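/- Call a reflexive canonical subpolytope of 4Δ₃ minimal if it does not properly contain any other reflexive canonical subpolytope of 4Δ₃. Up to the action of the group G of affine symmetries of 4Δ₃, there are exactly 115 minimal polytopes; among these, exactly 29 admit exactly two regular unimodular central triangulations and exactly 86 admit exactly one. -/

import Mathlib

open Set MeasureTheory

noncomputable section

/-- Points of `ℝ³` with integer coordinates. -/
def latticePts : Set (Fin 3 → ℝ) := {x | ∀ i, ∃ n : ℤ, x i = (n : ℝ)}

/-- The point `(1,1,1)`. -/
def pOne : Fin 3 → ℝ := ![1, 1, 1]

/-- The tetrahedron `4Δ₃ = conv{(0,0,0),(4,0,0),(0,4,0),(0,0,4)}`. -/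
def Delta4 : Set (Fin 3 → ℝ) :=
  convexHull ℝ {![0, 0, 0], ![4, 0, 0], ![0, 4, 0], ![0, 0, 4]}

/-- A subpolytope of `4Δ₃`: a lattice polytope `P ⊆ 4Δ₃` with `P = conv(P ∩ ℤ³)`. -/
def IsSubpolytope (P : Set (Fin 3 → ℝ)) : Prop :=
  P ⊆ Delta4 ∧ P = convexHull ℝ (P ∩ latticePts)

/-- A canonical subpolytope of `4Δ₃`: a subpolytope with `(1,1,1)` in its interior
(this forces it to be `3`-dimensional). -/
def IsCanonicalSub (P : Set (Fin 3 → ℝ)) : Prop :=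
  IsSubpolytope P ∧ pOne ∈ interior P

/-- The standard inner product on `ℝⁿ`. -/
def dotp {n : ℕ} (a x : Fin n → ℝ) : ℝ := ∑ i, a i * x i

/-- Equivalence of subsets of `ℝ³` under the group of affine symmetries of `4Δ₃`. -/
def SymEquiv (P Q : Set (Fin 3 → ℝ)) : Prop :=
  ∃ g : (Fin 3 → ℝ) ≃ᵃ[ℝ] (Fin 3 → ℝ), g '' Delta4 = Delta4 ∧ g '' P = Q

/-- `F` is a facet of `P`: an exposed face of dimension `2`. -/
def IsFacetOf (F P : Set (Fin 3 → ℝ)) : Prop :=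
  ∃ (a : Fin 3 → ℝ) (b : ℝ),
    (∀ x ∈ P, b ≤ dotp a x) ∧ F = P ∩ {x | dotp a x = b} ∧
    Module.finrank ℝ (affineSpan ℝ F).direction = 2

/-- `P` (canonical, with interior lattice point `p`) is reflexive: every facet lies on an
integral hyperplane at lattice distance one from `p`. -/
def IsReflexive (P : Set (Fin 3 → ℝ)) (p : Fin 3 → ℝ) : Prop :=
  ∀ F, IsFacetOf F P →
    ∃ (a : Fin 3 → ℤ) (b : ℤ),
      (∀ x ∈ F, dotp (fun i => (a i : ℝ)) x = (b : ℝ)) ∧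
      (∀ x ∈ P, (b : ℝ) ≤ dotp (fun i => (a i : ℝ)) x) ∧
      dotp (fun i => (a i : ℝ)) p = (b : ℝ) + 1

/-- `T` is a triangulation of `P`: a finite collection of simplices (given by their
vertex sets, which are affinely independent sets of lattice points of `P`) whose union
is `P`, closed under taking faces, any two meeting in a common face. -/
def IsTriangulationOf (P : Set (Fin 3 → ℝ)) (T : Set (Finset (Fin 3 → ℝ))) : Prop :=
  T.Finite ∧
  (∀ S ∈ T, (S : Set (Fin 3 → ℝ)) ⊆ P ∩ latticePts ∧
    AffineIndependent ℝ (fun v : (S : Set (Fin 3 → ℝ)) => (v : Fin 3 → ℝ))) ∧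
  (⋃ S ∈ T, convexHull ℝ (S : Set (Fin 3 → ℝ))) = P ∧
  (∀ S ∈ T, ∀ S' : Finset (Fin 3 → ℝ), S' ⊆ S → S' ∈ T) ∧
  (∀ S ∈ T, ∀ S' ∈ T, ∃ F : Finset (Fin 3 → ℝ), F ∈ T ∧ F ⊆ S ∧ F ⊆ S' ∧
    convexHull ℝ (S : Set (Fin 3 → ℝ)) ∩ convexHull ℝ (S' : Set (Fin 3 → ℝ)) =
      convexHull ℝ (F : Set (Fin 3 → ℝ)))

/-- `T` is central: every `3`-simplex of `T` contains `p`. -/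
def IsCentral (p : Fin 3 → ℝ) (T : Set (Finset (Fin 3 → ℝ))) : Prop :=
  ∀ S ∈ T, S.card = 4 → p ∈ convexHull ℝ (S : Set (Fin 3 → ℝ))

/-- `T` is unimodular: every `3`-simplex of `T` has Euclidean volume `1/6`. -/
def IsUnimodular (T : Set (Finset (Fin 3 → ℝ))) : Prop :=
  ∀ S ∈ T, S.card = 4 →
    volume (convexHull ℝ (S : Set (Fin 3 → ℝ))) = ENNReal.ofReal (1 / 6)

/-- `T` is fine: every lattice point of `P` is a vertex of a simplex of `T`. -/
def IsFine (P : Set (Fin 3 → ℝ)) (T : Set (Finset (Fin 3 → ℝ))) : Prop :=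
  ∀ x ∈ P ∩ latticePts, ∃ S ∈ T, x ∈ S

/-- The weight function `w` induces the triangulation `T` of `P`
(it is a regularity certificate for `T`). -/
def Induces (P : Set (Fin 3 → ℝ)) (T : Set (Finset (Fin 3 → ℝ))) (w : (Fin 3 → ℝ) → ℝ) :
    Prop :=
  ∀ S ∈ T, S.card = 4 → ∃ ℓ : (Fin 3 → ℝ) →ᵃ[ℝ] ℝ,
    (∀ v ∈ S, ℓ v = w v) ∧ ∀ v ∈ P ∩ latticePts, v ∉ S → ℓ v < w v

/-- `T` is a regular triangulation of `P`. -/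
def IsRegularTriang (P : Set (Fin 3 → ℝ)) (T : Set (Finset (Fin 3 → ℝ))) : Prop :=
  ∃ w : (Fin 3 → ℝ) → ℝ, Induces P T w

/-- A minimal reflexive canonical subpolytope of `4Δ₃`: one that does not properly
contain any other reflexive canonical subpolytope of `4Δ₃`. -/
def IsMinimalRefl (P : Set (Fin 3 → ℝ)) : Prop :=
  IsCanonicalSub P ∧ IsReflexive P pOne ∧
  ∀ Q : Set (Fin 3 → ℝ), IsCanonicalSub Q → IsReflexive Q pOne → ¬ Q ⊂ P

/-- `T` is a regular unimodular central triangulation of `P`. -/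
def IsRUC (P : Set (Fin 3 → ℝ)) (T : Set (Finset (Fin 3 → ℝ))) : Prop :=
  IsTriangulationOf P T ∧ IsCentral pOne T ∧ IsUnimodular T ∧ IsRegularTriang P T

local notation "ℝ³" => Fin 3 → ℝ

/-- Integer vectors, as displacements from the point `(1,1,1)`. -/
structure Z3 where
  x : ℤ
  y : ℤ
  z : ℤ

namespace Z3

def dot (a b : Z3) : ℤ := a.x * b.x + a.y * b.y + a.z * b.z

def cross (a b : Z3) : Z3 :=
  ⟨a.y * b.z - a.z * b.y, a.z * b.x - a.x * b.z, a.x * b.y - a.y * b.x⟩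

def det (u v w : Z3) : ℤ := u.dot (v.cross w)

/-- The linear form taking the values `a`, `b`, `c` at `u`, `v`, `w`, times `det u v w`. -/
def interp (u v w : Z3) (a b c : ℤ) : Z3 :=
  ⟨a * (v.cross w).x + b * (w.cross u).x + c * (u.cross v).x,
   a * (v.cross w).y + b * (w.cross u).y + c * (u.cross v).y,
   a * (v.cross w).z + b * (w.cross u).z + c * (u.cross v).z⟩

/-- Integer vectors with small entries, packed in base `32`. -/
def unpack (n : ℕ) : Z3 :=
  ⟨Int.sub (n % 32 : ℕ) 16, Int.sub (n / 32 % 32 : ℕ) 16, Int.sub (n / 1024 : ℕ) 16⟩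

end Z3

/-- The lattice point `(x,y,z)` of `4Δ₃` has index `x + 5y + 25z`; this is the displacement of the
point with a given index from `(1,1,1)`. -/
def disp (i : ℕ) : Z3 :=
  ⟨Int.sub (i % 5 : ℕ) 1, Int.sub (i / 5 % 5 : ℕ) 1, Int.sub (i / 25 : ℕ) 1⟩

/-- The indices of the lattice points of `4Δ₃` other than `(1,1,1)`. -/
def ptIdx : List ℕ :=
  [0, 1, 2, 3, 4, 5, 6, 7, 8, 10, 11, 12, 15, 16, 20, 25, 26, 27, 28, 30, 32, 35, 36, 40, 50, 51,
    52, 55, 56, 60, 75, 76, 80, 100]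

def intNeg : ℤ → Bool
  | .ofNat _ => false
  | .negSucc _ => true

/-- The identity function applied to an evaluated numeral. -/
def force {α : Type} (n : ℕ) (k : ℕ → α) : α := Nat.rec (k 0) (fun m _ => k (Nat.succ m)) n

theorem force_eq {α : Type} (n : ℕ) (k : ℕ → α) : force n k = k n := by
  cases n <;> rfl

def maskOf (l : List ℕ) : ℕ := l.foldr (fun i m => Nat.lor (2 ^ i) m) 0

/-- A clause on subsets of the lattice points: the set meets the first mask or misses
a point of the second. -/
abbrev Clause := ℕ × ℕ

inductive ClauseTree
  | leaf (pos neg : ℕ)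
  | node (l r : ClauseTree)

namespace ClauseTree

def lookup : ℕ → ClauseTree → ℕ → Clause
  | 0, leaf p n, _ => (p, n)
  | 0, node _ _, _ => (1, 1)
  | _ + 1, leaf p n, _ => (p, n)
  | d + 1, node l r, i => bif Nat.ble (2 ^ d) i then lookup d r (i - 2 ^ d) else lookup d l i

/-- Builds a tree of the given depth from a list of clauses, padded with a tautology. -/
def build {α : Type} : ℕ → List Clause → (ClauseTree → List Clause → α) → α
  | 0, [], k => k (leaf 1 1) []
  | 0, c :: l, k => force c.1 fun p => force c.2 fun n => k (leaf p n) l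
  | d + 1, l, k => build d l fun t₁ l₁ => build d l₁ fun t₂ l₂ => k (node t₁ t₂) l₂

end ClauseTree

/-- Replays a refutation tree, stored as a stream of packed 13-bit entries. Entries below `128` are
case distinctions on a point, the others refer to clauses. -/
def replay (t : ClauseTree) : ℕ → ℕ → List ℕ → ℕ → ℕ → Option (ℕ × List ℕ)
  | 0, _, _, _, _ => none
  | f + 1, s, rest, T, F =>
    force (s % 8192) fun e => force (s / 8192) fun s' =>
      bif Nat.beq e 0 then
        match rest with
        | [] => none
        | c :: rest' => replay t f c rest' T F
      else bif Nat.ble 128 e then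
        match t.lookup 13 (e - 128) with
        | (p, n) =>
          force (Nat.xor p (Nat.land p F)) fun p' => force (Nat.xor n (Nat.land n T)) fun n' =>
            bif Nat.beq n' 0 then
              bif Nat.beq p' 0 then some (s', rest)
              else bif Nat.beq p' (2 ^ Nat.log2 p') then
                force (Nat.lor T p') fun T' => replay t f s' rest T' F
              else none
            else bif Nat.beq p' 0 then
              bif Nat.beq n' (2 ^ Nat.log2 n') then
                force (Nat.lor F n') fun F' => replay t f s' rest T F'
              else none
            else none
      else
        force (2 ^ (e - 1)) fun b =>
          match force (Nat.lor T b) fun T' => replay t f s' rest T' F with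
          | none => none
          | some (s'', rest'') => force (Nat.lor F b) fun F' => replay t f s'' rest'' T F'

/-- Some point lies strictly on the negative side of a plane through `(1,1,1)`. -/
def halfspaceClause (c : Z3) : Clause :=
  bif c.dot c == 0 then (1, 1) else (maskOf (ptIdx.filter fun i => intNeg (c.dot (disp i))), 0)

/-- If `s · x = -d` is the plane through three points, with `d > 0`, and has lattice distance
greater than one from `(1,1,1)`, then some point lies beyond it. -/
def planeClauseAux (i j k : ℕ) (s : Z3) (d : ℤ) : Clause :=
  bif intNeg (-d) && !(s.x % d == 0 && s.y % d == 0 && s.z % d == 0) then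
    (maskOf (ptIdx.filter fun l => intNeg (s.dot (disp l) + d)), maskOf [i, j, k])
  else (1, 1)

def planeClause (m : ℕ) : Clause :=
  let i := m % 128
  let j := m / 128 % 128
  let k := m / 16384
  let d := (disp i).det (disp j) (disp k)
  bif intNeg d then planeClauseAux i j k ((disp i).interp (disp j) (disp k) 1 1 1) (-d)
  else planeClauseAux i j k ((disp i).interp (disp j) (disp k) (-1) (-1) (-1)) d

/-- A convex combination of three points belongs to the set if these points do. -/
def convexClause (m : ℕ) : Clause :=
  let i := m % 128
  let j := m / 128 % 128
  let k := m / 16384 % 128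
  let l := m / 2097152 % 128
  let a := m / 268435456 % 128
  let b := m / 34359738368 % 128
  let c := m / 4398046511104
  bif !(a + b + c == 0) &&
      ((a + b + c) * (l % 5) == a * (i % 5) + b * (j % 5) + c * (k % 5) &&
       (a + b + c) * (l / 5 % 5) == a * (i / 5 % 5) + b * (j / 5 % 5) + c * (k / 5 % 5) &&
       (a + b + c) * (l / 25) == a * (i / 25) + b * (j / 25) + c * (k / 25)) then
    (2 ^ l, maskOf [i, j, k])
  else (1, 1)

/-- The `k`-th barycentric coordinate (up to the factor `4`) of a lattice point of `4Δ₃`. -/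
def baryIdx (i k : ℕ) : ℕ :=
  match k with
  | 0 => i % 5
  | 1 => i / 5 % 5
  | 2 => i / 25
  | _ => 4 - (i % 5 + i / 5 % 5 + i / 25)

/-- The first three values of the permutations of four coordinates. -/
def permCodes : List (ℕ × ℕ × ℕ) :=
  [(0, 1, 2), (0, 1, 3), (0, 2, 1), (0, 2, 3), (0, 3, 1), (0, 3, 2), (1, 0, 2), (1, 0, 3),
    (1, 2, 0), (1, 2, 3), (1, 3, 0), (1, 3, 2), (2, 0, 1), (2, 0, 3), (2, 1, 0), (2, 1, 3), (2, 3, 0),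
    (2, 3, 1), (3, 0, 1), (3, 0, 2), (3, 1, 0), (3, 1, 2), (3, 2, 0), (3, 2, 1)]

def permIdx (s : ℕ × ℕ × ℕ) (i : ℕ) : ℕ :=
  baryIdx i s.1 + 5 * baryIdx i s.2.1 + 25 * baryIdx i s.2.2

/-- The lattice points other than `(1,1,1)` at which the given linear forms are at least `-1`. -/
def ptsOf (A : List Z3) : List ℕ :=
  ptIdx.filter fun i => A.all fun a => !intNeg (a.dot (disp i) + 1)

def halfspaceNormals : List ℕ := [
  15825, 15823, 14833, 18929, 18991, 15887, 18993, 16944, 13775, 20049, 15821, 18995, 15922,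
  16911, 15856, 15854, 20018, 16880, 17999, 15790, 17902, 17904, 16881, 18001, 16879, 15889,
  18003, 16945, 17937, 14831, 17969, 16913, 14895, 17936, 15888, 13806, 16943, 17871, 17968,
  15855, 14767, 14829, 15918, 15920, 17935, 19057, 15953, 18034, 17906, 17970]

def planeTriples : List ℕ := [
  265344, 268544, 271744, 274944, 268569, 271769, 274969, 271794, 274994, 275019, 134272, 137472,
  140672, 143872, 137497, 140697, 143897, 140722, 143922, 143947, 1245824, 1246464, 1247104,
  1247744, 1246469, 1247109, 1247749, 1247114, 1247754, 1247759, 459392, 460032, 460672, 461312,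
  460037, 460677, 461317, 460682, 461322, 461327, 839424, 843264, 843294, 1249024, 1252864,
  1252894, 184064, 187904, 187934, 265984, 269824, 269854, 433024, 859008, 855351, 842624,
  1252224, 187264, 596864, 269184, 449408, 465792, 26624, 43008, 59392, 75776, 32976, 49360,
  65744, 49488, 65872, 66000, 436224, 862208, 855376, 845824, 1255424, 190464, 600064, 272384,
  452608, 468992, 840064, 1249664, 102784, 201088, 197411, 921984, 184704, 266624, 119168, 135552,
  21504, 37888, 54272, 70656, 32936, 49320, 65704, 49448, 65832, 65960, 840704, 1250304, 103424,
  201728, 197416, 922624, 185344, 267264, 119808, 136192, 118016, 121344, 121370, 134400, 137728,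
  137754, 121216, 530816, 137600, 124416, 534016, 140800, 443136, 200064, 200070, 459520, 460288,
  460294, 449536, 465920, 443776, 525696, 460160, 119296, 135680, 444416, 526336, 460800, 118144,
  134528, 459648, 134656, 17049, 33433, 49817, 66201, 1249049, 1249689, 1250329, 1249694, 1250334,
  1250339, 842649, 1252249, 187289, 269209, 859033, 56217, 72601, 436249, 452633, 469017, 445776,
  462160, 462288, 845849, 1255449, 190489, 600089, 272409, 43033, 862233, 59417, 75801, 17689,
  1246489, 99609, 34073, 33561, 918809, 115993, 66841, 66457, 50457, 132377, 843289, 1252889,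
  106009, 925209, 859673, 859161, 187929, 269849, 18329, 837529, 1247129, 100249, 919449, 182169,
  116633, 51097, 116121, 50585, 50073, 34713, 198553, 133017, 67481, 18969, 838169, 1247769,
  100889, 920089, 182809, 35353, 34201, 264729, 199193, 133657, 68121, 198681, 133145, 67609,
  132633, 67097, 66585, 117273, 51737, 121241, 137625, 124441, 534041, 140825, 852761, 49945,
  66329, 39961, 56345, 72729, 132505, 66969, 34841, 116761, 51225, 121369, 137753, 50713, 17074,
  426674, 33458, 36101, 590514, 262834, 443058, 66226, 68997, 49842, 459442, 20274, 17714, 17694,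
  53042, 50482, 50462, 1252274, 1252914, 1252919, 465842, 466482, 466487, 845874, 862258, 858576,
  1255474, 190514, 272434, 452658, 75826, 69072, 59442, 469042, 20914, 18994, 18979, 1249714,
  1247794, 1247779, 102834, 100914, 100899, 922034, 920114, 920099, 18354, 427954, 34738, 36111,
  1247154, 100274, 919474, 591794, 21554, 840754, 857138, 858536, 1250354, 103474, 922674, 185394,
  524466, 131250, 124466, 140850, 443186, 66354, 68998, 49970, 459570, 449586, 72754, 69048,
  56370, 465970, 459698, 53298, 17099, 426699, 836299, 443083, 49867, 448901, 55685, 52613,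
  180939, 590539, 262859, 33483, 852683, 459467, 66251, 20299, 429899, 593739, 266059, 36683,
  462667, 69451, 23499, 20939, 18379, 20919, 18359, 18339, 1255499, 862283, 469067, 75851, 17739,
  427339, 99659, 34123, 33611, 918859, 591179, 263499, 24139, 1252939, 106059, 925259, 859723,
  859211, 532043, 73291, 69707, 466507, 138827, 21579, 431179, 1250379, 103499, 922699, 595019,
  529483, 463947, 528971, 463435, 462923, 857163, 201803, 136267, 70731, 19019, 428619, 1247819,
  100939, 920139, 592459, 854603, 856651, 264779, 199243, 133707, 68171, 198731, 133195, 67659,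
  132683, 67147, 66635, 526923, 461387, 114891, 524491, 131275, 527691, 134475, 852811, 459595,
  66379, 40011, 465995, 72779, 135755, 70219, 854091, 526411, 460875, 524619, 131403, 460363,
  17124, 426724, 836324, 33508, 39301, 1245924, 852708, 459492, 66276, 861701, 468485, 75269,
  465413, 72197, 69125, 180964, 590564, 262884, 443108, 49892, 20324, 429924, 839524, 36708,
  39326, 184164, 593764, 266084, 446308, 53092, 23524, 17764, 17719, 433124, 427364, 427319,
  596964, 591204, 591159, 269284, 263524, 263479, 26724, 24164, 21604, 19044, 24144, 21584, 19024,
  21564, 19004, 18984, 59492, 56932, 54372, 51812, 56912, 54352, 51792, 54332, 51772, 51752,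
  20964, 430564, 102884, 922084, 201188, 203811, 594404, 266724, 528868, 135652, 18404, 428004,
  1247204, 853988, 460772, 67556, 861711, 468495, 75279, 465423, 72207, 69135, 100324, 919524,
  198628, 203791, 591844, 264164, 526308, 133092, 114916, 524516, 131300, 118116, 527716, 134500,
  530916, 524644, 524595, 137700, 131428, 131379, 443236, 50020, 449636, 200164, 200120, 56420,
  50788, 50744, 525796, 132580, 447076, 119396, 53860, 444516, 116836, 51300, 527844, 134628,
  53348, 131556, 265989, 269189, 272389, 269214, 272414, 272439, 840069, 1249669, 184709, 266629,
  201093, 53637, 70021, 433669, 843269, 1252869, 187909, 597509, 204293, 201221, 269829, 840709,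
  1250309, 103429, 119813, 136197, 115496, 131880, 132008, 922629, 185349, 267269, 37893, 201733,
  54277, 70661, 199941, 52485, 68869, 465285, 72069, 42501, 452101, 58885, 443781, 460165, 37381,
  53765, 70149, 444421, 526341, 460805, 200069, 55813, 460293, 18334, 1247134, 100254, 919454,
  34718, 133022, 67486, 18974, 838174, 1247774, 100894, 920094, 182814, 35358, 34206, 117278,
  51742, 852126, 196766, 72094, 42526, 452126, 58910, 66974, 34846, 116766, 51230, 55838, 50718,
  21559, 1250359, 103479, 922679, 857143, 136247, 70711, 18999, 428599, 1247799, 100919, 920119,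
  592439, 854583, 856631, 526903, 461367, 442551, 852151, 458935, 68919, 42551, 206391, 70199,
  854071, 526391, 460855, 459063, 460343, 17744, 427344, 836944, 181584, 197968, 198096, 591184,
  263504, 20944, 430544, 594384, 266704, 201168, 463312, 70096, 18384, 427984, 100304, 919504,
  526288, 133072, 531471, 138255, 135183, 591824, 264144, 853968, 198608, 460752, 67536, 442576,
  852176, 458960, 52560, 68944, 203216, 465360, 72144, 853456, 460240, 67024, 447056, 53840,
  444496, 116816, 51280, 459088, 200144, 50768, 266634, 269834, 269859, 135562, 138762, 138787,
  840714, 1250314, 185354, 201738, 198056, 267274, 119818, 70666, 66472, 54282, 136202, 524426,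
  458890, 118026, 68874, 66458, 52490, 134410, 119306, 70154, 66468, 53770, 135690, 444426,
  460810, 134538, 53258, 114851, 196771, 131235, 534051, 206371, 140835, 66339, 72739, 34851,
  854051, 131363, 137763, 18364, 427964, 591804, 198588, 201231, 264124, 526268, 67516, 69647,
  460732, 133052, 530876, 72124, 69683, 465340, 137660, 124476, 58940, 525756, 67004, 69643,
  460220, 132540, 444476, 51260, 134588, 459708, 267279, 201743, 136207, 70671, 442511, 524431,
  458895, 199951, 134415, 68879, 534031, 206351, 140815, 525071, 459535, 465935, 72719, 37391,
  135695, 70159, 524559, 459023, 137743, 114856, 196776, 131240, 203176, 137640, 72104, 452136,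
  124456, 58920, 49960, 66344, 121896, 56360, 853416, 132520, 66984, 131368, 121384, 55848,
  442516, 524436, 458900, 118036, 52500, 530836, 465300, 452116, 124436, 58900, 443156, 525076,
  459540, 449556, 121876, 56340, 525716, 524564, 524555, 460180, 459028, 459019, 119316, 121364,
  121380, 53780, 55828, 55844, 525204, 459668, 53268, 459156, 134401, 137601, 140801, 137626,
  140826, 140851, 459521, 460161, 460801, 460166, 460806, 460811, 465921, 135681, 118145, 200065,
  134529, 121345, 530945, 203265, 200705, 137729, 459649, 460289, 134657, 49946, 66330, 56346,
  72730, 132506, 66970, 51226, 459571, 66355, 465971, 72755, 135731, 70195, 460851, 49996, 56396,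
  53836, 51276, 53816, 51256, 51236, 132556, 115020, 196940, 197580, 524620, 131404, 527820,
  200140, 134604, 53324, 50764, 131532, 53766, 70150, 460216, 67000, 135691, 70155, 442640,
  852240, 855440, 524560, 459024, 121360, 55824, 525200, 459664, 53264, 459152, 134530, 137730,
  137755, 459650, 460290, 460295, 134658, 53300, 50740, 50720, 131508, 459148, 134659]

def convexRelations : List ℕ := [
  34680609024, 34949047680, 69092779392, 35217486336, 34733044224, 103504949760, 34638660864,
  34691096064, 34907096960, 69008885632, 35175533056, 34649147904, 103379110400, 34630271232,
  34682706432, 34640758272, 34898706816, 68992106880, 35167142400, 34632368640, 103353942528,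
  34733450649, 35001889305, 69145621017, 34691502489, 34959938585, 69061727257, 34683112857,
  34951548441, 69044948505, 34786292274, 34691908914, 34744344114, 34702395954, 34683519282,
  34735954482, 34685616690, 34744750539, 35013183435, 69062543307, 34736360907, 35004793291,
  69045764555, 34745156964, 34797592164, 35066025060, 69115384932, 35334457956, 34755644004,
  103433177700, 34736767332, 34789202532, 34747254372, 35057634916, 69098606180, 35326067300,
  34738864740, 103408009828, 34691177349, 34959616005, 69103347717, 34649229189, 34917665285,
  69019453957, 34640839557, 34909275141, 69002675205, 34744018974, 34702070814, 34702477239,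
  34755318864, 35023751760, 69073111632, 34746929232, 35015361616, 69056332880, 34701745674,
  34659797514, 34640920842, 34651407882, 34643018250, 34713045564, 34746604092, 34704655932,
  34696266300, 34651489167, 34919924111, 69002838415, 34704330792, 34972765736, 69055680040,
  34651570452, 34704005652, 34662057492, 34930492436, 69013406740, 35198927380, 34653667860,
  103364755988, 34682722689, 34951161345, 69094893057, 34640774529, 34909210625, 69010999297,
  34632384897, 34900820481, 68994220545, 34735564314, 34685226522, 34685632947, 34746864204,
  35015297100, 69064656972, 34738474572, 35006906956, 69047878220, 34651342854, 34642953222,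
  34704590904, 34696201272, 34643034507, 34695876132, 34653602832, 34922037776, 69004952080,
  34684836354, 34642888194, 34634498562, 34696136244, 34687746612, 34645148172, 8830784690432,
  8899503839488, 4432738261248, 4467097671936, 13263190533504, 13229099640192, 4432737854848,
  13263996331392, 13332983915904, 8830784287232, 17627414589952, 17696670609920, 8831321649664,
  4433006375424, 4467097508736, 4432738179968, 4501725764480, 4467366435712, 4536354020224,
  4432737773568, 8831053129728, 8900309149696, 4433006700544, 4467634546688, 4432737851673,
  4433006369049, 8830784284057, 8831321236889, 8831858189721, 13229099233817, 13229904622105,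
  13230710010393, 4432738583193, 4432737770393, 4433006287769, 4433274805145, 8831052720153,
  8831589672985, 8832126625817, 4433007019289, 4433274723865, 4433543241241, 4432738173618,
  4467098321586, 4433006281394, 4467366429362, 4467634537138, 4432737764043, 4467097912011,
  4501458059979, 4501725758155, 4536085906123, 4570713752267, 4467097502436, 4501457650404,
  4535817798372, 4570445234916, 4604805382884, 4673792967396, 13263243781504, 13366322668928,
  13469401556352, 17695649624576, 8830837535232, 8899556274688, 17764906054144, 4467150107136,
  4535869417472, 4501510088704, 4467150759936, 4604857411584, 4570498082816, 4673845405696,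
  8830837532057, 8899556681113, 8968275830169, 13263243375129, 13229152481817, 13332230959641,
  4432790696473, 13367127650841, 4501509679129, 4467150350361, 4432791021593, 4536137934873,
  4501778606105, 4570766190617, 4432790693298, 4467150103986, 8830837125682, 4432790286898,
  8831374078514, 4433058804274, 4467149940786, 4432790612018, 4467418458162, 4433059129394,
  4467686975538, 8831105958603, 8831642501835, 8832179045067, 4432791015243, 4433059123019,
  4433327230795, 4432790202443, 4433059448139, 4433327555915, 4433595663691, 8831105549028,
  4432791012068, 4433058710244, 8900361978596, 4467686965988, 4432790605668, 4467150753636,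
  4467418451812, 4501778599780, 4536406445924, 17626888280320, 26423249741184, 13263201183104,
  35287793398272, 35219611202048, 8830794936832, 13228841769856, 13331920657280, 22093653862400,
  22025203230720, 22128550553600, 8899514326528, 8830795259392, 4467108158976, 8830794933657,
  26457340637721, 13229109883417, 8865154669465, 17661247612953, 17661784565785, 8865154588185,
  4432748420633, 17626887877170, 13228841763506, 13228841363506, 8830795253042, 8830794849842,
  4432748742578, 17661248013003, 17661784556235, 8865154666315, 8865154991435, 4432748414283,
  22025202811620, 22093654262500, 22128550544100, 13228841357156, 13331920654180, 8830794843492,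
  8899514729828, 4467108152676, 8830795258757, 8899514407813, 13263201101829, 13229110208517,
  4432748423173, 4467108077061, 4432748748293, 4501736332805, 4432748419998, 8830794852382,
  8831331805214, 4432748338718, 4433016856094, 4432748741943, 4433016849719, 4432748332368,
  4467108480336, 4501736326480, 8830776170752, 8899495254272, 4432729676032, 4467089021184,
  13263182013824, 13229091120512, 4432729269632, 13263987746176, 13332975265152, 8830775767552,
  17627406070272, 17696662024704, 8831313064448, 4432997724672, 4467088988544, 4432729659776,
  4501717178752, 4467357849984, 4536345368960, 4432729253376, 8831044609536, 8900300563968,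
  4432998114816, 4467625895424, 4432729266457, 4432997718297, 8830775764377, 8831312651673,
  8831849538969, 13229090714137, 13229896036889, 13230701359641, 4432730063001, 4432729250201,
  4432997702041, 4433266153881, 8831044199961, 8831581087257, 8832117974553, 4432998498585,
  4433266137625, 4433534589465, 4432729653426, 4467089801394, 4432997695666, 4467357843634,
  4467625885874, 4432729243851, 4467089391819, 4501449539787, 4501717172427, 4536077320395,
  4570705101003, 4467088982244, 4501449130212, 4535809278180, 4570436649188, 4604796797156,
  4673784316132, 13263235261824, 13366314083712, 13469392905600, 17695641104896, 8830829015552,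
  8899547689472, 17764897468928, 4467141456384, 4535860897280, 4501501568512, 4467142239744,
  4604848825856, 4570489497088, 4673836754432, 8830829012377, 8899548095897, 8968267179417,
  13263234855449, 13229143962137, 13332222374425, 4432782111257, 13367119000089, 4501501158937,
  4467141830169, 4432782501401, 4536129349145, 4501770020377, 4570757539353, 4432782108082,
  4467141453234, 8830828606002, 4432781701682, 8831365493298, 4433050153522, 4467141420594,
  4432782091826, 4467409872434, 4433050543666, 4467678324274, 8831097438411, 8831633916107,
  8832170393803, 4432782495051, 4433050537291, 4433318579531, 4432781682251, 4433050927435,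
  4433318969675, 4433587011915, 8831097028836, 4432782491876, 4433050124516, 8900353392868,
  4467678314724, 4432782085476, 4467142233444, 4467409866084, 4501770014052, 4536397794660,
  8830733894912, 8899453306112, 4432687400192, 4467047073024, 13263140063104, 13229048842112,
  4432687318912, 13263945467776, 13332933314432, 8830733814272, 17627363789312, 17696620071424,
  8831270783488, 4432955771392, 4467047040384, 4432687383936, 4501675230592, 4467315574144,
  4536303420800, 4432687302656, 8831002331136, 8900258613248, 4432955836416, 4467583944704,
  4432687318277, 4432955770117, 8830733813637, 8831270700933, 8831807588229, 13229048760837,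
  13229854083589, 13230659406341, 4432687464581, 4432687302021, 4432955753861, 4433224205701,
  8831002249221, 8831539136517, 8832076023813, 4432955900165, 4433224189445, 4433492641285,
  4432687382666, 4467047202954, 4432955752586, 4467315572874, 4467583942794, 4432687300751,
  4467047121039, 4501406941327, 4501675229327, 4536035049615, 4570663157903, 4467047039124,
  4501406859412, 4535766679700, 4570394706068, 4604754526356, 4673742373012, 8830839168612,
  8899558579812, 4432792264292, 4467151937124, 13263245743204, 13229154112612, 4432792589412,
  13264050328676, 13333038175332, 8830839491172, 17627469056612, 17696725338724, 8831375641188,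
  4433060629092, 4467152720484, 4432792654436, 4501780501092, 4467420435044, 4536408281700,
  4432792979556, 8831107598436, 8900363880548, 4433060694116, 4467688802404, 4432792591952,
  4433060634192, 8830839493712, 8831375971408, 8831912449104, 13229154437712, 13229959350864,
  13230764264016, 4432792331856, 4432792982096, 4433061024336, 4433329066576, 8831107926096,
  8831644403792, 8832180881488, 4433060764240, 4433329456720, 4433597498960, 4432792659516,
  4467152070204, 4433061029436, 4467420440124, 4467688810044, 4432792987176, 4467152397864,
  4501511808552, 4501780506152, 4536139916840, 4570768025128, 4467152725524, 4501512136212,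
  4535871546900, 4570499982868, 4604859393556, 4673847240212, 13263150712704, 13366229862272,
  13469309011840, 17695556880896, 8830744463872, 8899463793152, 17764813244928, 4467057560064,
  4535777003520, 4501417347072, 4467057690624, 4604764932096, 4570405275648, 4673752860672,
  8830744463237, 8899463874437, 8968183285637, 13263150631429, 13229059410437, 13332138478085,
  4432697887237, 13367035103749, 4501417265157, 4467057608709, 4432697952261, 4536045455365,
  4501685798917, 4570673645573, 4432697886602, 4467057559434, 8830744381962, 4432697805322,
  8831281269258, 4432966257162, 4467057526794, 4432697870346, 4467325978634, 4432966322186,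
  4467594430474, 8831012896911, 8831549702287, 8832086507663, 4432697950991, 4432966320911,
  4433234690831, 4432697788431, 4432966385935, 4433234755855, 4433503125775, 8831012814996,
  4432697950356, 4432966238356, 8900269179028, 4467594428564, 4432697869076, 4467057689364,
  4467325977364, 4501685797652, 4536313905940, 13263203144804, 13366282294372, 13469361443940,
  17695609719396, 8830796892772, 8899516631652, 17764865673828, 4467109988964, 4535830251620,
  4501470185572, 4467110119524, 4604817770596, 4570457704548, 4673805289572, 8830796895312,
  8899516306512, 8968235717712, 13263203469904, 13229111839312, 13332191316560, 4432750316112,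
  13367087532624, 4501470513232, 4467110447184, 4432750381136, 4536098293840, 4501738227792,
  4570726074448, 4432750318652, 4467109991484, 8830797220412, 4432750643772, 8831333698108,
  4433018686012, 4467110774844, 4432750708796, 4467378817084, 4433018751036, 4467646859324,
  8831065335336, 8831602140712, 8832138946088, 4432750386216, 4433018756136, 4433287126056,
  4432751036456, 4433018821160, 4433287191080, 4433555561000, 8831065662996, 4432750388756,
  4433019086356, 8900321617428, 4467646866964, 4432750713876, 4467110124564, 4467378822164,
  4501738232852, 4536366341140, 17626871306496, 26423232767360, 13263184143744, 35287776424448,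
  35219594228224, 8830777897472, 13228824795520, 13331903617408, 22093636888064, 22025186256384,
  22128533513728, 8899497351680, 8830778284544, 4467091118592, 8830777894297, 26457323663897,
  13229092844057, 8865137629593, 17661230638617, 17661767525913, 8865137613337, 4432731380249,
  17626870903346, 13228824789170, 13228824389170, 8830778278194, 8830777874994, 4432731767218,
  17661231038667, 17661767516363, 8865137626443, 8865138016587, 4432731373899, 22025185837284,
  22093637288164, 22128533504228, 13228824382820, 13331903614308, 8830777868644, 8899497754980,
  4467091112292, 8830778284417, 8899497367937, 13263184127489, 13229093234177, 4432731383297,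
  4467091102209, 4432731773441, 4501719292417, 4432731380122, 8830777878042, 8831314765338,
  4432731363866, 4432999815706, 4432731767091, 4432999809331, 4432731357516, 4467091505484,
  4501719286092, 17626829030656, 26423190488960, 13263142193024, 35287734471168, 35219551947264,
  8830735944192, 13228782519680, 13331861669248, 22093594937344, 22025143977984, 22128491563008,
  8899455403520, 8830736008704, 4467049170432, 8830735943557, 26457281710597, 13229050890757,
  8865095681413, 17661188687877, 17661725575173, 8865095665157, 4432689432069, 17626828950026,
  13228782518410, 13228782438410, 8830736007434, 8830735926794, 4432689496458, 17661188767887,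
  17661725573263, 8865095680783, 8865095745807, 4432689430799, 22025143894164, 22093595017364,
  22128491561108, 13228782437140, 13331861668628, 8830735925524, 8899455484180, 4467049169172,
  8830736008577, 8899455419777, 13263142176769, 13229050955777, 4432689432577, 4467049154049,
  4432689497601, 4501677344257, 4432689431942, 8830735927302, 8831272814598, 4432689415686,
  4432957867526, 4432689496331, 4432957866251, 4432689414416, 4467049234704, 4501677342992,
  17626881465956, 26423242921060, 13263194625124, 35287787309668, 35219604376164, 8830788373092,
  13228834951780, 13331914101348, 22093647775844, 22025196406884, 22128543991908, 8899508242020,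
  8830788437604, 4467101599332, 8830788375632, 26457334549072, 13229103319632, 8865148113488,
  17661241526352, 17661778004048, 8865148503632, 4432741860944, 17626881788476, 13228834956860,
  13228835276860, 8830788442684, 8830788765244, 4432741928508, 17661241206312, 17661778011688,
  8865148116008, 8865148181032, 4432741866024, 22025196742164, 22093647455764, 22128543999508,
  13228835281940, 13331914103828, 8830788770324, 8899507919380, 4467101604372, 8830788440652,
  8899507851852, 13263195015244, 13229103384652, 4432741861452, 4467101992524, 4432741926476,
  4501729773132, 4432741863992, 8830788765752, 8831325243448, 4432742254136, 4433010296376,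
  4432741931556, 4433010301476, 4432742259216, 4467101669904, 4501729778192]

def polytopeData : List (List ℕ × List ℕ) := [
  ([15853, 15857, 15985, 19953], []),
  ([15820, 15825, 15985, 17936, 17937, 17969], []),
  ([15853, 15857, 15919, 17903, 17907, 17969], []),
  ([15820, 15824, 15919, 15923, 17936, 17969], []),
  ([15853, 15857, 15919, 16944, 18928, 18932], []),
  ([15820, 15824, 15952, 15956, 17936], []),
  ([15853, 15858, 15919, 15920, 16944, 20978], []),
  ([15820, 15826, 16018, 17936], []),
  ([13773, 15821, 16944, 16947, 18992, 18995], []),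
  ([15821, 15823, 15920, 15922, 18992, 18994], []),
  ([12749, 15821, 15920, 18992, 18995], [8886937]),
  ([12749, 15920, 16845, 16913, 17970, 20016], []),
  ([13773, 15821, 15889, 17937, 18001, 20049], []),
  ([12749, 16845, 16913, 16977, 21073], []),
  ([12749, 15821, 16913, 16977, 17937, 20049], []),
  ([15821, 15824, 15920, 18992, 18995], [9152937]),
  ([14830, 14832, 16878, 16880, 16944, 16946, 18992, 18994], []),
  ([13773, 16845, 16944, 16947, 20016], [8886937]),
  ([15820, 15824, 15952, 20052], []),
  ([14762, 14767, 16944, 16945, 18002, 20052], []),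
  ([14762, 14768, 16944, 21110], []),
  ([15820, 15826, 15919, 18994], []),
  ([14762, 14770, 16944, 18994], []),
  ([14764, 14766, 16944, 16946, 18992, 18994], []),
  ([15821, 15825, 15953, 20049], []),
  ([14764, 14863, 17935, 17938, 18034], [8886937]),
  ([12749, 16913, 17869, 17937, 17970, 18034], []),
  ([15820, 15823, 15919, 15922, 18994], [6855081]),
  ([15820, 15823, 15952, 15955, 17936, 17937], []),
  ([15853, 15856, 15919, 15922, 18928, 18994], []),
  ([15853, 15856, 15952, 18928, 19027], [9083290]),
  ([15754, 15856, 15952, 19027], []),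
  ([15788, 15856, 15920, 17902, 17970, 18034], []),
  ([15754, 15856, 15889, 15985, 16913, 17936, 17969], [13207961]),
  ([13773, 17869, 18001, 18005], []),
  ([14797, 17869, 17971, 18067], []),
  ([15754, 15890, 16018, 17936], []),
  ([13707, 16881, 16977, 20049], []),
  ([15853, 15856, 15952, 18928, 18931], [9083290]),
  ([15821, 15920, 15923, 17869, 17968, 17971], []),
  ([15820, 15823, 15886, 15889, 18994, 19060], []),
  ([15820, 15824, 15886, 15890, 17936, 18002], []),
  ([15821, 15823, 15887, 15889, 17935, 17937, 18001, 18003], []),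
  ([14731, 14863, 16913, 17902, 17970, 18034], []),
  ([14764, 14830, 17935, 17938, 18001, 18004], []),
  ([14731, 14830, 17902, 18001, 18004], [8886937]),
  ([15754, 15886, 15890, 20118], []),
  ([15754, 15919, 15924, 17936, 17969, 17970], []),
  ([15754, 15952, 15958, 17936], []),
  ([12617, 16913, 17902, 17970, 18003, 18067], []),
  ([12617, 16913, 16977, 21073], []),
  ([13707, 15887, 16944, 16945, 18992, 18997], []),
  ([12617, 15887, 16913, 16944, 16945, 17970, 20016], [5810585]),
  ([14762, 14769, 16944, 16945, 17936, 17937, 17969], [6855081]),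
  ([15820, 15827, 15919, 15920, 16944, 17936, 17937], [9152937]),
  ([14762, 14772, 16944, 17936, 17937], [9152937]),
  ([15787, 15919, 15923, 20019], []),
  ([15820, 15822, 15952, 15954, 17936, 17938], []),
  ([15853, 15855, 15919, 15921, 17903, 17905, 17969, 17971], []),
  ([15820, 15822, 15919, 15921, 18994, 18996], []),
  ([15820, 15823, 15919, 17936, 17939, 18035], []),
  ([15820, 15822, 15886, 15888, 17936, 17938, 18002, 18004], []),
  ([15787, 15886, 15889, 18961, 19060], [10078619]),
  ([15820, 15823, 15919, 18994, 18997], [9148826]),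
  ([15787, 15886, 15889, 17903, 18002, 18005], []),
  ([15853, 15855, 15952, 15954, 18928, 18930], []),
  ([13773, 13776, 16944, 20016, 20019], [9152937]),
  ([14762, 14764, 17936, 17938, 18035, 18037], []),
  ([14762, 14765, 17936, 17939, 18035], [6855081]),
  ([14762, 14764, 16944, 16946, 18994, 18996], []),
  ([14762, 14765, 16944, 16945, 18994, 18997], []),
  ([15787, 15952, 15957, 17903, 17936, 17937], []),
  ([13773, 16944, 16947, 19917], []),
  ([12749, 15920, 16913, 16944, 16945, 17937, 19917], [5810585]),
  ([15787, 15855, 15888, 15952, 16913, 21077], []),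
  ([15787, 15889, 15985, 18961], []),
  ([15853, 15857, 17903, 18035], []),
  ([14762, 14768, 17936, 18035], []),
  ([14762, 14765, 16944, 16947, 17936, 20118], []),
  ([15754, 15853, 15856, 19027, 19126], [13207961]),
  ([14762, 14765, 17936, 18035, 18038], [8960666]),
  ([15754, 15853, 15856, 17936, 18035, 18038], []),
  ([13674, 17902, 18034, 18038], []),
  ([13773, 17935, 17939, 18001], []),
  ([15853, 15855, 17903, 17905, 18035, 18037], []),
  ([14762, 14771, 16944, 16945, 17936], [10009497]),
  ([13671, 17903, 18035, 18039], []),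
  ([13671, 16944, 16947, 20019], []),
  ([13671, 15855, 16913, 16946, 18961, 19126], []),
  ([15787, 15855, 15919, 16913, 18961, 19093], []),
  ([15787, 15855, 15919, 17903, 17971, 18035], []),
  ([13671, 15855, 16913, 16944, 16945, 18002, 21077], [6855081]),
  ([15787, 15889, 15922, 16018, 16913, 17903, 17936], [4754329]),
  ([12716, 16944, 16948, 21040], []),
  ([15853, 15859, 15952, 18928], []),
  ([15820, 15828, 15952, 17936], []),
  ([10635, 15920, 16913, 17970, 18994, 21040], []),
  ([10635, 16913, 16977, 23121], []),
  ([15820, 15824, 15886, 17936, 17940, 18002], []),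
  ([14762, 14766, 16944, 17936, 17940, 18002], []),
  ([15820, 15824, 15886, 16944, 18994, 18998], []),
  ([14762, 14766, 16944, 18994, 18998], []),
  ([12749, 15920, 16913, 16944, 22989], [5810585]),
  ([12650, 15824, 16881, 16913, 16944, 18001, 20049], [14195113]),
  ([10503, 16913, 16944, 17902, 17970, 18001, 18002], [10328473]),
  ([15820, 15919, 15925, 18994], []),
  ([15820, 15886, 15890, 17936, 18002, 18006], []),
  ([15820, 15952, 15960, 17936], []),
  ([10503, 16913, 16944, 17970, 20016], [7186845]),
  ([14762, 14774, 16944, 17936], []),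
  ([13671, 15855, 16913, 16944, 23193], [7047611]),
  ([13671, 16845, 16944, 16947, 20118], [8886937]),
  ([13671, 15855, 16845, 16913, 18035, 21209], []),
  ([14762, 16944, 16948, 18994], []),
  ([14762, 17936, 18035, 18041], [])]

def refutation : List ℕ := [
  175333562376269174238396090902641414900209691304810796578660465965512630649465164258225840129,
  2849968762845734210435711027370275239275357176419159575911214982276285248175388755422107189277,
  3146548730132613746311145619035305182233136979299103868997139362515515789906492194182351768637,
  1189649840635508312589924031555680047071747845497257458354110168267707001975296566708874694831,
  2813457291974837139306963547788909810956605992906904213598491189414873109623490260988197617705,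
  2033108632402965497046648183684194569463661492587472470068250795725490510353627350320385904364,
  82644678148976988998738046692059904290923019765040226247715585184639882206391904018409581591,
  82520787406641402982047454054553967937345456270209932404526672278110896191401001423861958731,
  4504345250606239687375945301560499438879137099886828737445443635976505166781118133762255857739,
  1231409075612924966493518085095117999992263362035400634424123608723836956754564051090594177191,
  1194866696717414357725453539267157154355086988640054326256705814469457630734632337157803205823,
  1237649673715919598327022141193338115810599506228918990271206644021139791136118161917936140445,
  1254955462923600604652056644071461000656324097929288976543985183362038999765896491004950470823,
  1274321311245212676299459287065274060304940633746759555848245590930817266510476746034719826069,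
  3901268080367313363780631313740223671386418675296032218697025086719808622865394046933899209444,
  3142377418903894428000747434113553563634712429781782566266549308808246685722832206006542561224,
  2024820740622423234448069654449833006776597121811930545011059686439805400810471006127935225985,
  57057837914928619593541310524782467359464063905180813535792636438532749536620889340036302806,
  4518603756243235952338460884298475740198382246314082226728541274226042587281813770111561115613,
  1271131277303236981376840534833764828812388241677912744231087065622354948465725361290011091111,
  4507087581913019994433181407554435471138877884410606209947564449262069774321995992650760398051,
  147991243507580121483461441973573782008484841131385247267007958108377885663311516365318620303,
  2765277221972212907384907863036298247447221721050518378961682375002482105866493935134781023459,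
  150758204519899064956208859316305868602551617325241817577766773826807150257395680690947850381,
  1178446701322160403957438408793738518038841605107244349736788833654256420126819912814563360940,
  3141409764464666936020963337085950683083526356175498491471757908930426412423741508135562744306,
  4390209678109996106218393489335936981110433212450589039857595670284846451306645699281970446369,
  4139640701372182459588457670935109517494634455989292811073946194700281529502929163239963164839,
  57187340906204785713557036762622464214880277770589514235713483305279462099858458006375202968,
  3381779139293779732593076896398989410967290928672612154320406236502078865256906433127090595798,
  1261070754081121905941968578011550031054289757852814558378103775357249068383992713094783926424,
  170568721470206960705373175894699043699860022336711313404358885885674623651667043917150528989,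
  1156316964269110194701503733134750141757977475856176537977671217506821578040988037722920624273,
  33667044630916487025872847928618293410993157540667200723555408064561018796981285356154504330,
  3540708235158030379638093632318877605882290256218988468263583315977459219956269467083533971594,
  2189820701807884805380265637275929267554018918566469544500188385190128053921231023192144732302,
  6619250101222873061657072845464644081702329403507189509376157924239737459256299352865417767,
  1188619960273699348012721351528505342927149485042033618485733225329600839258215296931793268326,
  1276351631868482834547666425536823974568141088989534964924929073800920343061925191212369743108,
  2475019849975149854342318500825405680492929948753058132070994497455838441127422504858294732311,
  3377653566539832655276443843304436341675883607186118955996583412337057774468773693199437578373,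
  135847698845610976318427150017530770272955390895534623094555929910570256219537991288602791442,
  131694207297143751580119955583608514632797151656664930302052058623352498161822139859007537155,
  170490393103920095193246614884333123576865780994185637632427403554328442293614841591916585041,
  602031413377080823934999467043603555285020666631414112977979599556050140739005201330186012825,
  12259395262887668554784495687829502020653396391134915861239126321199970844895195494632317009,
  3061976429456919155905943813953649641439940363638388168104522286246609134888327255306140083748,
  147764068001846771417709398153004250926278307175997182840560390338254206209960138423981932689,
  6203489774112501668022627540775706100367501933490041273980505754083701012630323114152281209,
  1185697048387268093306486402439022518237558671154050059106519600305916353380761901937610334215,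
  2006497003041562500627423204600398764299177503710383364717837671742477974037566528827888771149,
  147931167181762723806661816400618184222546918401980730891148522970282994877226746349504743370,
  135480591950786061035582519030704514261688114883812737416421442823822778197981174174284939316,
  4235464088095306660002768537089706376885073034102959173054840739496874149114625790511294695782,
  3467400179530823315689899036775610885912329752698493800463570773508442821840577442364450070692,
  239381211651559063276565545028817008677207403970446175181069291139218438275702145121375936676,
  1156122379463519306340922240201093506949449075819797606298106046545346507656892649115172872428,
  2490283586868207104563276123294137115616807775534261341534486678522407005298807497782145359953,
  2544518053179451416618029967947976956108498470663571956219549432086652578203084542461535037847,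
  146170769835666024415350925846061327693799401037292253038564169066512105484172117817436946577,
  148211567653589684103049763634625257870399978731813717754538760155649562040015669924582916263,
  3379460234324327908625995131748669451571490677329988677468013635955183755991924808134680019094,
  637656171394444292188282924880794758211254254950831534619941966504840115249391916101297761623,
  3750199773184799638729598474502321529736746651938939007255158499415799970389052195670245811311,
  191501830421192920491433366679486572474160386692071298075207987583431874172822502388136755388,
  1168382615597872216762993415548530055106326294556446649671868192631119601088753183920787406976,
  1234593761870952684545703732180401573478263557762557554058199357980099559056395371208232862904,
  156137651137911767613602850963692263118420227125193691113623442453427522697287428963928321033,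
  2491593798776214435693506326500259263177319892077052333707738997805642249973728334678303817805,
  27846390134580933340911980681601922441440533228938459825687030413162780095760766900756491267,
  2925452371510661774430126763053540629063068772050485572764868038243356305233942007821319471132,
  2171729776407569908937765191253627216664784145641069518357800714308692036191920257285865402545,
  1239686850032582590419788234033809783568953157956335041710812753442856569263604156195786779038,
  1227844135331864773092160114147172921114900299193662714852528972156319844294336256898179605731,
  3357183742126849411097552204091579751303277304407993633917174169533034269681840626201260671002,
  1709224264429043314881364015144042023811784955806436737238782320508730808140039634680742387966,
  1210019573826501842137886990082136439489385576107358908865081681845991263082986264555833884801,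
  237845229004867323746491367094511984822971255345565696383305044525972559673710208102460908718,
  3753650990583165145496962839858687830175284645584630535146786856242561254031076729437990731909,
  915762566871495067186084001250246831165074770579680405129262696115745107279293527834519421095,
  3893950570941648014503142544606264381254924543811864170493208028839133960384701773372112273550,
  4341222959742565947787420758135459882539251211906629138203673810091408612689656230943901687810,
  1282334307000930088485805696976379645053203271461756774723869491629518628546055130268499738757,
  1228474058789961105438918825675794542502829101813319523154406721047760643015221164850205117443,
  3055805229301208565898001230342191364338446253987076394596496765717717501573769623073566458,
  2449686467845716169720999340152957215701697256677203931718823832598248220978797555842270692536,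
  338189374633456786616525601613960255581616244507534265606304014956858176860686973491476613499,
  1180810104093709079967472681234441085954141592211345998213032944723217857797988164149572763984,
  2031169818434888170261181122597768823947090172441512652352711065388250552358521303792754991237,
  2080064910061953868564623843898279719070753651712871031766794780157690166381314337620316326674,
  146170547583897748490798277424418742758986890209198790978178907460377917342469742025098660626,
  4011046800815690944708562370209621368217416155959790833084114256694248542754903859297547632657,
  165135685423400382239024224136314903043015586089745466955626693076327455143166669787216798684,
  175686822011731752217498230435368371966636583929945824814546078292033786078680436218832814790,
  3397796192704003154350487066817916678902584284696889170557197591293831142258712460869371274465,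
  3151298512263616860287570927522699311465474004372626576795180711694549885431737892672999443910,
  175490114595300640700480025589291229037459436499864816957024016817523757117351203012344990982,
  143960800998138924438629990323183983186178244503253075310194105990318075314633336825457247176,
  175203541596217171397825967894849982138573532096842161328561042429664641616183790575886345334,
  2645111421097075554617250949574540620689934338262165035634369917417958985755086535202155039768,
  2226501087689303185295117329002104037551780347719655053016237120699230269587598785548150391044,
  58081390945545193879243349159682046299422883067766180774074864041016090737835542826065002658,
  175636096164946462182783735348268583818821048765535571298356411503226932451918062783337637816,
  3665010324528954237359934840071593345992708152285151148716057453877400992553974455877211504782,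
  314760354374998512985429446364000726804127505433936003096055809324784338966265197927625436734,
  1166506963225773438789948238702416191057653034428541585469419474798451523553045779099060953229,
  1280433289616532840269973186124787221183692758042486453493562937608670896375956051834371712208,
  165509470396633838711201972642519787252611060240293146966294409855392482848257683206559622378,
  28522361870215083315654055696557790009565479654769803905156192919068795295251374771780904141,
  2481113054235441265613452471739646013196591406295733001767913212362438580678892441413939906927,
  1130557099584516319333092051275916980177820824395190413654584670251656742927728134035480760316,
  1279400828390343036213558582442874917648890385188331796844065535728595280928552839398946391125,
  62148684432856914672430546238053586886742563818896304227838395820114853231168173974183620352,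
  144879851348770613831084979168881910568944244808708948762388348151825779341043565093899961457,
  287238626116006898297531828799064014473376158928937143699227611078726690458373472406570371036,
  162979431565528103157650990164746358537961158335338975813689833284324106192684053661663822086,
  2201268165186015527173877744728855868939186298037758036908878689401052190917078330949772864164,
  223082547061744282408538545823858522733233254377610600526756766532219690729723005768937442027,
  782317063984811935923109923043156409501682552674703598701730095441546267199379694888004288772,
  6266539865658662710830367976568353272055071687664885823747757864868842562553924881404395802,
  3700722375268833199062852490009719992604028380871093144496959459546114779870638078122714664905,
  152264638876147769858064459407398852649806526542921716226961655936041007275607629013555847317,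
  168074047890359881318113836857366966141141890502219183528313485098479877466965745223276036241,
  9743683683047528312008277563953985204246214219227470843572378122326771909483903448753164281,
  26498022115236041120216687762460548720734184832671975160185690198969763297831702911073479692,
  1305889275847051393905856767025371267936754426869615374625930227271535819178936434393257643980,
  4816114069875679933143341669267811343122825142809332472490938643213260359894189237485183172753,
  1262086212751153451895397108560514453229557039175494909616878831867855249578204707541671773305,
  2478353796524945849278910788789756420289878531703393901831579233351039003379714904943880406957,
  2768631186270370081228697429395934799169607252683253979187958302397967628641344011082499533263,
  1271656078696180521370060645939772447318117232909860159636158389921626089989938548799815201181,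
  1271126988857957586634596212835576617101498355404867942258492110372992148262080417671429785515,
  1222787790445850883207035675313205470685354039887683196958777539220364753450228213042002530765,
  2922283540398123074405512927203368133445287731961314322053141443151186014414704889159156450099,
  1271259153631335156191231797204998709910254736050979738409216342728125818465336323022129619085,
  348336509310249123589665031803811810075536099329392907371153887690693325505404393965882917133,
  2459739038737532506353829357408021212564885587978529115176434063340544266455801330904380264795,
  4657217083765883169381238648623547723773649000948322108394297086980226302607732165068026120865,
  29072024538436158514304774223950549769692860238421935609287589028992609862493447405356654759,
  339195585496008842414918488601288363554699172285313049274561103273971666670546658110838524059,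
  4372814518667267425442129743450506611257713356227504868203990257281873108424525993180064325784,
  755773421526562986808585015370917060587473401667484975602151021202746062023658107937890562263,
  4461128994676120053291820797766791581447433229075870858746474272302849747303404639300413874343,
  1179999980811260509437783282856095529526644836794176846219884061581007157035763403143159107892,
  287254714820529617346475323395799611514758593198245692885235862821293009793102003872377250100,
  2593166950848115926146391702639317160319009000508421708687341697197975573686463107448751555754,
  7285041698636053306072808135471640780383780111309108352909932374087166438543492467413024775,
  2459724469492775697584937077346205582717422627687718341098481113992200601672123483308921302025,
  3923715136922569073982914179625667361145937731449652776086065847190306490268981526886045720582,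
  1085740426646774211719723067081921147412070184280078536055730255286593759284076036677288648853,
  241547801683837239325766014505590268523734343443059737430827941797234441836737605636809097365,
  254650635299871547893133541122827173616789959983256222615652248461535119755985325772683182315,
  1165772088253572463431753134017397864262106147454809838725599288115946662518906788796539740499,
  2449677998447014051706896583684100587198318817109449089240545467853159410570200434476493251808,
  1270092805962118005386460494213664422100528689421812398714057959101776747535809612698466742688,
  299010680989163351213253161867698539892798983732514170873382508565419988557784925727864417139,
  2179462473517509654841177354848189518359373610385509542406829053832439048824425768597947402,
  1100564330179060163510338497522823262518618761291733722223807058830094566324206455473607156944,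
  7147161357801637788580388173817770775221902578568296971829916935010529700176496267626824933,
  4664848443881173267250280212367474871040452244230298412015998607005634627268151099855546556428,
  153321586844766467911768440685035638252837859631898082517553580386298231897002565034837155968,
  4576207975480351925403767883960478194070398275585374232585464773844603814208653577291531822303,
  1255368681414386961434776064099970187663900479570191579474883623190192531294441012908254855313,
  313722585115387531681388466567051236050773530791815445617929797288778722030577210163180185124,
  58438342163561819023231247656422728536050001888919461749011748280927494377361253777716330525,
  1601258730527067881571887696217475965052812770314873451273282878547418242745640346252027215949,
  143806756885793379260190244156165857206743109726973626408760276429589532020763387412412311081,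
  2192114541015799188719596340254737278098374080897250425238545853303734559647645579191050846519,
  3195242630181564651836657090528794404374219931832111374933390006056250783728847150246057208217,
  587756378084474112333826907552260587395070343623172919638091496906761323909375613196440505443,
  155198200880802590310602758379284784695169006741818229877744886527504481746602970480773210140,
  4344327751471226059223226214294255721193309495817278586270439455054604080374023554665462827681,
  2424318862696546622141368005905513392415437639172607357328309417224103869329646838182053028007,
  2046450058739095108082565508896580457587590632767015176809308693026238739003093590544603859286,
  1174370188956355702385801351435063826435493745963335880654817798631157121597517425090456610921,
  2768482209933609464224048213351286250112847483609081990443942076064064467837884595588203601936,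
  3774966343296060719847072928385774181859590222047573632792877500680312316570330021256597400223,
  165020742094092081705072546794204626636680645586208021926306660384791295305484501557041430688,
  3121036551134621407853935213566145516885868046933552558078403072225257293471067716756381409308,
  3490809428755816090490505797289690968372882948489459368425202279524348745364576691689675083379,
  1177411909444463836537388337825898080761984926510008638149731681428959736099557076585801904299,
  17464760158393030333542580198908720606667058477432160145720906791538080670970199028141747266,
  3978669568225452588520237874641019871421984496516884769162001605626469453297188327173792736475,
  131891918870264850161515874577040315650679110879625455765608633065045517373306468659785007269,
  2371382439941201680939771431664781203974758198338025422624358964801978494906154966166978627944,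
  2235665014533057558417604902052412717381428378168818879210130377377271695782204635860160651409,
  2253998338094499341405559451982219181154555729276465516752819690056978542793622546857072634026,
  2191857053562629585010702715940326433716938020258683613590372265109204943461242692925494857577,
  3282059631676623920621096531497742411998056387406236956169663298056918437409668380064243453880,
  2855253817288909175709213092743139608541760780179581002546011015416881256123931160292307414240,
  2913208882013233408168968724119546800325191844014770400820998909087848646169970094428138802196,
  53998045985875329087882469274163631015202313029240313638991138731774413641656388605500391475,
  11502967166409819268918502473861226933702756788691602116312260515045614687113089353832490950,
  3314604954167926807472150047137893815889577374708093063019011112357219812845736754234764929030,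
  4114132211824406129905492379586924364653603823087109334947637091864891709095229757655119839377,
  757869761535370080645961669094383372317621711511881014352951973931798573703038987272152989860,
  1260928645397038036044685821518560571532527583242097481124856843672803250478874824239026907373,
  3754521134863078137368549012019521867970207406057027268656176827047582177446192372951700195686,
  2191995556702825736372621514459195265074622185235318266219552258130112536976728735490151083624,
  779258700737879242400532254373429391850405366394549620203138959616815207640613533787134541957,
  11224134857283157434814408156275698582697364135901226382423726528805721489462181394020181124,
  144023732616022570225049765212070156589287039100463559606968293040883742178647082533317575865,
  1184680785809203033156410426220127570654486267481172379636412288711184820871268865377994582371,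
  1215240179858978935124657538543082545782958735849604544902435362613861688959039840910765352080,
  1189773375717691640852574121215163033485939485665918120230290369625641308085746215189673461000,
  384027925112422109123215021108611828627957445411392793269254986716495317432609708949651866115,
  1178428793755078878037960727362505053078461827314917098959263036007341043382619753568974160246,
  1186591034291305695353183251389589394002897415388531487187409408140891960550654951282393074492,
  1260969407959058561033144271690712479111459319715647177658788541493488010448819757592230339798,
  1217579110481909374587373034517880346749396311940599871864854661339137436273156175867325410420,
  2931301237096941396930037961323349048943258970539613486342186612886395148913629601033990293419,
  4112247108105300782651540588992581258457396008806008395532796453148103479901397591638077595790,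
  1270109588169329958329586912123941847625594597139269967421170839311738118408064585818705436813,
  3158806849816954015513209351811738812041020337750970615779679239231064872049540550545060318263,
  4016363435132510896968680996031674425741132324125585112913560840186667486957019715759215070261,
  3918688824738896628915998063975547074949437986846323232804294167080921421472506707808768925858,
  144647144448752246264548595767090222162904311180106300209622530542133155922973161169982226596,
  165016088987393112346550339588655154671377180353402699191424215000643382038010713632834891621,
  4280160742612222194838606803986313201534046521108385894080080007754347479729538551175979518981,
  170641977894209624661729208092959040431734670040041661311065368290632004453589254918201909304,
  1194866836219037132544027648568751629820936063535967494848034858476666600542821830185464733732,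
  82643312960970024052954154005769902056154935388677902316951871275514219416297027443212272813,
  12277668255887965232747745900497561757569392822416998543772552358648387173300470525578757293,
  1183536865404152519957730387938815291879373145109508708838603568780913223202881992670338852826,
  165476401761723852479236057825154833619416960068278613411123980210129626182522232301595500910,
  4123269405944424809597595141807231310006836641057786342638204560652728056011303287477685485894,
  3756684273714599988049476174832172420773423193374358435730386583061606788470262297272157651086,
  1229494999668573801914811458019367702174913264574223661321395802753531200392031645517132948612,
  167180803195008434934418632413306007900294091767800091203082675479321625279166339321201533070,
  28538078399510470077527998129965479733153750857348589009728166341014438014298562306973428983,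
  2017690618080424602065013866000437826894644351573996319491834543167472206496283901417646751785,
  170242589508170368328899433464970713823502667642053136547295834277125056244272765636470698090,
  1186613990214376623461185417987284815609972359397325468390877316310240501236682618635277320840,
  1182643003861319893758248990753686370041635307249539702213884091220712752916275499222294374445,
  3916654975045138561483335382789752510047582790393085086682615508137031458028850407449879970998,
  143755186117784956137786788638993041508121275601142606732638471502937817746891494163202736300,
  1275334891746502253202514830387661993918231811498837530190822275506851352861169208547752315909,
  134905565571850933516979257834977043326242867806910750914093829342571259327943701869713932315,
  3778077739441330412250916774796412628662903359167622977686324941894743906829119644572312764557,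
  1180507886056035171743078349029565768127961299251653822084175641029169216137600872125922557969,
  221521753000274665526183786629561741046104102132704162980656974321106867954315986464588824941,
  2838907068412632521299422022439456788878984232323830636344709985934749057004041035613074130052,
  884295936174298220676814694535777172521578090349199783713928028046018785245644047987928002666,
  21532730501340642274006354926356126594637375094053635511181680688749279093355203242221569156,
  1188755355227635538413814531149792777589526300838650135982376850771924311516405164601538306436,
  4551778291616754706332571216398414125360599920599816564392774945208095918979388853146524951706,
  1042095479645051532313667382890090651284986693140244541685744954329950812311171039828037387458,
  1180483804920334146492007737108465017931115723315470444617062045904075793603061431966597489799,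
  2010699620243228602493058567654870311308766377989337386882917263293297035339880822205720847490,
  37705997825476446517907858652465312920169340553429307473504026290653145993697280085690632306,
  4344335336303491251412622779295878342127188318903287810780464968389726027480635357003524753362,
  2125665971994818514687283585166470390549392601577251455513500054282577763713147105172887978151,
  155227678119804352503324685295798978085374928308981920025971318336522758221609774610173733417,
  2046450056666117729634597325374140634286903156037493495952285155503981761014303014683411498174,
  4162130921432758853720353392636989702135898975482153613059174856529066051082485375894247254073,
  2765281482395448951097020374777260887379316650207368983708442875234468644709163411525432807415,
  1177458144953903555123479933192234499076086606126081809190872618150647340259728698477544480916,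
  13261774728326825981420073451904920803376210205713715373918510097288091128879429159543209987,
  3108812809383541686044468080346391349297378439915899939096846157499012469478879666680513766589,
  378917163611615205362579739256609961914990543936497436356043125974132854294698579773478805671,
  1227330521227879571322952728216592453099199572894857428483451495762135953653768473208858361868,
  3380612018139520487933899153730653751135900300474333890223666343892983659150268142855625310349,
  164456468593802064059182454726198966979470428069860702300961427467345744228032651194118819782,
  12240927878608590817515225716571837727262067445797114116408088492923001961760816751361163689,
  2015648093336446134984346187265672967675196181031006940816790081780642064850717421738811362047,
  408475451985752505859710438501883421122593634888223783166658910882154267253986373247155620172,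
  148136572287187970994854454630826702228318279992244610526297905839028865181625919785178824845,
  3712803336114065311815248193047230975862174565436700966116376147508875444175592208732468183071,
  1264001276316931305596586385956336229070179426739586947424596020161398386779196258116328210596,
  167548006620318690699145969097929878522339424735769101423670804321483594059350818635570753503,
  3774003790314866530500678380135626317939654801614868673222686461152068504194430644743618940991,
  164395833212716413628838583929435044231052029505734077045707786152239412911659824713273577082,
  2216540572060441878608405081534267587400792365481315467475191766604680131257851546928898041057,
  2337772468150674489390219766902634241190644910653819989051881487360410978118409347428018227947,
  2598290866203020480470595208099402243957509124064617891109419948526099345540190344382376061417,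
  2173764822740431333979089186141445687849117663543306496251809511161699409360910608622588987944,
  957426990585269021554173410150991941050957643680622345825088213097184839240821526865329178981,
  3791385021219067788783876474759210411422418178512056774323167943355827315336083028003238175980,
  3285118494789959890000119634933113097203522257401763021608766917203050111763954483462118932641,
  12243029556629130558949554060376653709597766877298553795003279574576291749032347988333502616,
  3139378827692675231195779695576510004177991846948899913410966515245824735116518223184095430588,
  1240666561113258125670877766816029233477405075668753337941521777195195723846364231285943283466,
  1275336212361343874579831220280349657878993406263748880995101768786476090316476602502906152131,
  4125444738302421221377459897784626477709749896467934583637795849122527010203657578384472908712,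
  1271111321937309822936512452521979074835602511618474847676652314881918119279895917376521216161,
  41914653474940012909236776624355281606537800862288168267867084888226715108268199797988198354,
  2738041923307670613593312416651864677359571803512055528286571889351614393968730996636353710771,
  1262968776797841947334423226780968031969914319848188035211174626022173472735807437652001279718,
  2266479035649836174737865361570909647365959657467764678575030705887964879101829721582838048530,
  1251894387477122011760316089206829604305791457744699932457428264110293750476855967426527854733,
  4286384465036814087501443189961285971989706502058123022491683589444655281101422446090837493184,
  1270245355721299744226612399095257257615925574601782758123754906450568572502956970723549937672,
  143629991835884608241731641916741465054272087530294174779703860118808607749697108576417669541,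
  1187592657203194034132621190179671980286107970649092023299443543848532648833198426821411121510,
  1801909774410610847592532991823731823556328784093056014118507135650615789681289639199738675261,
  33671649846894963124999498492643229556684387446038843493450607923804996941835921950498087073,
  164474917108974802934463304526309853895601222457707688185128723568174373506844964817601759840,
  1260934860383305445738659265847829620421154540526769598836433015234606378702151737762340857057,
  164540686497917051358022111194003984202311732488489910228511653551102618676987080443868220532,
  2596492076123040804047030080608404426565559837491467065391018295685454510994039962744489975958,
  1275335527791036696507640557970270625553165300401136369908685373149866105947991407400653015862,
  353469153761828227466241556502888233015787657295848944469030260227808852301032841239860413676,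
  4803481772249974892840989346756324808334891045321671620610210981457448429599708840020340253020,
  2368339694174795120682826948956638125725671479760965751128443323230127298922720967012194182333,
  148042685848376658093063879958806536275547867481572541521486281044994874242131506006721997294,
  164121533975853492843486605065865756163307986361141026854134608926702202385658726546219516054,
  3389650493601905160655696078151459688883095652252637065420329345344397791068834714402747614303,
  164225103484813903946369985071623648575753622738507753662812762874051292813144795391909825882,
  1089856395896371128921215355525659036215988739803024159016990665833079249812630969616881034301,
  4803714659829717928513192951855777936484529163407449287813748462055588355666298200346584171334,
  424854918304504007461096120611044936574501338318930159237619084762758879564359883951322219709,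
  3217505289141418099818628865917698919442005669031877315566075486163563242426762404354234392579,
  4241153415428050537315968700426910263779037478874786891319361603164171509320899838755764723724,
  1279259014075570133287661577568786583608483006330950557333253920256628933451208443761330774383,
  32075917675301210285543496747107236306235051720673647487905218815462397840718006639005311053,
  2451593562924747754787911571435630539820892148836508472629451752203493887672787277674773749989,
  2453628734046758543126267959075309222009891600100131867578001745879421699493063794448439550097,
  62587385776259930654367835945787553999832435812804642215415641542121556698718646262197290163,
  4021457019780609792876576620333197532472332431401615082407485031172802446672683917336952385535,
  2826405944662284704429197239097972280525010816357070796714181198186455727336583485959466786949,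
  1219310551042821665768652419093065141734831291309375590902536779306340035564198178862677476490,
  3144172613773330016592226574208495781966188702685812224201911639541800638187022651570065735825,
  135483088478430515413943024898438643229380112995645238273945762042532644976108048739298488100,
  1276205154822707347251625724780395206084349528681687485998086808380460065076662426819694857826,
  165019839783441445746032185591964030946362350470437430130721339139173655542782247323680022661,
  3786178387596484309033175556481526696186961911301682648502444612583429509056780661186625571855,
  3395067480107739329301379776448439834923203043257430421619464746301245658097388921878333894637,
  2546978137521556441434688610324718559953221863926892511217058006273835224134556687235686461,
  410698872385748866282638259039518009300489038953908805657054044386428510835012837658058924521,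
  1254815672044413179246324447432052829575011064733907694570337918201135514741067453912477114377,
  143913908629786411832297614983834837869149872884109399540792672168654301856967669197860685747,
  431902396069777711382921490886519591777715492435794228270726980069441692599452733975175856280,
  2014629453177578211489079173709377903081936247256068110886677954165715645189554377185463247182,
  143627616282373894318676028071369491627725700145515066773860806085035846691208813253421558193,
  159923862635549121747504373663701079327380119587665943535989665985393601000573756992657467323,
  147817039349798743162376313610204383868394637175479748959941522145772692319029131927436963066,
  152795728338658661096009038786830912246975602075409068260278931581070802412920426352804127952,
  431871690943902859418329272675965783188762271814782422291895367946234045009136778331578272102,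
  152795742053234339589491201785654103770218485281971529102051766315909525162963577394953388441,
  167458433644572827887604698991076173408875289759847082641701725871427902256853257574588280199,
  2475099048700707404578382814052153911907628202938339453273777813857275093804014460111822374096,
  4152960017736804535821731184655579442973610098404841314228466795569370311488562934173225001102,
  3150276404761795616808365099973876118239030504698676631866363964949538619895231785821971555553,
  3281706486567146948999646941248861423010546095630351574687105110051440584706392236014332207245,
  2256021506626405990783986107545090407948211749658942419450320211736697869806735944896222986621,
  3150431551783930495288514956865380118970295063541546265478700715278516557549926177826675731183,
  135948192546267461965180577386892021918657567056706047405078056786090865538516302874732440981,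
  3799227260820062793567739021596032568210880934121871685397528562565635488664378583064980545677,
  230664024574301176748702909663919341388350382822961410750894603867459999055782079183526536400,
  31620186353874147211406835446793575634016312554512993032633860992378284523482777577623888033,
  2475000327655444863563572320678256746356049728465837706527595861687992068356911069435999043910,
  12242397033246423103972048330156129772771282567829939133873448461251590896992594925543071906,
  300463925896662069635970912274011357374792044173045575906686020469583456760010382950432655586,
  13610512780713586860702296465571826482905863548595475746284492863400786276429413531268695061,
  430138847902096785213011704532399422896319224186961949210026831780963025174165805502888692070,
  1272147051607841389536710857991322770733958528338168216786688389773540254484134700524540019935,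
  144994505054260642807710416529071156892512126551254172056721454152919080377138012147273760776,
  143627450158924857909390179569441466367135437276037522014816495033892828455737527314435204319,
  2514236729938459805037980303960357938268474405333535453341404023888061555118992499297987589,
  376867837310338017428844147197909907135635492621993345542226063602702895594417512867946618889,
  144101080758718320868557669816470075638798806660441510872773993393585206608170111217130119220,
  1064387975360098162494909995771444096483129495680280059250048918117764544595630825658308019410,
  152932242589736724933438261970314802183679377454005980418957360164731107442708782806788752406,
  1270556436930096249010944622226991547931726100456279488191236527593459846814235833236869319733,
  297427396114857594412553435225586356071178145942767517407917947138470472667939000209873412518,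
  152933029977723159220239575000344701833010648900631955529123157446791010535173836287311391118,
  58074193873006730691247924136560570139950455931442215302715755493398102638200953386866557309,
  3182887381509279619532671791029712823998169869727491398432533821166829066260858693466073442423,
  407909369545594993899039663684942202340740740130510856204715525362400282018578056600362740828,
  152932993021424394507872326564799053581833172612721724634774210055176945124331592737814683798,
  3488837178967237742456877151498434091911827187281554715774819378549191839660634296917105107108,
  4355531449341065552644450551473219817707138381260955269196964702949802492787139415264187674594,
  1212181517614761317151712612899467350618025581132097078647845663900491866239320859015308058700,
  175615439367906401646369300586011877604249333370347561206625822704804585885037984334412588359,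
  2447520112772231358229390902971401361190469415114630721665349316390214940435022636767675498504,
  452238540427338456866940473225552256957035842830015274279900652504898681595857675679037497477,
  3376531978310117532848297795079080661339758617263389056922711861391813060828173774733859495952,
  2188801685395907360367193871251656600944485877210134922191316906926046604274730154392758357957,
  4121400013964655209731833240822808186891019351627167445254052885882961983186990620571509828663,
  2161299274961319169713518997613360819102078649807021536810267373015920042814649862380831687829,
  131697163081138372065500272466061231310106843968047245009480835134773631055197553820948884542,
  2110518843935191798085637124507316733297092457562575141251439356657700583652715461198046495910,
  2007517012559330838618554850297557367090058568028145180945049791168297381280117306135340902474,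
  1231481915888258472401345197928557510826298539581506359606981092170161203942176560416455714747,
  3745355343952437203660969203298524792485491928630545307024399898229438736632590833478244319269,
  148114344242814014189766491777940263978030144980448263060206489556362426368867901630871351143,
  1213202771271755916163926957859551051830964663350391979143154739056330207985848351912396882053,
  149181934347133988954467077944175193310053620759893244789327914013503001283084058518029010088,
  1218559965511524649935177517277326848490025495662747926288039048016469868519330661085148954788,
  1187020596534932328597728766394229878938265369251420010572960337996088957825060303910905897101,
  2016820924619132854744314422579196864925407941765761145677652325956260327096370302272236266722,
  3535689587794021630123827069467066408579896505972436517751826519297752885313161172684531247857,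
  2186911172994242507266484652997844124956561074684531947238067981654477998708888111255960022631,
  2923467186414705414046021057112513673002447932585196402487748599015923700326225852425599033489,
  147838299884088491424959749711987736390164960588467844106075830137465452539051066959338827003,
  1083159727373261742396296765295145981719717522937774233408958653310453509198505548441978249392,
  8210814237704058321468794366446737328515998803148126849506285729401970876972471078546080803,
  1273154581294170998740090044112365083310472463330236584730502388375309896521817248514039853076,
  130501490568938879563237455856862001983865687263787276091768117268614191371919621926419777554,
  144086030765567885635137426566637444156140965004761534243052820998606147700598808686836392081,
  153285764270946540000773452624456639224736922500088818066048932577848492729642439210183566543,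
  1181780381500326029753385624674702641867679801472612817010864173466487151379180925979337998512,
  3942049210878824811037133201798040903616034857499679753644062908937749524641536681543508467789,
  8154645563088841047746479398823635824963503779590346046804656049992888967721279158793642117,
  7274100524191853495462435214463938751469361995872292443966292415463831420914135439255333573,
  2520059555673801250342025982100726325868695416158396438401761082704704809542467723707706556497,
  1252929945676503125808984076822492431961752741773118722260464564852358458472663549001089927708,
  3917276629910208665043682071647186209869806677318834984376611988996619422040012478220397610195,
  3388990947921140943511765730357206678168788050714943407181561577749690942548169782207970459824,
  3648715991387987610957966180184922748265021633084574715389546448437714560812755946900122903762,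
  136626149104889124588600113746160531793707622079784633124761749533754276595540165962468435082,
  3386910863893069861680102593019668146187250636519699182324799416028246621501187630340418683347,
  143680048294242129235474565647758482634919446708269335025702001769836927967192164974845808973,
  578588970055122375655021411981249555158439668988046494556378046781472255076440493529607497654,
  2853217011554395662312175624827903066181638041938903163876991987737105930029909157563402936461,
  4122964689282188384306675162155471899354972806131754846356995243410668354533578805778363673947,
  2013765229831516199985772957168072787399189010287481116612250627837049155873575526009927409830,
  938168083983189447391330001988722963464369397653320499481391316084187357960212434242293786764,
  1236498895987198634873074462797032642437606193259847063748032255018675115743954305878590964873,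
  3115911725940982303857597720297670329225296049713408556010711803814106505343257147987840829801,
  4109113626863673526216542843108581189234724923467934245489559766495601874802497094988582388910,
  169421769816282036233489819450731990001584562452181679973946284335335030282892125249743184015,
  2276651908694499485847314426039691828717339945647628898201872936880210282055974673680738486221,
  2034001111600071355962224881261020396269527024485526326858238622653152485791458591131230816466,
  708400283270859821579553001512207368196013411874474851529803612075341558884657714151585843958,
  170110073343719623524647574940025378668335382651281887312438887237544269101105111825816609468,
  143927985872961751441989653609165517234006225484366695163160180213507745547930577708779242182,
  2047466214552991866918466143185381247266739202072325682584991333953457228535494387681539489819,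
  155194843702752974570555961844480301249024142790903739030970506095916400336471353529604849805,
  155227683583694004296085622679959491473348382412473613853597833397585911799196234693574362291,
  145949735306200044520345584036366703680687490265909624609342616923508625104589956522537394203,
  131407769149572132871416218559316533888501155394682408887719056752451166256150811474729723979,
  544973524411080521657857989597213649064694231753589597459312773499220672749950641550670236925,
  164304687858306683286961999944122014295331477726625978638012096028777674859649876949908531305,
  170622818395957247054543212956668321030945154027808021025497348169149065121193282656721887399,
  2855153341105248358071216840058959337925225233238521317144658739466388972844603386695421822092,
  2070893123134927927979885135679230626177505583545532733476504808110238069114525537194902614185,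
  131409511329373282800868382272553982123909694791670520076413660510446962409378192353565222987,
  3140092456699320805181483965302860914514560568125313837686860778890449353197834565209338088701,
  4313840608342387969872865211960489317008025120607002095831567016890450228137274862048313499676,
  2521104086544617003514940412385376323776547155042813110006487514140323111653717225359017500839,
  4282113606568207853073775147299811514345999040618929924145158999555593430705424505074537171443,
  1280421832239318436962571294876610322480494623145644808592749574416827566082051762239149547687,
  497057463935436569970418362962009773870317125643815939122179010650133920106599464029101550834,
  3409386929670417304189976808671746143100829904773139767082730125184001943557386108379971010704,
  170619085694230303421347895352977398987266265384208570835096585774883329672575643453496815779,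
  3904235215529302950613412565577987999282501617754255947721565720558696638840701812479997822092,
  1193703609414892214623042459001996422212956900079217060628225164408817906238440090833544904865,
  4686701749601569300413991577825982394618743178284971023021034499314125562188592255058316699760,
  2766299517357260537944534519736066327982810458118846469130472731299630012643270350309101248679,
  1182597990599143276353478772527733270488738295276762322553762144386795549979245186626596408012,
  501264772896066589846301545362030335668827695073986253663440927142388617488372821262613291044,
  1689926258395115570606874556366691472608105704944551606129219359481123804845361828213334262251,
  3843890246818033017949910544065205361457868442982883738064093529905551000751483608768479028865,
  143684921343785425926928310237984080767675826673342411362178243114285221675599309072860070029,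
  2043150451031302705479184511762535112268578366241189610999626138253820053137930498695495131197,
  27958642301151309882497393561010452116353194794657603012694103443874708630661722280538779302,
  4313424676907811156532552815526319922581999513245810943127928798762813175661504855885239921920,
  159355099237493957513588197921883388528800600678066416180220353921792276758498662332951748639,
  2190836046924548817731579468542145369023872696339844914977263617708626531905881466559957033101,
  170532554639297711546351945407016779329831989836829088354563189400410839075852269490379196966,
  171614124407369673670838035475596253871393975574908590022415331489148071795125308756159938724,
  2495522995086229948014987828349814657235580049666743839277824098381723497217002471928507892921,
  1186918368683766850533886261456585382912908285753199511797951466377409989109021918293376745480,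
  2930584004603817295900935449695406911909811402601455484650418818954095942218318324907276649686,
  188427954821461183435579645169943955872677346416397760215479575846634207346649885244633115892,
  3011063962284176567402608545702270160292202287884317429515534377932650628250582702735349490187,
  170615230042854828669041389387842248515456233732091560026314927227850020980984052102378679542,
  169533015885984498995852361458567757995627796455374010693275217479487699662132724407238877350,
  1188013623645987689134078482979636376684880194296837713118704535884760247131756836215424059500,
  531687161012992450001275871826789004051191854351813837747184005435407784949262790296241702036,
  2014633183203212458916478780389184410707218549595372817431463825195869098849869234324448534609,
  532707909275916043155155921408945531421698809837154602733953270426737430045954392043449395942,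
  31586625776216475643228433602535063559439742943262896061007596331277539495177192641506419325,
  167054523051286937610572136156683752712388201607170573783208396984267406790102560172483240572,
  27501480174991340209133777995988374790885528250708419896308841928379556099187876973375243422,
  143957949309571371423370628329974549904646908064777241131704191966447083372928194068833288786,
  1182516106322201836671499133108652627402806443068909101033470725795069415369870039521712062628,
  2764556464667165238871521643061175583075840203659555379955517173927536441540056155890401763355,
  146078293365068297554847386847441572170679461519583879579123108700621994795849551992082074866,
  2446499108031288185779587955104212213812077907513373339640318089179715870344276588886480019489,
  169325661585565521468816911742247495367934182191983583927441284795447192453992941578498638988,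
  17332646365463312587954419662358721578421414142782966492215265367338573144303473386240418956,
  1227463870173931883201381573865366563659828824014784330371985596619630770179166648200341652195,
  143927987784990741702225036367853006988533954403306781304577123089475477196380097092931284219,
  2014646658889674221623657853877186643291650021096476552748797068087137066015277946639746107746,
  1183535981900455419461514337078921590654323430414830298241641213239202385258899051969861552988,
  1225297548961065206783245638480279407242132948211354095375187751729377768204868931923326928045,
  2374166301206153915295787384514525483627911709923045517210895811945868605082090732949995105853,
  1230387799137238678032746433962891829524172610296208004119337996032096396057824867276645608468,
  1267382036037593865802289659946853532930527812767636933610758967725949793270189610927310622406,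
  1113715142672292830296965203632890667849899277365696553421397626504215206629171539551567021277,
  1275452829515213934209415950164841089837121504019938006861299844712647756891610142864419857476,
  3389631237443104175293949170485396444017406565704150558356849195757827157142553282944116737259,
  1108165628721313690733914923481576939886707765055816743129520958164397980505004018312787635470,
  2131775709898726672753759694452646727397511337253769475470926855525618598017799906874007592991,
  169091577257250312806924584573782861029952703895597959026284527797492581582862286373206196376,
  3125059114538658274452693744656035642052417181019167787673049431001040176961883486239294720019,
  1186717990331806790205162928717472849169141784851389411009786003128641101326921756002676862206,
  2509931690452001182477016343408666815992280024659790035654414977128493334267695350784577479906,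
  28535076338643432106046345346817609759195824147121983131466178680717184185268377105546739739,
  2045431663381873686340899284536686585968999598441558614697319167853290283440544350226840504260,
  169224065449134830114375931896501887926944352539175766197778677868587220916565053557647786150,
  2446725141416078373501586205174112848633109085676608921905335704215177780812024546768943933363,
  2764413121649154578321561878104538039004391458918203042290782020227215897566418886995786746522,
  2010560974026356684014474584857419652299520395434937971155948199316613356984093690388881383576,
  2127839617597671738775449042371192446211800268028249921650477371112565196934916591641197619580,
  2642095591297469312434714252381543157081065961693188419584950027322176303967898300084522970183,
  3776671720717110441137255232963313575214082351159441017237538465519996045800136140413180283639,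
  2858260520353080483432944897968258426089679004570408686269164170068934202246845549703988002949,
  1086820363765015248023515857076243416039802183888987596952214064128872867238689135462647696406,
  2680994969413956552441782750063945220614263014390816125536229090135432813859051583075882024988,
  3921297736122032875186592318894465748138669543191852756051261290133432923334497029851984170024,
  2046305720929242508543669509612224518224806354084694991054494634112269737451010380900658085944,
  17335481248092781513843014003510096692739654964782716010721403958780184984748562120435449884,
  2048260439897765491449035402641317337213878793616294007823741267861163697559888109995245481090,
  3310244759084096908202241650450893115245335498701929498295474856467472286773902471066611116178,
  169451369262673712923617484351898280233167838902015359124953691436439922204226736564172390870,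
  2039134309851333088207557893660315383074782754664933051268817002165808247434424901162117834703,
  3092466538922178925511241214889363452190117425145507921283232834983524005586850332870459114635,
  164280538510918084702393160580882842700320976982198003194824017668221782232054257538886283451,
  28663351132873368340692643518908246868161051525623308580079146712811374338638814724820075755,
  1918025674610555443221028767909761017837899974523212141226783726741501079317992326412636310544,
  1748945733776721952412790362384194138060227266234758314546728069685077826350157174970766109736,
  2024820791270548166015773801076862181435158534650089586966101639587869683600668340066413765583,
  27644833463425143828408625767884319828523059518745721473349011752264107833633908036961358227,
  2851869905761770175969291143171978573513644431261787608979086833935697934960340288270791524369,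
  135715562927482585201345385326987770239463885442162181781481818303972719295790590131349498694,
  2229781832428712455796436358833662930452273137049340461688294344689795103127205663874188869685,
  832365950698092871285980971781610643206498013709161120202658958096766555000588298468237287585,
  131865037917969438225681355737505586408190781003413073126566868771091292164991785029190385720,
  1230483912498788167762664893232660240506787144976743421967760971690144953164311296542102325680,
  57507516615516909591784956750423221023408666922083706777200003450555197540506021033270084748,
  8166223555456851062139971281422036443192941247991752345938470809049744705123746705106018955,
  2015648095389054526283087403389004387893145776409321298614878091524144635367407865047255744523,
  2851852481281513918258446381142404240926031475603696760094157246688236176484004386455780166064,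
  2955054417736903364773899955175226245692442970587456000869945730431410557864251975446224833793,
  169326753105483099611619672478178634539332213905298705554470008847964064488173980677269266598,
  1273148606391899522207159111227353338157609126104775925273209619944906982002439906347237706094,
  1282451199190559739893620946091344643021360105171488193243441019823220117774612747656084367972,
  148108369428887301953429992163639613369924639941028748674924881367335698788594233794749096081,
  663057324775501689313932742056476530224433192987794680076344898334001180494463792684140380974,
  3829628683578992099812479818163562054143575469379130598103187809253314512191135366017208918753,
  1236893782768163126862602804008824198783233237103149267680864459790046135704684036653231940697,
  2626030557100910799221445438634195414181807900861703629783328596225994171009158014885755552992,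
  2520988199031922474763471749737293977146004769340375857767136968186918270227406002254226877169,
  2196962862454356259372745416299487034938396719718399267371431273928957139856665991153164021485,
  1273302650200202316593275724240323444184331359267460169528221351350498912576699906808609909831,
  143857089537640129659244369556534915524670060051929949755193262441378012521134671860222937764,
  2520059554262090266633868661064437298683596709765767468068658722710127954483968296197822801916,
  3502041596298197687220727571328938444598299547708336283525391355505458416047995296926980484414,
  167288738919342080095534322871033436047239077532073706214238652917499896165863167818749542541,
  1186580048137481075645339067888721589867862201378012114406969374680877923748637288039475576965,
  144032681398858217473966631016052207142062873363327245727710086763623984962843372441018239403,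
  482780935517472216765309434381259041095751142728618124204532832150771451645021350040068980869,
  2449809443250733208771295442406092301018552007857910146489006466206812043391880213704882610197,
  2035149755775704283665474329973444145957989266392804655888601641431311589457954489120769542525,
  3970658862347517329624594344804815707135964965282826060674208757940214765055116275205042683960,
  159313805436483397219007850238532719750159280658342345071999617560387541163392902196645154762,
  4360622927104289076162901078128380523088182884004767151971055330889032645133665924500195265402,
  4465617572240834903578147489829048310990101385354459456613203012036557078796947163752439537825,
  2485203413513314228125601555020355246678414972183537141708460925314440085452180060433625317537,
  1187654395829529792872449855665750138007118300868992154639178473292818599888450282508638620064,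
  1262962834813150801611162150486388717606034628623055273248528820490683910327810256182173934807,
  1274167497709008263019225365209222136207645258652052443735291165904915601848406112504748376565,
  37080459193205204194551163624472262097336404554528196330514068936408696660401152084327770786,
  1012627710168954554475041606633188734699561606408117585832880260979962538965780115531500783559,
  2064556727435879741776926862355498860144587415306205394766348092157595820767373056204076933161,
  689555616738079689271620116318073487978136672887581792039393057282289165396430546641605845133,
  1240571452908163815365316269143292712109569062398766862775151043953598792958249794377718465725,
  159924891276168915516729527020784248234043897517875834904628754371276418561504559281969900152,
  1272148364973358866631953064979688193414570424220290589035253871819098824028512096600442677174,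
  1276222453798728917985487743152626324766391471706146531267942482872918003291348281940367715598,
  137064714529766776346072616332481676252138786915313203750120126658776664276566607344453144618,
  54002224268171354059471837507873935098865784821617989297515143957909675391085233169764532228,
  2485246432067974439285649589829372374749004355129559154929963178038898101425527226849979475085,
  139553655107987437206526540379365268850104055356925799287591882986531964209123230887753851327,
  169228173941305539381220528244759124328693143995422605744294279949084203678037288741604903299,
  4219072076737837426663828966615739864407587063941182699017613478950727291692198874160062497,
  3586585894631388179596604387064381533186445512931868616833743636485139006725691240726679479523,
  1240710707664035605708265963887279068011213974571857453281909840252981700181951531877257035932,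
  1274412054051447534652848810889223380858035683021703066738602335270897089541695240567502856325,
  1272148420183686044714726830034160508746208960344893690485795761527933519912941605557164990516,
  140039634085244679038737460182124880528510620473205562914805833798276518011845514332866662089,
  3018234209348976365341904320482928415142022975330537906292945374022170279143790876607685681318,
  3708807220615205310687845404431205250937048542434512485257851757228831358119916342221739027467,
  159039870629216470015746472220827659678798417137837259400437705830544314272120482642228883025,
  1275340324451667824781705935921145366893346924005846018720285068830129178134449673289449548144,
  2460802122642851401910654864194513987654033478777498501038582634898760085003753224248284856486,
  1124568813784416047006629771396502520524728064092889863222689913096698766437527607573606616459,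
  4166877566345782586335558477546011132381727661372430098977338190635433520933465678656942768285,
  1241578532791673362436878432057035711110345793644103530205293257320837146354358635726670012573,
  1433056816296156663883021812324015656347574270961039247655754046479081852718390978304213655580,
  1276205154878894711411584196616114925036560287000096242263166721645563044466051302591618580960,
  1242818235286110604138572903279225477512385659660252558670534531962859948236344066158227427899,
  1278396003681013194610908457779619810249121656608680281238641739281443368784759526049007837188,
  169090584220910103595944401141943693183570810360200948548948407113484737819601472396735627276,
  136999762647907862151323148469024352423824207058109171082121789689464013710533081678086384266,
  144649126956136278405693244847858713104347962153183296563664333426037719022262439491084201648,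
  515432889162425971914777854252168944999833741771345142962754921938048819210581523587530571932,
  1224406966525573722353236509844366954750640746711199646935052957763341848961228451539341763076,
  3233799135268023649352733073570349565587472161108415335910565068568119228147220520175067702459,
  131469799264958434349259064933881878593674671780801083725644504224829668408859871950102703739,
  1196150055044156346487308288078886605036327907321676391559890765008070607549612641811302287486,
  1333385888752989123550613787959311576780471968124631077586359884676035093182593052456184480290,
  524628022983750578644123106306062660760329565417270876485141837592738324012283106175842110478,
  147749023806085628382664637317873192331595192571106999127884969460368850897966762002869191283,
  179277817746359444803261872013845223192039768750785802814063947081095808835688530861840507393,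
  2660631963484917142682361200725776589169886476666546755861066040786739567342076505978878142072,
  170625428509058296300369732141907377172535810863916298548855824958402999051911157112221125878,
  2206379016383048404085275133314908562744108049264375604576607328526482220805797749784568693984,
  1253941252569588270847193983542645836390519478111052212295629101164656151367338744276670269644,
  1254815662483960700448908536623288873706670185868322534438954728540069396496893173542538061313,
  4112780239001629289160782214310362513162384088057702896501316569322003342120817429444836846838,
  4597312259855357368182332601062967568791486867227472798277615883203040763022301045958877211,
  2646424698261288584315665850966228167844347210387656440066414385786832015330514224062399677587,
  16827844519154244980027270872011047905771317352689976814589577138720223820226145751336488036,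
  170644824858945166456156494218660497130243627772913981663073049437914177815143559801544665194,
  4524612283346487756393342448066640634731096752413503605498279530820417766935759562702364696583,
  1231538315148036137967203864807211564201927269481166407587007757996997047789626725627662041255,
  33686447037969180381860696792221554603336246454204844346853981848390345056560645655460367850,
  2447517625989328943884292249985025579124594785579396803370756586800354814718158708124215986991,
  169224444108056246202079508584951011895389019674659337986093017673090754132983952604775162022,
  558215800346249018900165632226611443150134144012937107893438309640956298404493964203635351725,
  1229681847334863536368720314375177757332774804227016022703529009282338282352362249880389116453,
  3924733369099579414160769838680559640032645373424907289062681132479750474184411745239300842681,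
  169577705709110806393654240713561218824750571242482640371411342850193020743212208091357668498,
  1741816871070415212346686812443356658527703519473675233910987185682118564542247833455618256131,
  3362278941116271971217908791681509908983367940173566023949060677916637472777370793384588911512,
  4368443702278716760393197178468446703865713730872637240509206002291831694849211416290601829256,
  2846054596236269231817748115840571347430730170112767949908686060958075811133803725337082250434,
  551019166887362395832730721113418616152361196018901686307654886372826435699090461560914398854,
  1926251649619371306271556138551087687392752572161360399661068447817496870575979205631152091324,
  2203299839825351167373908073770022639946833325150656462720567621381318628255861888465964541810,
  4373583511275940207806415910603038694887306356656219043446687823442555946623003275028971333760,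
  4472332132625407823486381373741481902989476367242765418493216827233155044785718572479877219519,
  155274438374238918784717170987996049134667696107952855383204886513252541964679385759585284513,
  2838612990197068115772498222252507444575682528399276795201138567548971032231674066938997375037,
  155138157341553200638197266279824255374199074083753341272126150148510928061950599417989852520,
  2470934215164296711588292091967879118557764246491258503740556143811629346986701961881095610535,
  145804427882850909355172085977323571489183154307759024262649615740065599971430571211498269745,
  145667023078342317508664098096183588944590334855208349688105290695965581603185789104881371516,
  2476037671533998430530059858936559272186615790434988242777292801692447287082897483401692006778,
  143682783936328150883068747406888071145179663208963248639708774069701846707502744661504249367,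
  2241775631770215204410679283237562922798681782952723778466260070960459627142624831055139959156,
  3376712792263313205953578101425314741224465171854861123749872383243131418931439872243499190448,
  1270243062446768177612554357773346855915346522592166280302165832873445216038349529788664504789,
  1195273879114413252085996515241073352127593437736557897402688251387141230986886044408773666497,
  827272978248700851069789641301939230989740343995980521894021448316701405459904139275040089261,
  2770387828336447738347379126320297490620697868292103828415981371852790919938294515539326656520,
  1996538104142977344647330676249792466573992377922307144488851055960599346332687308345360777345,
  647842343359923121671281396856711828774262481018221193576901385800925701068274849891080086107,
  536002818785213685447755898139717650921773042037304428700217607768294667083329857344705635476,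
  144017973590165450572841597592575013390968241684333509725098513671496002128006267324676022438,
  169094378429454706611000935442262790564848116548124535365904954288803144086276851478047809700,
  545992042399247765374796986552924204402291099651721601883408134616153910716468186180519135591,
  37984432309003960972621938682082236709349936191406320695064645387119463347510063025251207358,
  2451593189916413333883906781992042412247150180950726438005592785171209007663422993580264047170,
  3167611591949438051252212349579174428006168823749156799748768174602001634798845876701241655462,
  3565851902084914869538603161401538650044778292301716676968899624043192101834384975474208080024,
  1275338825523960323407129287551388439600984960385080326894733327082793134364505388571849384081,
  647856657002691369860740937769674299673547510195327287030685579199205298560592548926403069869,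
  531670998320549403053787855079703685578114386234103951616544874800241780040259253940933239419,
  52983592663609979544266447686071373795993905275730408667359732539795796737262920026042753567,
  2255016904339710512148826449527358405005486872998015861259673339584027163510500474534526380099,
  3149295789168825648522252587744446003476626353136333860332275370098307418532381887236592732910,
  549048085765437975384328518271417136879409137764727902827932399161506033372275201445753032084,
  169562042210454311830145617147727489926156813685183101024164216140119449302201491850379313692,
  149872621450547654333196714679242231646749025673471654951768567305726690749724622499244818605,
  4732055507422536173910187392094452707031775245909439415117993961499602050913948675858436654240,
  3143296951844060302816508893200298427146963718619842828654641827371635221720871678100462298298,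
  169457547371363012512410946431312215180845472222118528721569849624168288592071737675358868077,
  12289620960328230120848295475532206022904393907264710343521117717239097199840467896052985229,
  4755969391634970041434815660806612767906631647062946110638911594114296451499145842069338492877,
  38066247953517867833388023355968090155711505439553178902830282933208055097363056612389224577,
  164052273262568256420259717211262156723603765640273788395970181452363163236937960361909562457,
  2771686988728337684071334988911657810161512224036231167012789088657798483403171204383654453817,
  2013679074584471898667007870257118963841516254704132390794313288505706258268747916086013766905,
  1271249335670638931425299233156901985154775823293392427972530880816492451013613191554299488615,
  2617837050010246758061205933007007767878229688779033812255277854956814836496549862571840431151,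
  3785214432672234311201999188592597328186439039070741199617314955195267829922308996098772904513,
  2565951459813973950892230032640624725517642620592459789934087212013007097141416066747985682599,
  170220718017999131494511849451815702949942025692646989928730739107330705081148191046583905855,
  619347595480694501826854031600059892244105210571923449806715350416625760358977276346864067588,
  543443270573550182540104801846101392455395539703886208283629914669889758369188035440943857697,
  3910246840606979159646907125958089941799145634016409273845841543635302759905852620488904655394,
  170635518217136444222105305179921338644996229885787932016474048654919547164183413133762850775,
  154832809218755362522846029445745983779377861911832193174029237143749015023512151207901388817,
  4179128503657978900414643852314975556919689483347736341282263709633664701694540715158840510393,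
  145665414095448988518067906622588930248118118393093295475438914714642201690049588508513923636,
  3327652562438174727559187718147863763897026730483843925818561858162816486699339414744474968220,
  588773901077850200982533701550513226512082477003826135659249728203855229652028859377180184493,
  57526889651105382073283504030069198059464987409059246377663819497128972939957151064514503260,
  1272283518979507699497396183506200943252358953283500630187901107633231051178020923000979252026,
  1806049749594172966399622022805527705748891708729287746061297633392545703306575371879786774561,
  3551919108258386816081540426832476040725683178401254240427043122066365395487193218189934135024,
  593866633685647295474137370395324000941974228821387482921746482446681979150858812720031981709,
  1051115174728648969668017661697879382405087811871813017990471434801674974434265220014814060557,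
  584700442751057421787699213100550576278045769906236311600234407644565354787950951514875087590,
  3770902234709733285511361737786078274989496806596839533037982470350032589793262468334210097319,
  143685139804422166056327953006741454916015551681606199472034572872624279001024688288401097952,
  3688479967705564118731038527903380680105853643567636330376847527816553657908229407366093725860,
  2434553931918990312305509786217853569740480669812989673743302089780986176062531115795373006998,
  855760026070857392269042011305506479804350152059035011830136228807999260468789862481470057190,
  153233886222039459031170601103737503176388802414722834776368158982881664059163070789303132212,
  628502195812678481501759019239880624006665946306828655717032541314162999547262384727507279949,
  1195747720381009320891094355418043267690276603751120523667266473935736738135140991350132007530,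
  756850124281491273192701248165684195961109169355999859727520246077328086778631761435016086693,
  82517995300138689703582613512574878791682621143267827445932271010649286911956451314067816461,
  4811625937320252894676893128383010188815220580571099363258227561888165966091322191293400523955,
  4402567690513451475568468405809935122382400735891491560482601122318084156193017458252995396834,
  8154609519387593777577247219823383549966863705522142067380837905973055164643045596254679290,
  1264514337563056721567718228364701901050817953346669719068227720028423907360774447692827480260,
  143698700268341792671569753084974906391731401158796026760302680483317436276609279196879537370,
  650912327103351453929186055178031140286091741161701588158377814758936989768350017746782766238,
  62389219115876102952946738133634205712587195502825492441436631077770869406001004531797450788,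
  7276105460751875204022520876395078206733848173097491342690630853880274033436637550696735894,
  690639630028787120464262692759197307728987664674759416210160983518589803292000601585349690592,
  714068141517468396542518568533475209236483640374531505229180463257029520373860820064257999523,
  2031961479167488116598420213346745212657190966112434844516345628093804582058485396698545070760,
  1195747720303157051206419671321753457989187711143572199624261620302776161803197226671781300190,
  37791355259887101994425993071961326486890124332133049530434335449830583431205273933775692982,
  7690127143961831216482616717015791815839842257985824791019452533229686096759959369667781254,
  147930166616172718254577854206178612363926670878492663724784275387145935481002038878134068448,
  34171594836554682890025547642885496363866629601605368102683944659852173807014183784324792327,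
  685542551163540403225587337155790055531807124733220913321550780876558237882732115295913543788,
  2446502260789340448860150803596923454301075975844562818985047710787081429975542991402257015467,
  2452610136208838563378603552688836513347248081124051987138132950045586216123379222678647925783,
  3131071008382807740491763869027788051446488284319314222843433207445900516350656864463338392229,
  7241028631285951922494138357453687063007166533266771982530678483350008195112320441689452241,
  155271691862898075395791066538144153312171980641742683240555449478882729515532819114381226121,
  2839873953141382440571871560593852986451584280470369626088408971150201573048465824371126289563,
  1202876362518292592338745417743211673494772253317356176036605726633515186814727015403742030583,
  3375520422851913934294344888722059632303138562197917372635540644004671495715141004965941978300,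
  3375386185713742475283067255530436127861656968435997050566488373035435160483211562792540671316,
  2084038635001214972135325448649542754748135661289997479550527869161581429551154232899822701812,
  3423258659824148791913652430866922026299721184429230309261054957910963663442744485409454802990,
  1234590637155395576094967800000398519386938472622758179737303330267846868728461363570084818449,
  155241606342428620063090191561526535579113150534030398560637152854071436319525118737269956615,
  159321400017516135261802743906226841813651576705282163577912171044446386883291081259861697691,
  2837613123765039049340249614072593825488075701957675484782850038313996149580306692443369251995,
  2837913507220184935596333738001355977544456317154919585317389338759514047384566006834898947506,
  1203908654406627167335406021357487660417458789305390379884854871209111451592419056498054613753,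
  37989172330065577310157798722672731500579284927911038405652239574647956509204140651925670295,
  1201851617895199929495524827824219397962380487500147020797377431964696216667739039094747129049,
  149869786250981962581612669675070805600438168655227421641871163068360710385063521490900624616,
  161394711808923146574903303445111192616007434648506135247895538969830742307310213884376514712,
  2007499825162447024066364948003613093833067292794608293398386447725086145972661790022238825755,
  8562326468031237632638982998032715246259144694868043880784874194600583104864140935175408894,
  3386955873500566744284729840022205825789442781969278033116622674268601567889325110356597475718,
  1232422856283049125252131337401233370678605454393974820917208000524061820857820683862090763589,
  3112939513476267008486197172244303314936805083918638676814979792855571629852507322210956976294,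
  1263498236254751454897462127618750863440069395357179299108341586469733861105818994950400640163,
  4795183063462856365273710090041989123509508346707711983978747578069768719231902981543105282105,
  1661357200941242399965233569964045585808642641997157630252235759184870239987181185048295604380,
  4667956962771752365999875917715643264655313845664640142032561842514618243904105859884026332769,
  3135153408212290724501732870945329798833172793230830379551419150933261535127127938683861943454,
  2446481736367338330495850622149741359228855009143012725370539924576747828478382921932625596838,
  2477045864844233880923754543210368430556548777159030907963722381584275424114448100810591996282,
  3137345129951887401517648927182504386933982085044264929870660059676724541062389789913810927763,
  4282152013223265702093465805962770905254384964491908609008136651566449805507826726310503047220,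
  915666641335176688758295023125013335476339664229682973717534433584608636590122219754749386903,
  8735405062206854771631034456325262508685843928637200828024897419591755000189718818426888273,
  153951383204181610876162299636606935286321614976906900108672410993224337029504928247314631051,
  1221734770156792758188718354738981087667380034239699974888770734082561151305176110895922990093,
  52980980049145255264284296860421142240707508381983106160418010660488545016447423807786984671,
  4365456871622742832332052547363572773950121486478851294036178134053648379829449516536193549528,
  4365456869908773375219857331173108252660514975595985144090938181897000565659314300129220354200,
  729276426647306944093856547650379672984871715657436482434545446012317119448499170041493217337,
  739647116376833220418848019488295254829413948908800219858210638549640270808259638686523822445,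
  4816575065246885026394756335400935540944482295292094051526841373333049708425128173672918065876,
  2448521730209884564840942322873448962663160022515071947198466983529623736374837445887480570033,
  34134333870270149671790571641759631035041042351367992139333238310383467220449387507671495073,
  2176820377177538660573823150150659230280348505513991935980005695113695256490705026641849952199,
  3489742919060155913838768517386955005742776217975594905462546429573956371393911899915577493626,
  755759306991684186462273235102691083270579752160543816894502981659378527569099510346680500376,
  3266942052238361343985563851008797219069028999039772492923811679037984476386466018902220952,
  1215113406788708327629119400195939502885806873832094386509325511183458029848966975097204581608,
  3154687645315556046573126813264562283552393487896929325395242167290122572048497347258322927618,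
  2245082730410805867362639767746667565599059047731846050036844495862583768315937036794364211138,
  2053574118952466567082176663608336080987082250351318700143540537164436657967409704046209836,
  1215187696827424237290987237793417359879978306316162100124170792619542923382850909346884208736,
  3072378240755030155672136843312991402724624407621323687270941956408877560098996306444632072,
  135574304108067411312030860472359197904470029363827546064719693742240370774369938197861950697,
  1618441904741790339100447876820369382549966555363282846620341056491332480634856101570719902964,
  3141411991170802309442320557391058785456233814597148687521129194308305271208513564433478336658,
  1234450405643252890558642529037661275904092608188679058001336041001959088436291252339900351678,
  1227324293299924578973930952071866311745598107065157297146434864089983287311959623344487589096,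
  1216111482400035931236474153696304702478238004500838079745206515169093213831553887572964732183,
  2244067442667615259138680183005808706505699573687833513724237465265630006551579896704044261388,
  3072129457651068257332032115529524791039408447731332747734254093810600506613851158252185850,
  2234875636112625413409383708124432005654405165149449457715254580646922140482923911575830915039,
  660015756419982441137498806505017935870454453635814436981014555748139745576941789328551297169,
  131971751550920981391866337920184826490591002426062172543691585978090225279239487360486547601,
  861821649793223824075334580851001681958189814965005769890216551381901133720195296011471314997,
  660016502314530434522590190260996406048072805246133401857361797285945800794931189234128266338,
  2311291465086658350455978049927385792755013588738415072288113838074561473781208777418961846274,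
  2848009061176812011294746978848109240719915246644910700994118426475563781642655703285922392596,
  4005286719272365366812231488977199003869342951416365497290608873486822350602652907884768608401,
  7598768510287354054049070820588269488397233743368091286757052329051502167025707933455663239,
  1047040645080157182570355489916534228311814809137212496477925936225410060682577493326550122573,
  3381498655636020898646652019671543518925799902114512227917956961298889571464444205534312319123,
  143688130829286787562400695830747918299806243408362957444715758223431445829934007500319764448,
  3493894210235951200259803049252412706498484869341322824433604236203195460930486056099918184485,
  1213056931262423758188342530388373808062735339533469426965302338866653059381967388847255908228,
  3186249548927335839987865996587174633447378912598623569859215365948725087336283045016164974600,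
  4180463693440997873475323788774354361281790082910285147630978951715138208738270902747468139765,
  1129841326949292803881169264215641348983302675036342244023898879924450512463103929729370390681,
  1243631290575507019601526848905130932892757660760337421914965639489142603605940705512190010450,
  42113598624496116562172992560815512193605243931931511607040665080947609529510251041129620445,
  137521250442627547988815982661465007860361440834719734264355662462658003391912745848608120909,
  964653917391930753882784162037907261320038935741250308599269601109034507584982737911812148872,
  2449692296494161020543096052418586413031129806640701017169518748120405133107255881042637202358,
  3378580701288585133763487546584643336212286091033507960496764377528221703190809182059338345878,
  4134609794403821777021212881185867731644284355473521161981810160569880656571531363374369713416,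
  3395759156803544948092427678154403039270482960765533367755337858037802410566437284814924652716,
  2449540240069507236343881331806622102055833409154864636632933963954352963250668555733679149016,
  4109720331783398748078710402111740894655083334928186993655223348626057921169609241983722745096,
  820925749583499358703697334217287640451759270854872438713377125788244588797629113834056819742,
  4253838388856701063538026292144929088260801147796755679954542548216244499353228811640081117171,
  1264074822415942838664020577614427442832674779490356496304309077047569959154517980029715546284,
  1236497683632324508120685255390921227675302440825997799533084783185731133621063174963035103263,
  985000172081361082822458796222825932187034408068820127614877894818359474842093522492541342313,
  156304756112198196881302661060946576525772179836434857216430303078758032414330381486561943569,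
  2805323081526251872076336211421408029862426160848026955198907562653555333986142308230644196093,
  144987379178957238348718249262382585458551661150281433029243920839377780203339765805384158154,
  2489547439808172191059561469651205645475783633346971520998534640425595993495169795950959757672,
  12699167949963118192111100971862496256561184009561792581901230940127763731632749035946795153,
  137962488095243951060940617827250471029940211066775940216116657812968310013338831071677262962,
  165018938854113079787918207669325031358763066293189029887649901217954756729373825425987093402,
  174259578022799550272161189537303682640254051099905971334070373269651199831589207735100868963,
  1274166571094298211005179019045488900361365911414745811835452457978627372849741034787354345646,
  3822505593877497792067704950086790117518143188963086269457904130299994907678750453540923770532,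
  758946140276231546344377509355439860383612881256301380256673372708188786398033241106909441993,
  177243451840234010565048118159519838878792563390329432354844658610667160984469964897402822801,
  438372050588140283921536170551055702638953958330199274211559562713254609106986654145925370401,
  2177854543559095417269494444905810300630505968632670196129753952818183983136942927092465590886,
  3547796921876211318357658555216650343716223421616880440096729094684856119626315643447050251866,
  3138353445799998013355730552833284264724049283963147248483719543369592255981479182582633685145,
  11331542392148438138724614712974811681898146122597423480813096183684891362240326727298941061,
  165519368757502564023194002699573427619193006293557126939988422963743225866579996632081007496,
  3945104351297713917948816731303960370168814788563506817661150731262360256827623358452618062914,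
  780382483262226857798371476777448928414450791684277389432237964333180080118256901153947467928,
  437984429947238071750154581994539647798036032848217720890645864159448150843769661851972174604,
  760925939208554896799402275842393046594519213980906539016492554110910322613498131105631895704,
  3754261425969263313645290773140322027837486283892487835365468629180166957369320851865536413867,
  155138742432218596733875723795373793598368976894250989201131396857078405106505259957221125980,
  155204931547601279323319136048683630422207906471856762735972173191173543422840243478622831833,
  2035149755769883429650026342261401873250082256009789765662609065054677118728348268110374445800,
  165096031242095411832734716730150426398594547974588171970903270595757510282055398658151608046,
  3818425365015244371482287631614248191850552750308486732089641830476215277312694358932874518555,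
  170111451167920163150890651280191237852189448800948696826611837949566639121097781601289736181,
  2450571823774529023159697991078482872596454956739470460734201785798486084619594677676091746442,
  168074424385234400704058448075535400012472633727612904637665763407060853036416429129728434311,
  1231405814858045530912257568910007203403593953853200977613844146253984911500759488278269406217,
  2962964936083417212358865313923665132602039633388030438335176633131456948727070452469181703378,
  38162117654125073805762047141410420096011289286641744970401785658835484757677619062743608327,
  144893895476844182235805245639968150150705615675856483514332995567463874166689685017112881912,
  1231481915888255859565102866376243607587574088269340433647637901706596964921743154197643943989,
  3136366048810134085638359954910787925440256926688761708834752016304876386605175549696759668813,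
  1251758858261436724084850323617295929770733743671808452940474115777780476365061705978835215588,
  766960018555433698752203861855773132168620205252433408162747034247532318473078416397193888976,
  145131478601876874845154266326263215745373249972501112276682355394538728956863988648803926068,
  154832294835476073148886333807874061836562936011878571141589631912170566742624565845133536263,
  3136023984155904167625182000761222091224152833509487785310546973333244722710318682528669641248,
  2840651287588887511015539879182693600963119588735427661897112287841528442383515227314888417313,
  3172049197779297716996345916829424570302723953611661732071954476275136609853005312091966660749,
  4180091944174094818730809202057895253274308732336312992270375696106052389803191240260101819458,
  174317266973360056493930675202621075956614257522129668133905729710790396235963686270550294663,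
  2205339857752996416225488998959216489573702074318928803676357452770145316329126553017213337774,
  2860153800219801676200821943656563151418130425468517335349720743551848862593642607024739754125,
  792732246498901319714597710379063479220858542836630710823516996615711058683414792656950407133,
  2297929756898614041566658585961594528031401846606054700235423309682293284499272594569145263312,
  13338718348655578012103196352344061589297976157771906362317869349570176261050385676479433110,
  11317339453722535141037505269723824928667005435018278567575147718547796802533149448556609543,
  33629153845046529732288338009822317161725350910243168242782733379563405338848925475508248603,
  154931412601459567109089201083185068175598705244163662517966146966310805770986694503371065461,
  155247424342955898680506064944189629522992051411596346704830782021225999688857010703883870950,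
  2040960896316309965273056855702880866835170825195598083686645433266219872330418835423298293,
  2033116093328831227563795353541876461352468117784225074470139047903727867848993492141114302904,
  2006634731785392467688156065729052724385525570799946230803415869649894591286990210476801920073,
  227278337652418768435642656533996341328981762470868076933534583264842430646646445663239465087,
  165443325454812485643327688510220817760513173112027862132357878610064961723291341123222061385,
  2852193311418402726112223067990108487707282796153204492841351416878405946688275176915126528367,
  165390456173703527347804252186334541917431747041462511987265935463157594729081341733599112364,
  2847925120125740388209398118098155882048712423904579980645958485492995749889040779272005953498,
  2649433998174420653608235337947592625297588983140807976133818406503027175715292351857268477561,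
  144656909640240271545384343152291772335060541562187154162900803235150423163114630926001212139,
  41777304127532818347290663265641608487661511202128179549896472755242670393802420155278313830,
  12242395274366692456456799798830081314788707814683397869802911250437219997372979003445290158,
  36685227372125319036491549126058121451165160482990889245756767221990002839059539736508785872,
  151879437544792173522985239245632472748853170661292479279634852394905864745069063038998383337,
  2849039887626730046467029397928087770083039716739810599102287164786037954299248616014909333537,
  2228763178772427343369123792642648265422840482806889551376932666495204306825748281046075910964,
  2642130288586678124259391122771244380576659772851695203557615912265221841186590069856512436583,
  53115750628858329226573503607290034730080317545937656164186295244587554645983692920523434651,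
  154930240061751549086571275527579664494258483000485859581131992734722494048081617874884543693,
  1234451399165097634007014409062104393552658301938292539395923750818951105850618361990542599383,
  893261471695339161511479579436008246426271256665757107183746449034281264734902105858928930050,
  135594947850387514261532296324667473624337629201560656436273334174591014363581221550374282048,
  3793285521549283150027689054013843557808015590904002981050326837330824711773937849171463880874,
  851509884880912906931134681158264092792062434371907352291212976812978736339502369414288040069,
  1235479886811128064256006910606277317464114568326640007852132055494974687953787940806640328853,
  3375386145453911295795681370379378959328280513361709710667586003150555222702491746397779255304,
  165356164377469277617780724071519021575584907181046605204845088763563734383975991454004822164,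
  2472242173684016503410268434205750618205793883674427317719122822188155170716384239993491949656,
  155226806240085904429494834751111189747040058240611966698133698216259706382748905026077548696,
  2472219578049008099259959541312672231614559900488773625983927516294787221939779305336843878541,
  2593423218530692463740583201881672307862336098106818061620768267340236130264736200813369378007,
  2006499337114144912426482645679709041270084007342154858918546337730894500975542478940951833681,
  143766217182722738106909144106286627218154962122185337867643351545632489927131177467405549730,
  2006499386832711828069260212781492470949492566971388786608002776302773600677170045811280896013,
  174672745672106601661740624308041999323311136810479693976067610542451379485236731268559906970,
  2848123587082414265256680117058116600485795395752102961673245049928217237556545683438780055589,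
  825400460676305287558440028630570453204986488962661120281151662620789344463023329783327960555,
  78527227043122708140110309059484739048674561121906828006837135941570185684895881988576838870,
  2843999033508278688400200718736616787260589656238474667285147708865050202341651897094569812777,
  1261963869836591264337362645344465594742942766573436912721572637353431199559711064375280093933,
  3115725352327321975647100124733103803785558675071407551067979219595809384164600315043741392957,
  860907321838994651699719943778239818657696599502599330387729285811527413822068326861870162081,
  1261026037065562946888750466229715461060705009276027731232583170885831291766991792276509384721,
  2026869731377044095834315293354471394931284279560449436965535150589177835740068629907057238057,
  3179108986012136273029094864828579383410845326856847970758384618947010778422491060816558549136,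
  2265433567914967497256503139857078107092258592741132869568797250995438436315959117055138209959,
  1243627682797029235311514780455939591383599628463216287916589812154641208214806207793915554551,
  1941529428850044881761544827988602658306672919092390131336390555024772982863577418574583218203,
  819103456334610233409659212107351313614589198486017897134231858557269858955471114309099121652,
  1270203334185573627815702727965836662862750308608257314361795450373940388467863370438276735111,
  3198150647168643374904495358225396297756612601806283511283244713980864123238708434790095332142,
  2596501367616369353655529903852998298946366963721053345330163362087247446290463166632878648405,
  3151316042433887517076581091452449135041061698024089886999535194118206820242873153379137667213,
  2657318050159068263441621479641687759114638565090187063256826288237697993612206325533465034765,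
  2447598068498551414958574513498092868331371106874094275073173495148208975385344894185256984737,
  154971285618190341221970906469144038328743783973217566132613074778953253917101302752503597723,
  3486800018548683238375252836757565583612165098237628086974565882184381094950717997282492579975,
  164302576252892831865927734170675936663996467170871202869655334982264525506997197101841165855,
  164137947555270098911739727197122985786545001180072191878069749106819863912647879683103318165,
  58502044067215254238537935206831928320681859100087495992564906423151587711631976723036317643,
  163998967995288187428835663586915062763263037785127829325583318039220603483751695326528333026,
  27749518404419918863338768604095136207016424710673050389048179374792815970004314859768285545,
  135840363206468282115684473724981047950931394113378340306617044886060029044546830429969246854,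
  12303168177342048806591029988144571583758108910200847416896802775009426121301409921919150438,
  4361788035260870614685844787894381184978981095386165199435699499216859433573577898298217769709,
  2596205727560899822176783912022592980760788595693775610428373481405101553762273696300031582375,
  52980502549335033668263353643088742743484948767189599776846817067844137713756890504581521489,
  1047273485435937898930647165695652937554200350295256752497017107200740970436799102161456491118,
  3149534523066021336533908041014433091200212860440582714347432005702919293736129498317480648837,
  1280542186432121823285861043389096627727993811663247876846685374774994809116451434532972052621,
  2171739487081637828341772967558340392922759122705290993806550726816372417321535086461895190384,
  1999590912570357054017782394173929373090436079871829976460589232572306054206630202212347587004,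
  945418328974036778315139539520794885644964567817728753226861119142898387927396139309612475214,
  4121370174550715562181039001983088902580224327259915592361248983032072123068314534847699902593,
  931962887901325053172618858435276465456667639286939085545166464926540988567458469309222486023,
  3583574770976620301468248630803064530185080514669709828989253147289460441021338973339559266256,
  2260364197966939980411172845912662761573552505893359238216840156623895163049957523536598990983,
  856817345703877669163329412408759069675102818659915844270313982765800365981878280474366061043,
  297427271828735386253237551007346045063428834279427775301362083731696405820895291323380769847,
  1053398002136128794702849651438034586187500662533664037700552812340612891845067234798771013783,
  3266777874995348166027369922341116342796300816939618874423879889316491664694402128429475702701,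
  33765280798012327104432364379231838548837500297258558826860053181792836999492317137144761592,
  2873393912588755581731091417677079727749116737104297255623874244510120146679658286073819482667,
  27903075786169477353205453134238777945609354700473595919060057650938862890273874701740089355,
  2452607415594651822456105346436732289315959786812873073672262715084696515557651842936255908437,
  148188150876507325200391686629466328222683139892212382986994562033322134941079264646942883992,
  1111223780626031599758036863667138972499687210923369494448810279751605416077085396573750855590,
  2972393977660454706507689608728992871746787122003095396357047281667259441269047522578993063126,
  1284352841799815922949351746296161727614143038296615290010969494515529949280699852263264092301,
  4354658160636554110997347118742177417615861390560982285694973851671173737296426670440631699382,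
  829173630293806994866459999487578625058166393220568269051692269778012144798594143739129950392,
  3213428371887980523693188839114453438085105827024856422687821468506259778038851159465123774631,
  2666782004731346144562307645713549003257514093156285286875472833973448056265118945306550952097,
  828153737045806860578528194633374583843400518209839055206259265326687793656997489289705963663,
  2598511299400693762914481143713237984124787682189511429263691088442428104750901017443027845263,
  54002094596404757168956255117465888613288750868134733907779844660314897934119149107579914978,
  2262401015055445248746784178352037189522659031803846947139009271343818744317222473612411455845,
  5109439639561441231735281654371848048845906017288002855534598446551550524809203844559096310,
  1230713143406139106261802171226575272617482189001232591037676585586746212739720387600299386060,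
  2643370725963381358098108600464161488533296804932153835751534199964346344552962531030995321625,
  1241108313190512335426017993875197672899409355159057927050230429041585183535527268321246765067,
  2195928912574545354253322065261179680132203644871776099175359681226556189942858274309649515715,
  964644481075593453085204142795734623717053133006583765277361445758964845965014257312684321325,
  62595476825277254320119988699436972268535556016350156626001999702919486866601188801457914017,
  913068846799839882772132162592174981924629971964771293352472810974746046362261073860073915580,
  2536114405409418738029017208658042736588470487480571116876581735992458367924488226323760874371,
  174549639305930006681552701909964948922005620110000589424389601018512655568601212518015446346,
  2041113405780804702962043994156472266310943081985170419614657879951482382917382349888157747561,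
  2487240958921267478059041247468454758782681242230090125307699512172095700896025667247851472900,
  2175575080765016668785238685082364675777112388822549034713470023236430373958909819647966636612,
  2077933228547419988597869258254914226585080866828122559410502982141971692451734758634688791787,
  9632541440580616303297455292287788796256327861669082394096557922673696509768621166217070632,
  27941360228222124371511060215515739051355052793492356115047935777438279188230859549296075977,
  169488505198439015227425283946504778696901900071939260120596091023904145426632552702741711894,
  33767321558928193559610712366565942340967919420595499595553879269476402707787374852899901038,
  1228360047435559345812813217758824442360516670329049073587577052178373208396611129140499564510,
  2149323111072290349493639828970969372857536063752511966104229951653361339244357017097545229720,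
  1236497687667976657131631619114562038089106446155378616476557433364922674928233994457158306150,
  2459721954495664347096448225328318959374370384123446889004009067156601516316524827862978749668,
  28901567004720473100106708245297837337506370063968583597105877114174053603768395168742476359,
  1236784080619502041039947402609086699145503416153788999456499545221826992485384233224996735343,
  3559720868024825003085358662691236114772901137310664016541361813116633344715982364040945091810,
  164529750609066631509456201987203538824416322801988265198300277143672984051145323402937557141,
  1876264316444256084270160217558606620317580725277921445649271875898823836711719219796811482302,
  2251963464029354825437756904502243543498181646386524426148150008756488761145746104701251232552,
  1271208795013502202421553591270049171239319597317906236955881292703184195428184150895953300208,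
  2157238672171184912501093230991930208976765637582619890531817699399534121555825216650480996003,
  165316709554569027118583932223517003707948468004383887875643215000367040383118862278546891727,
  2006636720564354039650916604501549390833845101071680044032169610292321292488588557180653520814,
  2447516300759720563541801804819709211174749720336058882963440534426226427815626523039059789770,
  1270109588361735653215638018883633012895421799000831387784579826374126243949181064160203704941,
  2618614398210351025683325466803163860284757288689710623868714560516704103718017069738961947310,
  1262320425901691623694178892458198070720263075846483306314325674098738041317029000306257010829,
  169373375413572163049340030965751888465250922858551536285178090664612188704303326279415201933,
  1275205201796017491797043178557482829608358825723454556319491500406872793439329335996769936610,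
  165470027874347578655627620653478746393322499654749041064093589610006191638542126270925684902,
  1276204160676057920109744862299216433648709113613870481151314946557142494437122172618067787804,
  37984306354033480681322612583156182745904848601508323090312852390978196911721625126249398414,
  2920407651735697892795962947744391772910321750268193093662416447706921831898454832758421383090,
  1277377362487429158026203678356685293805797614606716939580266465347773019359259440948985995425,
  12239765445407764639172286490704388591993935487785275342798909523059343877520763810358886412,
  1283489216584847637768918304269877097174302601072123170183529255602195393993763753455044698915,
  165156570978747205583121466289747337346448855452090508954386055576575844354776647710797809581,
  4152898476770419632082330016214073461249780278158148372915620941293605498777669984370222010,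
  2798192565593294169682034752320926981812294480041836338250834092859137981980560187178503505112,
  1273471120826043368093083924328933400040154361846828149410667825124200241710915880255025212355,
  2718698537727750918442308615746024418110146462637088275594490879413242521868042244544889538477,
  1093889191766425696410973193445783958255041055124123096279805384976088696537065580501033659303,
  1272131081713380496505659118777162304128291199130456302328158991287918510362300271179411621087,
  12357125728823052811665703026603887248819880494105707987659694859082328090447446664496441266,
  1273148606240826710945121693190062755839660602498812866870686292745037823847954200800643803634,
  1273148606637829131747647226938230528430025167402113064400927763189177964173114407941730308458,
  3266407224421914414940745364050913930722066137272337907569144743229210583944895448460923332718,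
  1284506360334428829669980360406645984038656775678010880520655399382748775454002686092525413389,
  144939654421594924161909783388458272956288309518827598322465210451732228190647279575119225958,
  2001544381686583008512485817876078382815592508387257168761057823567008580787454197580257533989,
  2907006127254837381969904887896701732431432302875540447733997639648850256228271652000318029841,
  2199242817779934049056722132225971707214300489230675483967941028726593188921800498878694679787,
  2446754127321652218287735112536425509927768183882346239849314408522980061208002755939850274942,
  2228763162144933327994431889241767145902416302148047600704970937748490254202563865678899751390,
  248539527528158261383668513630855071634581612866775862474220807998123837040355086983996606823,
  1234847008614543763065209252599900763620582477744547603095524859395186325262411621919952897234,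
  147703696461033311355615013853713168565240687516450083607891051687295069811212410136669594841,
  850786652680498108531674084506324189263618834638247838875720636149473972329673718188317385961,
  3162516939977736406774701514699825433344037922386176287034887009925358084122852107374370923373,
  3553627843058745303688967829588519489100057505298209332641684168482139202894730505936436399449,
  2843705829103977150277881485483576994839675631420548348408736379055005286157673267900033015960,
  2561574269580873539851963193513000596161946195375170554782289386587822282739804749171922857213,
  1912989537686908520133453690733837879377345627329996722645976944861450664497906099736981671099,
  3026278939111555886547877333208455528024464656733670701925003966478806193989876811690757187415,
  912594241296783966458840720755431612872441535218666652423482040522120214929727079230823490432,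
  3514926342718860751238905882213038108966245775721877474018631084149700615662988545392589090003,
  3088503660752195898550063923308320506133534097976965011006524189818189131980934696256277848071,
  78529347158420719626264480190928879342696097549314931560886224829978545338402236041699696775,
  82649166479809463098843289292892295476021564446797220215673655291331474935655655241531108083,
  3255450677277493745638875391157801692164956023843943435521066251656014681025884771748207996148,
  4340312579888866795580552468292586703028408041436089363954893767801064033773559944743069479128,
  1231494053411625807608367754096909365114032566889445734891622856406194332497117861805240541351,
  1271260891534738272712154624802473609702976125148250375944283093711000865371581843767816522171,
  82655140255908782128090084151823771233342743764023275956352131191020024262878429764636189923,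
  3650387301950784272152744541249397094213858900435060331739118087981747683837063557293201228626,
  155114882843818522191880244356885531580525344463122224725165730014284597317990829522138238488,
  1232427597610381582757232861946653372747211936732290476048406592212938303301145286610452713464,
  3821498436632188721647878260115363975225052918042966421914428274058986714755290577663171608609,
  144024561773605172245324065076006181036793998523967995239897618358776180081240761793842480180,
  2007505544324886124715797594139884373323220128423031828187701227151231585025188630750974861464,
  1232805372220665766707617050145890913024084398647964252467307476512083392922808476902286699846,
  1274316446018983891924609587012474880188214228887366173305717361891042609295538659978272531683,
  1876642413523284599680302229216914229631544113414391967228584907773687295293634882546885994327,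
  41779267570961695556225508410077995431244425634894210993180995849668251721820489614748926833,
  1809044249770512176463309864372964226083255683834661107452681372255146156975902176592368739522,
  2969998964085294997400687189581826621550415327832069162440796464919552317328298167914450249469,
  3212406745551908817732069988881369849456012151778992113337755927640262982040984497386465086716,
  143912698058683066458963450856574243805784368354964143373012274647523297761582964983588667559,
  141015432347066641989845296863190137899757493984920210967161436969137290485337939138028544021,
  3277633409599835975454115012181422884836110732194821909059158273180238741780431154217843843100,
  155131810941880036402371574130743020962500175187411013861130153511988829382722205150889656361,
  155244841145121488968372472177321465964615713338228148248069293697829378346586182515113675251,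
  143737009684671582470682278178524621785882616013902244569542107907407093756457095021509050837,
  1222280824155741414394479224455882182989981771873849954270439400816177726822551028179550371892,
  1265153654100701996628653520758577218942706753010477637916594286807705043196096063406124770481,
  1278395305018362329116264934057640473430763541791785243213998842344871635605005985875579897466,
  1918025687979717418427829598024431134287040743305853424670952719806698843504188487846870074605,
  1234451388146514737281060250952037981481278070450060903558865090763678570100314924845108184931,
  2196944321397087969715606151473591561578259537714207716704677649610643853374314552121919670987,
  2214412537874221806846057007431403296643128856870796541790623121328305150191435877143885539884,
  2448535069867685010462771519902788113808780651508607728030134835698155308524237994908976261503,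
  4011264255401041499703754063283727761333453833056541284548082236885278036873175435979309231348,
  2855180974112786450104178297822908894302089412347502738386234494560461639412698797959699734695,
  1678671975929506383852205988771770613682563339721009226628347169659929760042418853546283729063,
  3815470461578014282168675044965331314538601310987362508655988529461874332302749445227493205627,
  3397091605292547111322227458384354618928892332166708542991886201589930077891315394897791885470,
  888255978061623108460552637102428056603178975480018519561521861023960469208988278719521640169,
  3398795589626726323786378446906488728490592250583930549489680597357645355890287300172636177241,
  4132278801823644446035960826015966187634793672527461684599847962574986364796085833324853588265,
  3446061011849111409152092735766564712630652722430523101126459390906358187497955254769707335823,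
  135700132401662684611390217439990492800275994134928411780454506189705217409239367959499320655,
  1281451931928233208386865404387081698514260495087248230559165300026384205332646196849169459060,
  3861353128569868681910048528215262234500609687420055403302345951545796419016127108368457410403,
  1280432705048092443104422355201111237387837440420557960509477519614299279873812012856720138398,
  1227453304366105826885942844120259580604138601414206401657596810562512771569847389580213528436,
  9174258549958459036074282450774360320214723727834718219382740271482510937934929926166701282,
  454412957005542768507382919986775228608033210787190339973404241389637500129373214447002683106,
  1222277039365364110473616527294008699759209780290030374251595242883436164695737865826803572869,
  776632804818235679990353093409974732026039985881921208684489737241248380544915517427946005299,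
  27516838597319711327303175429400705858083615894977583134066200076555752078641699088909542629,
  138059094460016150994072081520961220355196627397989166104863697886601852630998251363240217077,
  2032188443223340774966249800824624521674994925922284688381309299186312923418651550300673065012,
  8254073938858660948194984039364307875292570619031199241001066965003372992377788289116154301,
  312701835926108719952627165000790866018437700197998557685712838908105396671070338369128024332,
  161233827939478744416386509307079156693953229025482215370239721073626917516244755175377511605,
  1272283528831057886404982654661404316937424795625381957932751608285814062775180713076931323827,
  734653718535064443678556762319224385599820949644616728463372386805136604449713081860259546740,
  2228534905224861601584892438431730955232145748826490479168554073879756404843465457828967858311,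
  29999675584342642349783061016795041238917546682071970433147831210370675475512567941644912849,
  974738553022038491683256377431097731158227403722832162483160476247767191177962990905970196541,
  256820473364503817903878012096997739651104588518538868247875205965564499416019660430158039119,
  2594168847527787990336747854208582901118615246926948478862579368715807148485622138128395067734,
  3162501961161985347891420388897470405438968972418396035850694053720158631783434633939715107338,
  143975863584990982719297886013059381083814355392511944439525671694081820963302919474041545153,
  236302781592400258969927832361867448054302393373003214177716215330770491004026480830056335714,
  159125796935734708707153196525910625695506500266357891609105548136352454192626858690812159164,
  1272148364971935997161967448029921696230145920517032771135183967399410822487216067733025211621,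
  457332374814646744008904127236869159518286803324341491061993012743662923074529881017571207214,
  1276204160175215449232410961705271099512006905701820580845749540823691759186673026371867500572,
  2853022931169111889119960778378164552786194973741437157481257691331725226987816621711329616028,
  147819275708221614467730714407654151936631005337574715473570489618092975591245153809672145718,
  857747454084823149771945857398125889814482270902974874969504289327953571906474705919126683656,
  143740972848676199188380753218490653923357888427488749962041625055573152656368894464494773067,
  2373419215873092728189646774891339683487243698574530585122023936702683651320820316417428277390,
  1091984470541699960809235579144719413311706558953875894932890776034386825082984070470693276002,
  853518700355561576840370800643353693326781923178719234213490340971986743914123987016465858727,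
  37817828554323958209408727054548876941640049724625609620718172741381060761835914175698756654,
  1093261942699136134610252337690162591360006934114375313482122489243829739831027272332754913836,
  1274321170069985906122478984048104787336232619792450237387461936770539131633886408512332670185,
  53093611724683592604759949818690225124903320976321525356081529293060821277779123060840236263,
  170627921150404840840594300169210484668658658465635428403207707238169778752889575121784973671,
  1267170812688175326362515583473449673728378358861150004034189986543350605254615902363777262816,
  1268209579309429859953670434819218298326118954545961302451638884952530535801350182806071543005,
  58590922641205752492253124831013750116573741886904527036335473098455175313590671818698621069,
  1280404953780086368889633305555389769745923853593818432652321399372277179912855569163547855003,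
  135832560662618907208587660345041958447686137715994138315369520272098857997497390307705143431,
  2928243335609550394442932080109333300597174663857870279773235926482824883798746208619212186858,
  1273252718930581015434945139737264420110268818159349149908820138559320743223990943544888066183,
  54321517092247433108101118072399707576436101987289137543891196279126364602306009225130427629,
  1281451931930061557119534348533230658040893847751968035358713858381656426347395856505319801664,
  2688125467253162616686683191893721097371370820110267545001915436618465264149097037914529916786,
  1133956546266230946208794743457634225169254697236780960995557700999573472807558967405466414127,
  3768865820159778500848921197414736137165844965221536497278512727130326410067192383764148823269,
  901593839051947682588894678587447261325082485074068264983565296789302887882240593663627125984,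
  4085740044945734146093926567994994129595493589719418153714051575476109492625716493425871275213,
  1225763207274806784599775765688231415178169294587593352289108704107252323660912805032754708621,
  3377788341368101171135136609370786749589356415972603101620437101625775997587045350681316271284,
  41870167311531012582050747449729183418633325607220613751267944937795586412976832563539026065,
  2013765229826348464035561241980615379149713078109634285815426604591700909994728277337585689776,
  1272136056446278659704797925560973062171268205405790555692914021164493969910900245058689312953,
  164511095644417399518113278001497522966279732808291085525266726993308400671232906080789359783,
  3646706432080904246184737413565966626846780348287983875097365221079871710528879640616005575861,
  3329801265754238250559196763105762797452637179645648117634515395921815932439964245021561340047,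
  4110738975412419733347678418044563614187377677960320107401161541953605032207538407611993132253,
  907517071489600884277464541104894643332874712628746143377799200856065954693292561614554038428,
  143828509404657455273377073009580929931878526000423813578788581805049692257384014050347371615,
  148046706128929393117758866577027684782538028093782516417850265282552976960150298509901860082,
  158994762687036260355513534377221240497182068464310441444076676298653404376250527297326654687,
  2665728296445593011714497705329158057943757893569297581908761807706771483903520411624795455525,
  7484111359078167932031882922665400611667294735036837341658392069438042232195111917377719353,
  178259440222901808512417510024624505109332697759617135826501950136625679870400535950390669160,
  1237609085733209066201302650391334780859493607538133933811235052552176684949011982321470115795,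
  145768426708213286476319199315416843321587613136110706040035387582699592925495619769547031749,
  1263985425700005402952112277702588419322880191979683095317659006488870803830414436898580210879,
  3398799004827752575118031410801015683668195159558907831008243780324793425973631948524587379956,
  1280428937492860716788519350389299610849356950894029351989291398141596598068026247737228807844,
  1228911017805589860271110985385394648300200626322665284237069416216913409935242205632893413048,
  1917007653930604161104601584403074988998627354592297562104946900672254836510675278111404729530,
  2323245998268884539188325320237522618113684308208964143241129360822756291830747636388040746861,
  3321700102262880945489842027007354305347551359094263930112638619086891943121018485947474487577,
  137655982556867523577713533786370493374712257802339008721958930392227157988498522894635712856,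
  3790307644260753064718156319274260151374686403667663087701951778658323808758470950847224111141,
  5242425595080473162372261055009002110438672217907812525179849021960106646658870497154441351,
  1232512324741567016327944982421594048097134709456789490737132579281760377641889746255471240382,
  148187452763990721487514764387863385639696476160416216000802792930158104516786541264466938899,
  147792057670847946841731815497410364089924573354666806262545330537601086324919455497966985268,
  1231877039751469495441627642406675085758804888414988923693473751275104301513753622274803041105,
  2178815000340057478857838473654935552378542785476158106623158376739447397927518347019575566488,
  153946410139208578048884400400914608020326224772599407788486727768962234314106601645084049411,
  3993071924815630106926060510901766650294780141786364066922199818916905807123564450914997264559,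
  961488567064324344150760975906592065544959988799027551024518155808198035374528133872196379832,
  3790203239101373422105723068484035888323008855479016908782661608114501205766246250514418311225,
  3154699456905969352048468577181151407206727326028578963171861690050140258521801642373422964871,
  2156353270818821359454671117209761862479813252654412003290535971676415349399409073541902101842,
  1234572391847565269932223853309447847971431616232209659513483969191005278377284848744976812123,
  1279259016458015522951940941310411360137752330714083765046585752247810548534553874824586617717,
  13518365336072401815898957167475627369850851896623688250189013076303020019842046109843096809,
  1234461848734086622693271207702586307828383057434463311692648487284501222238806471003654432624,
  1280293906683947985670552453515911880672782280587921393511675717637639177292947483474097088543,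
  180692575939321494388334688534588327323054452182272197590358226042447715975881918396882620157,
  1003454067580838089746690769701218811789392856046846277784053246601366902613209358357302748351,
  5097066025539943718531362136360126174904948058311965128100752875754462478605150999236321418,
  2183901390353224366697848013075721495972312089412401009039713080571681908163668146085982020794,
  1251776174606628705800775474807976021071056900959769265625299806833828526522700616787623215266,
  3435877608437415338915791052114043568239797837864524344849700740756827753142799928725144723622,
  2984559617023976756388263199482814161881906577321720278964015519239829648361169677404582978744,
  2189044469849045633638575459411146226416132761463450777781376876923782920097015610291355328655,
  2774742515289486250325951051739958945643223046645947850616468339592169163841758198902106851489,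
  3856128376621155628700131310406261780484851750962548290591676618980003448172375905711883857148,
  158023482058621748080994517084045097011476136695978208044092843850483711050286321842290782162,
  1270245355724150584103507356774201550865470973945873420669363374121795245501521249487060886422,
  1006418754012916456324304919073010027425239642379553471203040429056645573299463313309249554093,
  2164371490563137002772234516519844768921444290450041153473150877649391581590283235678478771161,
  2853891524444636721427662749024916986865104132886152287505351428313631959388393511451900264603,
  1000211395946621316034522047841973998904553455934511493849652157619013761236096462760176943266,
  175202662312702530310707632180697858875916967731995723192672438294148982346456866908807996414,
  144023231680552821564436409924175642090159153104663838362278288582920878445096205331850538371,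
  924927736690709092661195334100497559119701681174720548839114425342472689397967989363977987068,
  3422466136725438053352580330414110566977011346595106397983431793043576582749252116155264639887,
  1015479990012757195424738526796919227731979774916806816335939927686147923829101848112377995426,
  2187732268424867078604466925256927902007408648382645206424164401616568296897403853138927668,
  165299440859230962158646906821374348320817533485660198577862287709695966485393662060160024579,
  1230391169249072417257793851985725668984449376290026331623551707994949210008038587396052446232,
  1251908846264347594485172125110201449036752222539154588868341592492786473065037828003876282420,
  2042242953160744529342848357604886450460912080181666791098545534583732153304110356534805185752,
  2716686492183328721772682426405938192793836989252637122824234973148943747611392835683354124325,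
  3387949565570204746779589247942997481149742299726463146259012583932540464241497878797487808678,
  1230719864145057740855697743859812922343456910348251264217562269726337955829164663363113553647,
  135876215209841693126340137944770410584414741369738544262172432510083391826026277616343343255,
  12239793495807738342269940562592393940007690074136963972505011930179368232325215115406852153,
  4125001471319474972352399215291302127426647920962229165389188453057131406001587346897273899696,
  2835710238599668979173541312717989489616002011951664409549073409461265001171065924890791379106,
  3392028197366823795704905703494843969020127310082849620264538879996398866659835020200311655208,
  165473671780731278349413562629055922526058215634454255464215706533929973970434264393816694946,
  2057406739444565753822926051660480165173469437889223565712918915527324922127570618014305951751,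
  2016683183716174343164035804822744116393405812599152195737831408796428663867039591930610780154,
  1232878528619390680806731096915276707498797389905539720539308755467116088008426167432851507338,
  3869775223458160831941298189363954465999807571709526277295708048235312921078859298693642518581,
  4145601356421700902843650728073115908822876790924529177334806282455616551261956271118938277079,
  154209770474340807858289161355942585737977529425765446562961175370506403308911138987994456101,
  53438302625057677005272167591451155481247372345774046178203182929611394619149551515244997285,
  3534682791184827985541509695681140103783361968298192944499966836488469426131824743332864304344,
  3852188953200203777835584061369880019676502649905113918416391708425388253844349165681175965694,
  932058096819967871561669571903736548732033205687580986559591738943427801409940122656957374517,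
  1267055338343116617965641202654513130439711633157418512752019174095307144502110347413188354967,
  4175371759239846676945270559458882375145664219091550482997777275820253935301029491480054939800,
  1148388370553837933473501896742823381207436725366750840649984925839346737237550903158765830296,
  2452611970311737247975869783306307815906485646427966041313153505046453281808514814669392478337,
  2494506855182563491754383952205080156568099250944924394455558474382658971776706863144589340046,
  2017701715520324174923987826950246265363354217566303037217950084158206138543414999790588971412,
  1273301549554305813566399086854203425923126054891643597286771579607691872000129183422773946451,
  2128855773179062387464912434117742802030699400960097034780298965216722578173007317782773563533,
  2012595650056285285967010225561282718452821547760049014803261830566132921357811004944717449294,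
  3376769337371433020737232095753390905967448273208364162697361710350812368491318520448747252470,
  165021360227557403797584738352315204233167457191582395104776738584415810128583416833835548839,
  1000205491937289502081028861831288390062864847485274985402751067038639313599891378519817718787,
  143765124506299797369255906371946084484750476677603820510027099362689605002891910942660608215,
  923907962281997382049964772072272211425499565513615086590482105544211250195969688294852685235,
  144097847213824180323900697149698095421026443564421994612423902743105909634690105356430943112,
  2017838304823401069260524807186626199517391358989495218192803692880738643275995815142829261848,
  3009035131501584838642539135112440691638139350233974190737302181173557419914615324813533760160,
  144875854077800788364719356578302315159226057778375831351810366094098643283920371607781770425,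
  2524037892770310114233865980192007362983887940092794246953123950459534093540537033125330028472,
  2012595684081736803343127738233502612904478538375999829366495412301796800357322726924978733198,
  3449741813135172307429099952891062783592152278753676614898120931973686792365543712770051082870,
  1094042365605948665469499421596231358591856595727527231065411846436675633806968859170586255526,
  1276205152934167746817286977244033653116819219522321322386831569798810524477926519170362023969,
  144647136373470984604665384682165584366261263846129613399726315564184248791427033564900870941,
  3450042445243701287354407182259487790353852277375916150927087712262205640912334147725823690799,
  37996259945038126643581572920574414707223300087895344311509306830204392775144184443942674573,
  2183901373739986511509171538646259657807936163025179384400953025215911278943390646561901184228,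
  2080062393563936166854750107087924321086340047648891870305560490309887856949475430730147979419,
  930944363738317949111475397666218896626563650323800105166454869235528070118194954182925418637,
  541851818919963104854584673669552712908173246665530912923606847814680803308646660229468053659,
  2448790914666685691554380299372644991915888429781227315900652444355586704702985336565281489359,
  2623703251306899295847617244466826992966374257435122270076632267119158916030472281175391144411,
  948395411970322665853832097060216619638551883129826165089588152546253843355308239822915955512,
  1261947163214371779441300334835645345915211199901919016404921099948074598914178199851057218529,
  1257189893463641359343367083242303206538119997938595169464792292563118728259141679787366006925,
  2976468132041641488821127468350039634223116195149071563175237103519659463005502551763510255620,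
  3939065851748908656909684778245160903755243851134159096559868322450920359892086505190939798552,
  62520521268186292706402359882489147022134784579811248692669058387501778827489511633308516493,
  1082840823173017067010204354635071770920538499679621507969961968717783091446367879144730231996,
  3060154831859628750149301815661714876851033546210809192351518108580384599218309758418453539,
  2163585125783650653342050473901262534643103970049743571220407146873040177566587543196444543332,
  2453876926488012115024356654221069427270509365395246906325867971392081317389572381589686356050,
  160945924051208916670158276557125065848995619314260504856636496552486704542365934898740759286,
  17533895187624251621814113610123381023379706996997649010992354666691087120531608938902659124,
  3131946185785794970133923561238650764883107890840904159006936764044807152743807532600802419931,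
  164503876442112744317095728649703758294044018505867276375663104181583151309232294618937437426,
  3605913283429821702685608923133203317212386285365477689956548811675351342204153709572791386169,
  1015520805125504833809329531093804892089174523769120096750238918612698298341636775200634974348,
  3154698710964609956823689497873754992883180807339822343273260812926011251052268326825713148045,
  53348119455857764617636145315381669913431124704980793848876827142121903348147785249788747934,
  1237650104323241135300729082021187701631011154653138138141275271228091811777743224031910764551,
  1235463950564601670154898647334695112066149687253698912379436547271784593665612317681385717898,
  3459186601237713820629714030866931234016496773890673846832395618057537301347870984742698076086,
  2715667850164759090626473848947187217144217668562741011184559477358223066833870473517279469729,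
  1262962805054915907941048746977359180249934658135960651374308664629931463126095520024462069036,
  146033169292873054956749331274886633987526630792014075320755437937758364312411475531326303521,
  2812439397903763620864772115999578455094551372754981532421348447652769933139683299347517030558,
  1883395966985489611920001892978086797354983220419144502648283233186773735371680344345128174649,
  1883395961887717425583546168305681820523160019772934686319200758432107924506386113116236162874,
  2200249535314288070294297704280112804168966992488719943235192633880149778499035054598064210072,
  2227499711228949585942724201680470601824116479940650823220679217701234942466218936059152042099,
  161079766287055241375493981032625192966911711013613368765365707374467498913212474540115323041,
  4351535597479897156765745293314319748841244381669652478767504459229401486474921413892900465235,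
  3154649258339487186454554331263959731727615403808837263311405920198462186474766016144391520417,
  8278074078393241045712992360280155634644273504086971314984547182047811309368320222822572173,
  709909027248232366472904778969410838335090891403571367276237405393365890554457483254454012659,
  700861973537633267190656010492930634050466950555673514941224209494124232928023999650668520403,
  3203468962851994866546521912631941278681050049127096628453282574778441037175932325189754036362,
  3267729004637593344055354030412052349836725937929686630888614039811157538043420068698325942299,
  1031817033483856599877475538629966992451775663973643094039923938149577828427512350735799766662,
  21540328537616401050439676215655020565095225968213684459003683100413080914403578901353112773,
  2203056461476900992783771364984864199233641697734352109782890623277256614778989057192119689688,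
  2666782004712354930391509470455983353182322163637623931929761136609285244902026725766884780362,
  954410538690899260493756294945756162098307319739439835239175161387740336913944636165965652111,
  1089969804154809172092803024879761618971510710028184885334562177597828702052917464067155886223,
  1751045916114104093260788644146135747870605242780753344068698556675496395834943331734971334797,
  2985413112101053261558340048585435827344414299381976504881982455010671110777802472342315879811,
  160063499867629317512723721542581865507731741182106165283081338494449190227255205480452685986,
  1240952397326669842783101343646019361714682371564999108882045679013236407720387759038754850024,
  28634891563440634588097318066502354979999513680408064345430463274401161229164511096840619233,
  1262245822104786324290003510761897943530393272086708870275606963296913840622361010130260601385,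
  1041961451087848842973643676650326109760626971601745610167853919295778356557882100164335551714,
  955671872694513469718320606928844409752811574261170754298020158019191837899397197415082860705,
  2542377433398158655663821679529602603085993812064933943342912408179640102541682698874144392947,
  1263213082972049099627191073924918214369857049727022341428335748590434852399477334934817120411,
  1002308359174219864990632381538327550343613971689574801989729772774275236616675539722738418920,
  161254233323494487164098933956993267463212397916624269818452794710165893139848409436516502530,
  1263398136916278005401740647439237460578244044686140183884525150891681046691572766455778443268,
  2201280114772085632396850898697399116451154097966988544371980670800291552088438552492030001295,
  1094117977120453093241092502743917214977554409125208113726809458536413718546352776632023919521,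
  21745974776293092294470349175554854014629635224826613539388619191591102423364337626319668275,
  21408538335650922907563362219106916759661793330824306964416997973032056194881271306317808085,
  170248806839779106438671177893358625425784756985682600392821082145388106388691299562486203589,
  7284933514638943440478658890857508967101247459676796458710357258190803533743876885612151723,
  1263985480972764292548800139173657147117964474631641272495591573798643903401526735132789777632,
  1254831746373461579907094094772506414268284691466060736913178799290423521551854314008558537986,
  3822911677182397576638516913043379966362189376529452419827067702856343497515072854582379913365,
  3388764761009156145934895460306269170621727202931827280213253164524995598102512820120926384130,
  3206549215717059217235512870357864622602711890726131709283769558987980227660976178339097866,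
  3480276854536066955574499621761369675045216364867492438841304061484012673527704773969928250601,
  4171246426499802677167420612660013262743848232629867916331431183201085664780801971913723235730,
  154832279356576637433224813794541438444073725597396384836581617185984442893450716189960249493,
  37815466559334752387593996231876371272996156153206386935530882223682450551462203781137509634,
  2746961914396185559592375495970853754662007052337487812502094330705782090681292360122913484034,
  174305828746262803350670210978295989116513346321436133462391594750756151630490337144015544469,
  16314865785411874540089996514896789792117592994083474255572503353064300276898144928645951151,
  3131270683620189111556901647968420821455823976242551290484972026988440167952914672001338385326,
  160944991218071238580740806120510300984444918181497114351880295736142538880555300045095144691,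
  960580098168414992472537550282117849457772049549719598284003745921506702980264472756000795650,
  1101035535262854450580558148378155331698536971962412945308983715510792890830924916633422455728,
  180667114741779034554372403367837578904815680226324457161828640942908658424632976125699015868,
  2731930100490326053003180110786631978725791041084531729143536115397999177272605312434946122976,
  2158246146783229101337664182919921228136607910483770357663664710541717993004719237419534814034,
  4339216391463810705519303932206889320651787889189809154950805488511999883272697008459281967863,
  143762736332517573358375430672679467199461663157668407230456726117382092914472974217089786017,
  1026791600407627888811972881271629380566307259634049855555929751174296130540245824752343073981,
  143960051732433295261794102867708059031186322295246661880204596200564565268069800809985172460,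
  29020056505318531427946877801654949291675008082303296257638345354759179241542313329603333362,
  5357441427982334392561509334297034350601470555116817727042128905458636515716890769585089537,
  3822630672874207171834807620795307077971214681652739303886520031248064356749350988571879482558,
  1271111597169897368563933156687628039197822857438643403080627337018965799822672761844622172316,
  2016793431017158824526789218038623426074750459089386791367300321490516731261828507797913044197,
  2453610722603749312452586508165814904783063493101324845928508954058233001904538967599488011578,
  144029081407628146892888068932696693702491438091091485575564809625918527266956543895746306056,
  2188037006253729117091917930158219103334556288493274095666288899022115538093767535521540956293,
  3849999004535976630396621197210403954856043545401628733072801181038889202209928042845696068559,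
  1107145608154640069376380553833072478715597113225384445066009531403841691360332816724254826629,
  2525056906137651434217818343647247827794780153863302057300411300307357918713157832099759957181,
  1234450393549725559425017249498760357457703562405399980827022052208356774448084475966677262491,
  158024957839802757389526135107411129432792914017442778604042223265403499134925191985584318437,
  1096269628143735390839342610260851848298269164612511178979019669008716727624610683192403790369,
  1268209581191391732669190138464249227008874512852496791145328029951042413474086418933200946396,
  4367817338222044877340908158309095032361616132287042651364667563281975071973811164700902360698,
  4660759133532872599813149917814628639580964978728869779894278542423794884479544033128448311324,
  157313660302749171414804120491366971525083149418639192046155861943623901354505522796244935914,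
  170322162121140352080404758257588409257290654355976454747633477559637711750173982825576939678,
  1137705373073889697742305962811989393969203794181057360030077135180025662205272873585062765619,
  1280277500375134929279901533018399127964064901926335681733941494588788986409555541443294856408,
  3155750921114650562753385722046377349099511531841405778490178679163936366737811401058812608541,
  156910975992654756388795262223380572098410329955761828063810958232492558235380833683818900530,
  1751868777268323961378596487996742683888739392705090904665270663087334470845529492682963069954,
  1242611633559378842304681305480993281222864378774293931760094636777721987830369110342405014489,
  3914615250053032158594828855259747161311530924031280891152502826750082462112647437416176984085,
  2181820822295787959725543458372590666792329532638558500763980550674124469974735000266296369324,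
  1260945465949098433544122347167722723877973410189387050827684198104082395361857977022056456333,
  3131960227276344479949648067291748871207390410023885474508578033616920126304921711568588742658,
  4373928441946279530023515115396836952599642755002048477318208379075238814124108845948857586203,
  2182685556912610923705104515363388511338581290322860307787028140415200536048469301615069692919,
  3549932693164258396936693306089811108288697904625111537668453637227069153992483433579287783990,
  3355151695954947264672336158602554407970195660872629649857089027048678502128988902586805956019,
  2203207213298099295235534384021960360593843650667883686140501882751696682100701408354547541190,
  1272538527248691711250334051901528307064396984233707673455846130921040986300847917390840645976,
  1261274142102283616691991880514174265252645013887158096224779454664949027791498342493785457337,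
  1748950426308656994182751416294464447833010557233870177658255039117469238818142688150601834649,
  3572375896480312008004060210706736914372271669087200309410389633675909181032046636197261454579,
  2182690514028412447544186536704654060780176627729853618139623223623115129426650274282224754860,
  143732758335272044122930997833698065674894897155764056487854165872292164410045035156001221174,
  2663707923108510649150295278234641061513571580364877139868087999934983797071737253675956691922,
  2591129076898117603429369600128801106549379426279832992280060439141839436038216979509399145585,
  3911265236523458346582357903271639796748821452134305694893651298726948933176980479859085298691,
  509415718274539829645009185808308338162295522668721561865810737157603994668048093110644170760,
  1064371342853551596558130475337600781302711773731242699589048429052383832915506318151025091637,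
  1273148620564272702796814943857825650777247235061363422222000304631497689057672355782072705186,
  3180985973941167168095485958641945929724796272933582995898778570849675497171784998770915329667,
  2858986460160147492287004414177650876775577712896891102589557326332216057939119457753224552475,
  2837610447533779864694871482364288031531554928862502284109508956909447291131896651769320247402,
  1266427547869731805477650841019965844747533086376560996732301213900905422305767473857971850364,
  8277090270131982321275908005994042447663893445699614693082525663911772643948943788987229933,
  3156409289115239416708495340053523108810250878739891704527925324725737349146280086523982251095,
  78426192032889680227124798858856103074783266613223646327385576209993247092251250085479017523,
  1251765091403599629834085319611143648181950183785025290852373521584263712218072384407720289486,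
  1255985857108404184130305964840879897870792703002013822808938451458309615283574658589167381218,
  2837888671473064917424624954511040304174999342261436800259670876075067003091932046515274245088,
  38097200324537652104314821810445621579922964477606623021807918973472511317925000572780473840,
  1015586665953208659018623466247343148846815959958741499737742448902195857790795567711342012510,
  37819569521120189006533257583697185957443663524281469097086843440336266660477487510297084902,
  7281682694299910446644414789896184972936618541695624434277506063622041525692544529229751513,
  4373522706498477169097194535658249994840624096301982265971027994162227897962414094264158119135,
  58073376063033493837138114865356163822433562198474746682368000650166461540901323549330575576,
  158455582173326285397637254001782056767209675453955967309327912458075979515245606467887390757,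
  1823369521264503019347124949803294231040762052233219537655459328334422506200117143001353961480,
  1261447707836182390291641930924886531736108637567879646892314698688624417637136613883376567297,
  1266145424850668601263886557896071235442591228549570309964572368682737679794538656630058836121,
  1051128159891582463750689674656664329922428140180349968416790079388159236009582033075806695617,
  4574316219249672855957658685801888334863764502306063592307792148207267737574060400027117564272,
  155987237505486147453272169334367540246854473225172339881429895322819438989974510421619187789,
  156055582737295448342023332758746362019762148323390202403202559169059504312017058932379406535,
  1015]

/-- The facet normals of the representatives. -/
def facetsOf (r : List ℕ × List ℕ) : List Z3 := r.1.map Z3.unpack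

/-- The point sets of all images of the representatives under the symmetries of `4Δ₃`. -/
def orbitMasks (r : List ℕ × List ℕ) : List ℕ :=
  permCodes.map fun s => maskOf ((ptsOf (facetsOf r)).map (permIdx s))

def allClauses : List Clause :=
  halfspaceNormals.map (fun m => halfspaceClause (Z3.unpack m)) ++
  (planeTriples.map planeClause ++
  (convexRelations.map convexClause ++
  polytopeData.flatMap fun r => (orbitMasks r).map fun m => (0, m)))

def refuted : Bool :=
  ClauseTree.build 13 allClauses fun t _ => (replay t 40000 0 refutation 0 0).isSome

set_option maxRecDepth 100000 in
theorem refuted_eq : refuted = true := by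
  decide +kernel

def forceList {α : Type} : List ℕ → (List ℕ → α) → α
  | [], k => k []
  | a :: l, k => force a fun a' => forceList l fun l' => k (a' :: l')

def pointMask (r : List ℕ × List ℕ) : ℕ := maskOf (ptsOf (facetsOf r))

/-- An image of the representative `r` whose point set lies in a set of `Ls` has this set as point
set, and so does `r`. -/
def orbitMinimal (Ls : List ℕ) (r : List ℕ × List ℕ) : Bool :=
  forceList (orbitMasks r) fun os => force (pointMask r) fun m =>
    Ls.all fun l => os.all fun o =>
      bif Nat.beq (Nat.land o l) o then Nat.beq o l && Nat.beq m l else true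

def distinctNums : List ℕ → Bool
  | [] => true
  | a :: l => l.all (fun b => !Nat.beq a b) && distinctNums l

def orbitsMinimal : Bool :=
  forceList (polytopeData.map pointMask) fun Ls =>
    polytopeData.all (orbitMinimal Ls) && distinctNums Ls

theorem orbitsMinimal_eq : orbitsMinimal = true := by
  decide +kernel

/-- Three indices of lattice points, spanning a tetrahedron with `(1,1,1)`. -/
abbrev Triple := ℕ × ℕ × ℕ

def pairsOf : List ℕ → List (ℕ × ℕ)
  | [] => []
  | a :: l => l.map (fun b => (a, b)) ++ pairsOf l

def triplesOf : List ℕ → List Triple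
  | [] => []
  | a :: l => (pairsOf l).map (fun b => (a, b)) ++ triplesOf l

def Triple.has (t : Triple) (i : ℕ) : Bool := t.1 == i || (t.2.1 == i || t.2.2 == i)

def Triple.det (t : Triple) : ℤ := (disp t.1).det (disp t.2.1) (disp t.2.2)

/-- The unimodular triples of points lying on a common facet. -/
def unimodularTriples (A : List Z3) : List Triple :=
  A.flatMap fun a =>
    (triplesOf ((ptsOf A).filter fun i => a.dot (disp i) == -1)).filter fun t =>
      t.det * t.det == 1

/-- A quadratic weight, with coefficients packed in base `16`. -/
def weight (c : ℕ) (v : Z3) : ℤ :=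
  200 + Int.sub (c % 16 : ℕ) 8 * v.x * v.x + Int.sub (c / 16 % 16 : ℕ) 8 * v.y * v.y +
    Int.sub (c / 256 % 16 : ℕ) 8 * v.z * v.z + Int.sub (c / 4096 % 16 : ℕ) 8 * v.x * v.y +
    Int.sub (c / 65536 % 16 : ℕ) 8 * v.x * v.z + Int.sub (c / 1048576 : ℕ) 8 * v.y * v.z

/-- The linear form agreeing with the weight on a unimodular triple. -/
def weightSlope (c : ℕ) (t : Triple) : Z3 :=
  (disp t.1).interp (disp t.2.1) (disp t.2.2) (t.det * weight c (disp t.1))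
    (t.det * weight c (disp t.2.1)) (t.det * weight c (disp t.2.2))

/-- The tetrahedron over the triple belongs to the lower hull of the weight. -/
def isLower (L : List ℕ) (c : ℕ) (t : Triple) : Bool :=
  L.all fun q =>
    bif t.has q then (weightSlope c t).dot (disp q) == weight c (disp q)
    else intNeg ((weightSlope c t).dot (disp q) - weight c (disp q))

/-- The triples of the triangulation induced by the weight. -/
def inducedTriples (A : List Z3) (c : ℕ) : List Triple :=
  (unimodularTriples A).filter (isLower (ptsOf A) c)

def hasNeighbour (T : List Triple) (i j k : ℕ) : Bool :=
  T.any fun s => s.has j && (s.has k && !s.has i)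

/-- The triples are non-empty in number and form a closed surface. -/
def isClosedSurface (T : List Triple) : Bool :=
  !T.isEmpty && T.all fun t => hasNeighbour T t.1 t.2.1 t.2.2 &&
    (hasNeighbour T t.2.1 t.2.2 t.1 && hasNeighbour T t.2.2 t.1 t.2.1)

def sameMidpoint (i j k l : ℕ) : Bool :=
  i % 5 + j % 5 == k % 5 + l % 5 &&
    (i / 5 % 5 + j / 5 % 5 == k / 5 % 5 + l / 5 % 5 && i / 25 + j / 25 == k / 25 + l / 25)

def Triple.edges (t : Triple) : List (ℕ × ℕ) := [(t.1, t.2.1), (t.1, t.2.2), (t.2.1, t.2.2)]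

/-- An edge of `s` and an edge of `t`, not contained in `s`, have the same midpoint. -/
def conflict (s t : Triple) : Bool :=
  s.edges.any fun e => t.edges.any fun f =>
    sameMidpoint e.1 e.2 f.1 f.2 && !(s.has f.1 && s.has f.2)

/-- The code of the weight `200 + 2x² + 2y² + z² - 2xz + 2yz`. -/
def baseWeight : ℕ := 10914218

/-- The triangulations induced by the weights cover all possibilities. -/
def checkPolytope (r : List ℕ × List ℕ) : Bool :=
  let A := facetsOf r
  let L := ptsOf A
  let C := unimodularTriples A
  isClosedSurface (inducedTriples A baseWeight) &&
  match r.2 with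
  | [] => C.all (isLower L baseWeight)
  | [c] =>
    isClosedSurface (inducedTriples A c) &&
    ((inducedTriples A baseWeight).any (fun t => !isLower L c t) &&
    (C.all (fun t => isLower L baseWeight t || isLower L c t) &&
    (inducedTriples A baseWeight).all fun s => isLower L c s ||
      (inducedTriples A c).all fun t => isLower L baseWeight t || conflict s t))
  | _ => false

theorem checkPolytope_all : polytopeData.all checkPolytope = true := by
  decide +kernel

theorem polytopeData_counts :
    polytopeData.length = 115 ∧ (polytopeData.filter fun r => r.2.length == 1).length = 29 ∧
      (polytopeData.filter fun r => r.2.length == 0).length = 86 := by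
  decide +kernel

/-- A set of points, given by its indices, satisfies a clause. -/
def Clause.Sat (X : ℕ → Prop) (c : Clause) : Prop :=
  (∃ i, c.1.testBit i = true ∧ X i) ∨ ∃ i, c.2.testBit i = true ∧ ¬ X i

theorem Clause.sat_trivial (X : ℕ → Prop) : Clause.Sat X (1, 1) := by
  by_cases h : X 0
  · exact Or.inl ⟨0, by decide, h⟩
  · exact Or.inr ⟨0, by decide, h⟩

theorem testBit_maskOf (l : List ℕ) (i : ℕ) : (maskOf l).testBit i = true ↔ i ∈ l := by
  induction l with
  | nil => simp [maskOf]
  | cons a l ih =>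
    have h : maskOf (a :: l) = 2 ^ a ||| maskOf l := rfl
    rw [h, Nat.testBit_or, Bool.or_eq_true, ih, Nat.testBit_two_pow, decide_eq_true_eq,
      List.mem_cons, eq_comm]

namespace ClauseTree

def All (p : Clause → Prop) : ClauseTree → Prop
  | leaf a b => p (a, b)
  | node l r => All p l ∧ All p r

theorem All.lookup {p : Clause → Prop} (hp : p (1, 1)) {t : ClauseTree} (ht : t.All p) (d i : ℕ) :
    p (t.lookup d i) := by
  induction d generalizing t i with
  | zero => cases t with
    | leaf a b => exact ht
    | node l r => exact hp
  | succ d ih => cases t with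
    | leaf a b => exact ht
    | node l r =>
      simp only [ClauseTree.lookup]
      cases Nat.ble (2 ^ d) i
      · exact ih ht.1 i
      · exact ih ht.2 _

theorem exists_build {α : Type} {p : Clause → Prop} (hp : p (1, 1)) (d : ℕ) (l : List Clause)
    (hl : ∀ c ∈ l, p c) (k : ClauseTree → List Clause → α) :
    ∃ t l', t.All p ∧ (∀ c ∈ l', p c) ∧ build d l k = k t l' := by
  induction d generalizing l k with
  | zero => cases l with
    | nil => exact ⟨leaf 1 1, [], hp, by simp, rfl⟩
    | cons c l =>
      refine ⟨leaf c.1 c.2, l, hl c (by simp), fun c' h => hl c' (by simp [h]), ?_⟩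
      simp [build, force_eq]
  | succ d ih =>
    obtain ⟨t₁, l₁, h₁, hl₁, e₁⟩ := ih l hl fun t₁ l₁ => build d l₁ fun t₂ l₂ => k (node t₁ t₂) l₂
    obtain ⟨t₂, l₂, h₂, hl₂, e₂⟩ := ih l₁ hl₁ fun t₂ l₂ => k (node t₁ t₂) l₂
    exact ⟨node t₁ t₂, l₂, ⟨h₁, h₂⟩, hl₂, by rw [build, e₁, e₂]⟩

end ClauseTree

theorem testBit_xor_and (p q i : ℕ) :
    (Nat.xor p (Nat.land p q)).testBit i = (p.testBit i && !q.testBit i) := by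
  change (p ^^^ (p &&& q)).testBit i = _
  rw [Nat.testBit_xor, Nat.testBit_and]
  cases p.testBit i <;> cases q.testBit i <;> rfl

theorem replay_sound {X : ℕ → Prop} {t : ClauseTree} (ht : t.All (Clause.Sat X)) (f s : ℕ)
    (rest : List ℕ) (T F : ℕ) (r : ℕ × List ℕ) (h : replay t f s rest T F = some r)
    (hT : ∀ i, T.testBit i = true → X i) (hF : ∀ i, F.testBit i = true → ¬ X i) : False := by
  induction f generalizing s rest T F r with
  | zero => simp [replay] at h
  | succ f ih =>
    have hbit : ∀ n i : ℕ, n = 2 ^ Nat.log2 n → n.testBit i = true → i = Nat.log2 n := by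
      intro n i hn hi
      rw [hn, Nat.testBit_two_pow, decide_eq_true_eq] at hi
      exact hi.symm
    simp only [replay, force_eq] at h
    generalize s % 8192 = e at h
    cases h0 : Nat.beq e 0 with
    | true =>
      rw [h0] at h
      cases rest with
      | nil => simp at h
      | cons c rest => exact ih _ _ _ _ _ h hT hF
    | false =>
      rw [h0] at h
      simp only [cond_false] at h
      cases h1 : Nat.ble 128 e with
      | true =>
        rw [h1] at h
        simp only [cond_true] at h
        have hc := ht.lookup (Clause.sat_trivial X) 13 (e - 128)
        generalize t.lookup 13 (e - 128) = c at h hc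
        obtain ⟨p, n⟩ := c
        simp only at h
        have hc' : (∃ i, (Nat.xor p (Nat.land p F)).testBit i = true ∧ X i) ∨
            ∃ i, (Nat.xor n (Nat.land n T)).testBit i = true ∧ ¬ X i := by
          rcases hc with ⟨i, hi, hX⟩ | ⟨i, hi, hX⟩
          · refine Or.inl ⟨i, ?_, hX⟩
            rw [testBit_xor_and, hi, Bool.eq_false_iff.2 fun h => hF i h hX]
            rfl
          · refine Or.inr ⟨i, ?_, hX⟩
            rw [testBit_xor_and, hi, Bool.eq_false_iff.2 fun h => hX (hT i h)]
            rfl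
        generalize Nat.xor p (Nat.land p F) = p' at h hc'
        generalize Nat.xor n (Nat.land n T) = n' at h hc'
        cases hn : Nat.beq n' 0 with
        | true =>
          rw [hn] at h
          have hn := Nat.eq_of_beq_eq_true hn
          subst hn
          have hc : ∃ i, p'.testBit i = true ∧ X i := by simpa using hc'
          obtain ⟨i, hi, hX⟩ := hc
          simp only [cond_true] at h
          cases hp : Nat.beq p' 0 with
          | true =>
            have hp := Nat.eq_of_beq_eq_true hp
            simp [hp] at hi
          | false =>
            rw [hp] at h
            simp only [cond_false] at h
            cases hq : Nat.beq p' (2 ^ Nat.log2 p') with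
            | false => rw [hq] at h; simp at h
            | true =>
              rw [hq] at h
              refine ih _ _ _ _ _ h (fun j hj => ?_) hF
              change (T ||| p').testBit j = true at hj
              rw [Nat.testBit_or, Bool.or_eq_true] at hj
              rcases hj with hj | hj
              · exact hT j hj
              · have hq := Nat.eq_of_beq_eq_true hq
                rwa [hbit p' j hq hj, ← hbit p' i hq hi]
        | false =>
          rw [hn] at h
          simp only [cond_false] at h
          cases hp : Nat.beq p' 0 with
          | false => rw [hp] at h; simp at h
          | true =>
            rw [hp] at h
            have hp := Nat.eq_of_beq_eq_true hp
            subst hp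
            have hc : ∃ i, n'.testBit i = true ∧ ¬ X i := by simpa using hc'
            obtain ⟨i, hi, hX⟩ := hc
            simp only [cond_true] at h
            cases hq : Nat.beq n' (2 ^ Nat.log2 n') with
            | false => rw [hq] at h; simp at h
            | true =>
              rw [hq] at h
              refine ih _ _ _ _ _ h hT (fun j hj => ?_)
              change (F ||| n').testBit j = true at hj
              rw [Nat.testBit_or, Bool.or_eq_true] at hj
              rcases hj with hj | hj
              · exact hF j hj
              · have hq := Nat.eq_of_beq_eq_true hq
                rwa [hbit n' j hq hj, ← hbit n' i hq hi]
      | false =>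
        rw [h1] at h
        simp only [cond_false] at h
        have hor : ∀ Y : ℕ → Prop, ∀ M : ℕ, (∀ i, M.testBit i = true → Y i) → Y (e - 1) →
            ∀ i, (Nat.lor M (2 ^ (e - 1))).testBit i = true → Y i := by
          intro Y M hM hY i hi
          change (M ||| 2 ^ (e - 1)).testBit i = true at hi
          rw [Nat.testBit_or, Bool.or_eq_true, Nat.testBit_two_pow, decide_eq_true_eq] at hi
          rcases hi with hi | hi
          · exact hM i hi
          · rwa [← hi]
        cases hr : replay t f (s / 8192) rest (Nat.lor T (2 ^ (e - 1))) F with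
        | none => rw [hr] at h; simp at h
        | some r' =>
          obtain ⟨s'', rest''⟩ := r'
          rw [hr] at h
          simp only at h
          by_cases hX : X (e - 1)
          · exact ih _ _ _ _ _ hr (hor X T hT hX) hF
          · exact ih _ _ _ _ _ h hT (hor (fun i => ¬ X i) F hF hX)

/-- No subset of the lattice points satisfies all clauses. -/
theorem exists_not_sat (X : ℕ → Prop) : ∃ c ∈ allClauses, ¬ Clause.Sat X c := by
  by_contra! hX
  obtain ⟨t, l, ht, -, e⟩ := ClauseTree.exists_build (Clause.sat_trivial X) 13 allClauses hX
    fun t _ => (replay t 40000 0 refutation 0 0).isSome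
  have h := refuted_eq
  rw [refuted, e, Option.isSome_iff_exists] at h
  obtain ⟨r, hr⟩ := h
  exact replay_sound ht _ _ _ _ _ r hr (by simp) (by simp)

open Topology in
theorem exists_pos_add_smul_mem {P : Set ℝ³} {x : ℝ³} (hx : P ∈ 𝓝 x) (v : ℝ³) :
    ∃ ε : ℝ, 0 < ε ∧ x + ε • v ∈ P := by
  have hc : Continuous fun ε : ℝ => x + ε • v := by fun_prop
  have h : ∀ᶠ ε in 𝓝 (0 : ℝ), x + ε • v ∈ P :=
    hc.continuousAt.eventually_mem (by simpa using hx)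
  obtain ⟨δ, hδ, h⟩ := Metric.eventually_nhds_iff.1 h
  refine ⟨δ / 2, by positivity, h ?_⟩
  rw [dist_zero_right, Real.norm_eq_abs, abs_of_pos (by positivity)]
  linarith

/-- A real vector with integer entries. -/
def Z3.vec (a : Z3) : ℝ³ := ![a.x, a.y, a.z]

/-- The affine form with value `0` at `(1,1,1)` and the given gradient. -/
def Z3.aff (a : Z3) : ℝ³ →ᵃ[ℝ] ℝ where
  toFun x := a.x * (x 0 - 1) + a.y * (x 1 - 1) + a.z * (x 2 - 1)
  linear :=
    { toFun := fun x => a.x * x 0 + a.y * x 1 + a.z * x 2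
      map_add' := fun x y => by simp only [Pi.add_apply]; ring
      map_smul' := fun r x => by simp only [Pi.smul_apply, smul_eq_mul, RingHom.id_apply]; ring }
  map_vadd' x v := by simp only [vadd_eq_add, Pi.add_apply, LinearMap.coe_mk, AddHom.coe_mk]; ring

theorem Z3.aff_apply (a : Z3) (x : ℝ³) :
    a.aff x = a.x * (x 0 - 1) + a.y * (x 1 - 1) + a.z * (x 2 - 1) := rfl

theorem Z3.aff_pOne (a : Z3) : a.aff pOne = 0 := by simp [Z3.aff_apply, pOne]

theorem Z3.aff_pOne_add (a v : Z3) : a.aff (pOne + v.vec) = (a.dot v : ℤ) := by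
  simp [Z3.aff_apply, pOne, Z3.vec, Z3.dot]

theorem Z3.aff_pOne_add_smul (a v : Z3) (ε : ℝ) :
    a.aff (pOne + ε • v.vec) = ε * (a.dot v : ℤ) := by
  simp [Z3.aff_apply, pOne, Z3.vec, Z3.dot]
  ring

/-- The lattice point with a given index. -/
def pt (i : ℕ) : ℝ³ := ![(i % 5 : ℕ), (i / 5 % 5 : ℕ), (i / 25 : ℕ)]

theorem pt_eq (i : ℕ) : pt i = pOne + (disp i).vec := by
  ext k
  have h : ∀ n : ℕ, (n : ℝ) = 1 + ((Int.sub n 1 : ℤ) : ℝ) := fun n => by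
    change (n : ℝ) = 1 + (((n : ℤ) - 1 : ℤ) : ℝ)
    push_cast
    ring
  fin_cases k
  exacts [h _, h _, h _]

theorem aff_pt (a : Z3) (i : ℕ) : a.aff (pt i) = (a.dot (disp i) : ℤ) := by
  rw [pt_eq, Z3.aff_pOne_add]

theorem pt_mem_latticePts (i : ℕ) : pt i ∈ latticePts := by
  intro k
  fin_cases k
  exacts [⟨(i % 5 : ℕ), rfl⟩, ⟨(i / 5 % 5 : ℕ), rfl⟩, ⟨(i / 25 : ℕ), rfl⟩]

theorem pOne_mem_latticePts : pOne ∈ latticePts := by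
  intro k
  fin_cases k <;> exact ⟨1, by simp [pOne]⟩

theorem intNeg_iff (a : ℤ) : intNeg a = true ↔ a < 0 := by
  cases a with
  | ofNat n => simp [intNeg]
  | negSucc n => simp [intNeg, Int.negSucc_lt_zero]

theorem mem_Delta4 {x : ℝ³} :
    x ∈ Delta4 ↔ 0 ≤ x 0 ∧ 0 ≤ x 1 ∧ 0 ≤ x 2 ∧ x 0 + x 1 + x 2 ≤ 4 := by
  constructor
  · intro h
    have hc : Convex ℝ {x : ℝ³ | 0 ≤ x 0 ∧ 0 ≤ x 1 ∧ 0 ≤ x 2 ∧ x 0 + x 1 + x 2 ≤ 4} := by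
      intro x hx y hy a b ha hb hab
      simp only [mem_ofPred_eq, Pi.add_apply, Pi.smul_apply, smul_eq_mul] at *
      obtain ⟨hx0, hx1, hx2, hx⟩ := hx
      obtain ⟨hy0, hy1, hy2, hy⟩ := hy
      refine ⟨by positivity, by positivity, by positivity, ?_⟩
      nlinarith [mul_le_mul_of_nonneg_left hx ha, mul_le_mul_of_nonneg_left hy hb]
    refine convexHull_min ?_ hc h
    intro y hy
    simp only [mem_insert_iff, mem_singleton_iff] at hy
    rcases hy with rfl | rfl | rfl | rfl <;> simp only [mem_ofPred_eq, Matrix.cons_val] <;> norm_num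
  · rintro ⟨h0, h1, h2, h⟩
    have hx : x = (1 - x 0 / 4 - x 1 / 4 - x 2 / 4) • (![0, 0, 0] : ℝ³) +
        ((x 0 / 4) • (![4, 0, 0] : ℝ³) + ((x 1 / 4) • (![0, 4, 0] : ℝ³) +
          (x 2 / 4) • (![0, 0, 4] : ℝ³))) := by
      ext k
      fin_cases k <;> simp
    have hmem : ∀ v ∈ ({![0, 0, 0], ![4, 0, 0], ![0, 4, 0], ![0, 0, 4]} : Set ℝ³), v ∈ Delta4 :=
      fun v hv => subset_convexHull ℝ _ hv
    have := (convex_convexHull ℝ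
      ({![0, 0, 0], ![4, 0, 0], ![0, 4, 0], ![0, 0, 4]} : Set ℝ³)).sum_mem
      (t := Finset.univ) (w := ![1 - x 0 / 4 - x 1 / 4 - x 2 / 4, x 0 / 4, x 1 / 4, x 2 / 4])
      (z := ![![0, 0, 0], ![4, 0, 0], ![0, 4, 0], ![0, 0, 4]])
      (by intro i _; fin_cases i <;> simp <;> linarith) (by simp [Fin.sum_univ_four]; ring)
      (by intro i _; fin_cases i <;> exact hmem _ (by simp))
    rw [hx]
    simpa [Fin.sum_univ_four, add_assoc, Delta4] using this

theorem index_mem_of_sum_le (a b c : ℕ) (h : a + b + c ≤ 4) :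
    a + 5 * b + 25 * c ∈ 31 :: ptIdx := by
  have H : ∀ a b c : Fin 5, (a + b + c : ℕ) ≤ 4 → (a + 5 * b + 25 * c : ℕ) ∈ 31 :: ptIdx := by
    decide +kernel
  exact H ⟨a, by omega⟩ ⟨b, by omega⟩ ⟨c, by omega⟩ h

theorem sum_le_of_mem_ptIdx : ∀ i ∈ ptIdx, i % 5 + i / 5 % 5 + i / 25 ≤ 4 := by
  decide

theorem pt_add (a b c : ℕ) (ha : a < 5) (hb : b < 5) :
    pt (a + 5 * b + 25 * c) = ![(a : ℝ), b, c] := by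
  have h0 : (a + 5 * b + 25 * c) % 5 = a := by omega
  have h1 : (a + 5 * b + 25 * c) / 5 % 5 = b := by omega
  have h2 : (a + 5 * b + 25 * c) / 25 = c := by omega
  rw [pt, h0, h1, h2]

theorem pt_31 : pt 31 = pOne := by
  ext k
  fin_cases k <;> simp [pt, pOne]

theorem pt_mem_Delta4 {i : ℕ} (hi : i ∈ ptIdx) : pt i ∈ Delta4 := by
  have h := sum_le_of_mem_ptIdx i hi
  rw [mem_Delta4]
  simp only [pt, Matrix.cons_val]
  refine ⟨by positivity, by positivity, by positivity, by exact_mod_cast h⟩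

theorem eq_pOne_or_pt {x : ℝ³} (hx : x ∈ Delta4) (hl : x ∈ latticePts) :
    x = pOne ∨ ∃ i ∈ ptIdx, x = pt i := by
  rw [mem_Delta4] at hx
  obtain ⟨n0, h0⟩ := hl 0
  obtain ⟨n1, h1⟩ := hl 1
  obtain ⟨n2, h2⟩ := hl 2
  rw [h0, h1, h2] at hx
  obtain ⟨k0, k1, k2, k3⟩ := hx
  have k0 : 0 ≤ n0 := by exact_mod_cast k0
  have k1 : 0 ≤ n1 := by exact_mod_cast k1
  have k2 : 0 ≤ n2 := by exact_mod_cast k2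
  have k3 : n0 + n1 + n2 ≤ 4 := by exact_mod_cast k3
  lift n0 to ℕ using k0
  lift n1 to ℕ using k1
  lift n2 to ℕ using k2
  have hm := index_mem_of_sum_le n0 n1 n2 (by omega)
  have hx : x = pt (n0 + 5 * n1 + 25 * n2) := by
    rw [pt_add _ _ _ (by omega) (by omega)]
    ext k
    fin_cases k <;> simp [h0, h1, h2]
  rcases List.mem_cons.1 hm with h | h
  · exact Or.inl (by rw [hx, h, pt_31])
  · exact Or.inr ⟨_, h, hx⟩

theorem IsSubpolytope.subset_of {P C : Set ℝ³} (hP : IsSubpolytope P) (hC : Convex ℝ C)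
    (h1 : pOne ∈ C) (h : ∀ i ∈ ptIdx, pt i ∈ P → pt i ∈ C) : P ⊆ C := by
  rw [hP.2]
  refine convexHull_min ?_ hC
  rintro x ⟨hx, hl⟩
  rcases eq_pOne_or_pt (hP.1 hx) hl with rfl | ⟨i, hi, rfl⟩
  · exact h1
  · exact h i hi hx

theorem IsSubpolytope.convex {P : Set ℝ³} (hP : IsSubpolytope P) : Convex ℝ P := by
  rw [hP.2]
  exact convex_convexHull ℝ _

theorem convex_le_aff (f : ℝ³ →ᵃ[ℝ] ℝ) (b : ℝ) : Convex ℝ {x | b ≤ f x} :=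
  (convex_Ici b).affine_preimage f

theorem Z3.dot_self_pos {c : Z3} (h : c.dot c ≠ 0) : 0 < c.dot c := by
  have : 0 ≤ c.dot c := by
    unfold Z3.dot
    nlinarith [mul_self_nonneg c.x, mul_self_nonneg c.y, mul_self_nonneg c.z]
  omega

theorem IsCanonicalSub.exists_dot_neg {P : Set ℝ³} (hP : IsCanonicalSub P) {c : Z3}
    (hc : c.dot c ≠ 0) : ∃ i ∈ ptIdx, pt i ∈ P ∧ c.dot (disp i) < 0 := by
  by_contra! h
  have hsub : P ⊆ {x | 0 ≤ c.aff x} := hP.1.subset_of (convex_le_aff _ _) (Z3.aff_pOne c).ge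
    fun i hi hiP => by
      have := h i hi hiP
      rw [mem_ofPred_eq, aff_pt]
      exact_mod_cast this
  obtain ⟨ε, hε, hmem⟩ := exists_pos_add_smul_mem (mem_interior_iff_mem_nhds.1 hP.2) (-c.vec)
  have h0 := hsub hmem
  rw [mem_ofPred_eq, smul_neg, ← neg_smul, Z3.aff_pOne_add_smul] at h0
  have : (0 : ℝ) < (c.dot c : ℤ) := by exact_mod_cast Z3.dot_self_pos hc
  nlinarith

theorem Z3.det_mul_eq (u v w t : Z3) :
    u.det v w * t.x = (u.interp v w (t.dot u) (t.dot v) (t.dot w)).x ∧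
    u.det v w * t.y = (u.interp v w (t.dot u) (t.dot v) (t.dot w)).y ∧
    u.det v w * t.z = (u.interp v w (t.dot u) (t.dot v) (t.dot w)).z := by
  refine ⟨?_, ?_, ?_⟩ <;> simp only [Z3.det, Z3.interp, Z3.dot, Z3.cross] <;> ring

theorem Z3.interp_dot (u v w : Z3) (a b c : ℤ) :
    (u.interp v w a b c).dot u = a * u.det v w ∧ (u.interp v w a b c).dot v = b * u.det v w ∧
      (u.interp v w a b c).dot w = c * u.det v w := by
  refine ⟨?_, ?_, ?_⟩ <;> simp only [Z3.det, Z3.interp, Z3.dot, Z3.cross] <;> ring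

theorem dotp_three (a x : ℝ³) : dotp a x = a 0 * x 0 + a 1 * x 1 + a 2 * x 2 := by
  simp [dotp, Fin.sum_univ_three]

theorem finrank_direction_eq_two {F : Set ℝ³} {i j k : ℕ} {s : Z3} {d : ℝ} (hs : s.dot s ≠ 0)
    (hdet : (disp i).det (disp j) (disp k) ≠ 0) (hi : pt i ∈ F) (hj : pt j ∈ F) (hk : pt k ∈ F)
    (hF : ∀ x ∈ F, s.aff x = d) : Module.finrank ℝ (affineSpan ℝ F).direction = 2 := by
  have hle : (affineSpan ℝ F).direction ≤ LinearMap.ker s.aff.linear := by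
    rw [direction_affineSpan, vectorSpan, Submodule.span_le]
    rintro _ ⟨x, hx, y, hy, rfl⟩
    rw [SetLike.mem_coe, LinearMap.mem_ker, AffineMap.linearMap_vsub, hF x hx, hF y hy, vsub_self]
  have hlt : Module.finrank ℝ (affineSpan ℝ F).direction < 3 := by
    have : (affineSpan ℝ F).direction ≠ ⊤ := by
      intro h
      have h1 : s.vec ∈ LinearMap.ker s.aff.linear := hle (h ▸ Submodule.mem_top)
      rw [LinearMap.mem_ker] at h1
      have h2 : s.aff.linear s.vec = (s.dot s : ℤ) := by
        simp [Z3.aff, Z3.vec, Z3.dot]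
      rw [h2] at h1
      exact hs (by exact_mod_cast h1)
    simpa using Submodule.finrank_lt this
  have hli : LinearIndependent ℝ ![pt i - pt k, pt j - pt k] := by
    rw [LinearIndependent.pair_iff]
    intro α β h
    have hx := congrFun h 0
    have hy := congrFun h 1
    have hz := congrFun h 2
    simp only [pt_eq, Z3.vec, Pi.add_apply, Pi.smul_apply, Pi.sub_apply, smul_eq_mul,
      Matrix.cons_val, Pi.zero_apply, add_sub_add_left_eq_sub] at hx hy hz
    have hD : ((disp i).det (disp j) (disp k) : ℝ) ≠ 0 := by exact_mod_cast hdet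
    have e1 : α * ((disp i).det (disp j) (disp k) : ℝ) = 0 := by
      simp only [Z3.det, Z3.dot, Z3.cross]
      push_cast
      linear_combination (((disp j).y : ℝ) * (disp k).z - (disp j).z * (disp k).y) * hx +
        (((disp j).z : ℝ) * (disp k).x - (disp j).x * (disp k).z) * hy +
        (((disp j).x : ℝ) * (disp k).y - (disp j).y * (disp k).x) * hz
    have e2 : β * ((disp i).det (disp j) (disp k) : ℝ) = 0 := by
      simp only [Z3.det, Z3.dot, Z3.cross]
      push_cast
      linear_combination (((disp k).y : ℝ) * (disp i).z - (disp k).z * (disp i).y) * hx +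
        (((disp k).z : ℝ) * (disp i).x - (disp k).x * (disp i).z) * hy +
        (((disp k).x : ℝ) * (disp i).y - (disp k).y * (disp i).x) * hz
    exact ⟨(mul_eq_zero.1 e1).resolve_right hD, (mul_eq_zero.1 e2).resolve_right hD⟩
  have hge : 2 ≤ Module.finrank ℝ (affineSpan ℝ F).direction := by
    have h1 : Submodule.span ℝ (Set.range ![pt i - pt k, pt j - pt k]) ≤
        (affineSpan ℝ F).direction := by
      rw [Submodule.span_le, direction_affineSpan]
      rintro _ ⟨m, rfl⟩
      fin_cases m
      · exact vsub_mem_vectorSpan ℝ hi hk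
      · exact vsub_mem_vectorSpan ℝ hj hk
    have h2 := Submodule.finrank_mono h1
    rwa [finrank_span_eq_card hli, Fintype.card_fin] at h2
  omega

theorem IsReflexive.exists_dot_lt {P : Set ℝ³} (hP : IsCanonicalSub P) (hR : IsReflexive P pOne)
    {i j k : ℕ} (hi : pt i ∈ P) (hj : pt j ∈ P) (hk : pt k ∈ P) {s : Z3} {d : ℤ} (hd : 0 < d)
    (hdet : (disp i).det (disp j) (disp k) ≠ 0) (si : s.dot (disp i) = -d)
    (sj : s.dot (disp j) = -d) (sk : s.dot (disp k) = -d)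
    (hdvd : ¬ (d ∣ s.x ∧ d ∣ s.y ∧ d ∣ s.z)) :
    ∃ l ∈ ptIdx, pt l ∈ P ∧ s.dot (disp l) < -d := by
  by_contra! h
  have hs : s.dot s ≠ 0 := by
    intro h0
    apply hdvd
    unfold Z3.dot at h0
    have hx : s.x = 0 := by
      nlinarith [mul_self_nonneg s.x, mul_self_nonneg s.y, mul_self_nonneg s.z]
    have hy : s.y = 0 := by
      nlinarith [mul_self_nonneg s.x, mul_self_nonneg s.y, mul_self_nonneg s.z]
    have hz : s.z = 0 := by
      nlinarith [mul_self_nonneg s.x, mul_self_nonneg s.y, mul_self_nonneg s.z]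
    simp [hx, hy, hz]
  have hd' : (0 : ℝ) < d := by exact_mod_cast hd
  have hsub : P ⊆ {x | (-d : ℝ) ≤ s.aff x} := hP.1.subset_of (convex_le_aff _ _)
    (by rw [mem_ofPred_eq, Z3.aff_pOne]; linarith)
    fun l hl hlP => by
      have := h l hl hlP
      rw [mem_ofPred_eq, aff_pt]
      exact_mod_cast this
  have hdot : ∀ x, dotp s.vec x = s.aff x + (s.x + s.y + s.z) := by
    intro x
    simp [dotp_three, Z3.vec, Z3.aff_apply]
    ring
  have mem : ∀ m, pt m ∈ P → s.dot (disp m) = -d →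
      pt m ∈ P ∩ {x | dotp s.vec x = -d + (s.x + s.y + s.z)} := by
    intro m hm e
    refine ⟨hm, ?_⟩
    rw [mem_ofPred_eq, hdot, aff_pt, e]
    push_cast
    ring
  have hfac : IsFacetOf (P ∩ {x | dotp s.vec x = -d + (s.x + s.y + s.z)}) P := by
    refine ⟨s.vec, _, fun x hx => ?_, rfl, ?_⟩
    · rw [hdot]
      have := hsub hx
      rw [mem_ofPred_eq] at this
      linarith
    · refine finrank_direction_eq_two (d := -d) hs hdet (mem i hi si) (mem j hj sj) (mem k hk sk) ?_
      rintro x ⟨-, hx⟩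
      rw [mem_ofPred_eq, hdot] at hx
      linarith
  obtain ⟨a, b, hF, -, hp⟩ := hR _ hfac
  let t : Z3 := ⟨a 0, a 1, a 2⟩
  have ht : ∀ m, pt m ∈ P → s.dot (disp m) = -d → t.dot (disp m) = -1 := by
    intro m hm e
    have h1 := hF _ (mem m hm e)
    have h2 : dotp (fun i => (a i : ℝ)) (pt m) =
        dotp (fun i => (a i : ℝ)) pOne + (t.dot (disp m) : ℤ) := by
      rw [pt_eq]
      simp [dotp_three, pOne, Z3.vec, Z3.dot, t]
      ring
    have h3 : ((t.dot (disp m) : ℤ) : ℝ) = (-1 : ℤ) := by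
      push_cast
      linarith
    exact_mod_cast h3
  have es := Z3.det_mul_eq (disp i) (disp j) (disp k) s
  have et := Z3.det_mul_eq (disp i) (disp j) (disp k) t
  rw [si, sj, sk] at es
  rw [ht i hi si, ht j hj sj, ht k hk sk] at et
  simp only [Z3.interp] at es et
  apply hdvd
  refine ⟨⟨t.x, mul_left_cancel₀ hdet ?_⟩, ⟨t.y, mul_left_cancel₀ hdet ?_⟩,
    ⟨t.z, mul_left_cancel₀ hdet ?_⟩⟩
  · linear_combination es.1 - d * et.1
  · linear_combination es.2.1 - d * et.2.1
  · linear_combination es.2.2 - d * et.2.2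

theorem halfspaceClause_sat {P : Set ℝ³} (hP : IsCanonicalSub P) (c : Z3) :
    Clause.Sat (fun i => pt i ∈ P) (halfspaceClause c) := by
  unfold halfspaceClause
  cases hc : c.dot c == 0 with
  | true => exact Clause.sat_trivial _
  | false =>
    obtain ⟨i, hi, hiP, h⟩ := hP.exists_dot_neg (c := c) (by simpa using hc)
    refine Or.inl ⟨i, ?_, hiP⟩
    simp only [cond_false, testBit_maskOf, List.mem_filter, intNeg_iff]
    exact ⟨hi, h⟩

theorem planeClauseAux_sat {P : Set ℝ³} (hP : IsCanonicalSub P) (hR : IsReflexive P pOne)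
    {i j k : ℕ} {s : Z3} {d : ℤ} (hdet : d ≠ 0 → (disp i).det (disp j) (disp k) ≠ 0)
    (si : s.dot (disp i) = -d) (sj : s.dot (disp j) = -d) (sk : s.dot (disp k) = -d) :
    Clause.Sat (fun i => pt i ∈ P) (planeClauseAux i j k s d) := by
  unfold planeClauseAux
  cases h : intNeg (-d) && !(s.x % d == 0 && s.y % d == 0 && s.z % d == 0) with
  | false => exact Clause.sat_trivial _
  | true =>
    simp only [Bool.and_eq_true, intNeg_iff, Bool.not_eq_true', ← Bool.not_eq_true,
      beq_iff_eq, ← Int.dvd_iff_emod_eq_zero] at h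
    by_cases hijk : pt i ∈ P ∧ pt j ∈ P ∧ pt k ∈ P
    · obtain ⟨hi, hj, hk⟩ := hijk
      obtain ⟨l, hl, hlP, hlt⟩ := hR.exists_dot_lt hP hi hj hk (by omega) (hdet (by omega)) si sj sk
        fun hd => h.2 ⟨⟨hd.1, hd.2.1⟩, hd.2.2⟩
      refine Or.inl ⟨l, ?_, hlP⟩
      simp only [cond_true, testBit_maskOf, List.mem_filter, intNeg_iff]
      exact ⟨hl, by omega⟩
    · refine Or.inr ?_
      simp only [cond_true, testBit_maskOf, List.mem_cons, List.not_mem_nil, or_false]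
      by_contra! hn
      exact hijk ⟨hn i (by simp), hn j (by simp), hn k (by simp)⟩

theorem planeClause_sat {P : Set ℝ³} (hP : IsCanonicalSub P) (hR : IsReflexive P pOne) (m : ℕ) :
    Clause.Sat (fun i => pt i ∈ P) (planeClause m) := by
  unfold planeClause
  simp only
  generalize m % 128 = i
  generalize m / 128 % 128 = j
  generalize m / 16384 = k
  cases intNeg ((disp i).det (disp j) (disp k))
  · obtain ⟨h1, h2, h3⟩ := Z3.interp_dot (disp i) (disp j) (disp k) (-1) (-1) (-1)
    exact planeClauseAux_sat hP hR id (by rw [h1]; ring) (by rw [h2]; ring) (by rw [h3]; ring)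
  · obtain ⟨h1, h2, h3⟩ := Z3.interp_dot (disp i) (disp j) (disp k) 1 1 1
    exact planeClauseAux_sat hP hR (by simp) (by rw [h1]; ring) (by rw [h2]; ring)
      (by rw [h3]; ring)

theorem convexClause_sat {P : Set ℝ³} (hP : Convex ℝ P) (m : ℕ) :
    Clause.Sat (fun i => pt i ∈ P) (convexClause m) := by
  unfold convexClause
  simp only
  generalize m % 128 = i
  generalize m / 128 % 128 = j
  generalize m / 16384 % 128 = k
  generalize m / 2097152 % 128 = l
  generalize m / 268435456 % 128 = a
  generalize m / 34359738368 % 128 = b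
  generalize m / 4398046511104 = c
  rw [Bool.cond_eq_ite]
  split
  on_goal 2 => exact Clause.sat_trivial _
  rename_i h
  simp only [Bool.and_eq_true, Bool.not_eq_true', ← Bool.not_eq_true, beq_iff_eq] at h
  obtain ⟨h0, ⟨hx, hy⟩, hz⟩ := h
  by_cases hijk : pt i ∈ P ∧ pt j ∈ P ∧ pt k ∈ P
  · obtain ⟨hi, hj, hk⟩ := hijk
    refine Or.inl ⟨l, by simp, ?_⟩
    have hS : (0 : ℝ) < a + b + c := by exact_mod_cast Nat.pos_of_ne_zero h0
    have := hP.sum_mem (t := Finset.univ)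
      (w := ![(a / (a + b + c) : ℝ), b / (a + b + c), c / (a + b + c)])
      (z := ![pt i, pt j, pt k])
      (by intro i _; fin_cases i <;> simp <;> positivity)
      (by simp [Fin.sum_univ_three]; field_simp)
      (by intro i _; fin_cases i <;> assumption)
    convert this using 1
    have hx' : ((a + b + c) * (l % 5 : ℕ) : ℝ) =
        a * (i % 5 : ℕ) + b * (j % 5 : ℕ) + c * (k % 5 : ℕ) :=
      by exact_mod_cast hx
    have hy' : ((a + b + c) * (l / 5 % 5 : ℕ) : ℝ) =
      a * (i / 5 % 5 : ℕ) + b * (j / 5 % 5 : ℕ) + c * (k / 5 % 5 : ℕ) := by exact_mod_cast hy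
    have hz' : ((a + b + c) * (l / 25 : ℕ) : ℝ) =
      a * (i / 25 : ℕ) + b * (j / 25 : ℕ) + c * (k / 25 : ℕ) := by exact_mod_cast hz
    ext q
    apply mul_left_cancel₀ hS.ne'
    simp only [Fin.sum_univ_three, Matrix.cons_val, Pi.add_apply, Pi.smul_apply, smul_eq_mul]
    field_simp
    fin_cases q
    · exact hx'
    · exact hy'
    · exact hz'
  · refine Or.inr ?_
    simp only [testBit_maskOf, List.mem_cons, List.not_mem_nil, or_false]
    by_contra! hn
    exact hijk ⟨hn i (by simp), hn j (by simp), hn k (by simp)⟩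

/-- Every reflexive canonical subpolytope contains the lattice points of an image of one of the
representatives. -/
theorem IsReflexive.exists_orbit_subset {P : Set ℝ³} (hR : IsReflexive P pOne)
    (hP : IsCanonicalSub P) : ∃ r ∈ polytopeData, ∃ s ∈ permCodes,
      ∀ i ∈ ptsOf (facetsOf r), pt (permIdx s i) ∈ P := by
  obtain ⟨c, hc, hsat⟩ := exists_not_sat fun i => pt i ∈ P
  simp only [allClauses, List.mem_append, List.mem_map, List.mem_flatMap] at hc
  rcases hc with ⟨m, -, rfl⟩ | ⟨m, -, rfl⟩ | ⟨m, -, rfl⟩ | ⟨r, hr, m, hm, rfl⟩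
  · exact absurd (halfspaceClause_sat hP _) hsat
  · exact absurd (planeClause_sat hP hR m) hsat
  · exact absurd (convexClause_sat hP.1.convex m) hsat
  · obtain ⟨s, hs, rfl⟩ := List.mem_map.1 hm
    refine ⟨r, hr, s, hs, fun i hi => ?_⟩
    by_contra hn
    exact hsat (Or.inr ⟨_, (testBit_maskOf _ _).2 (List.mem_map_of_mem hi), hn⟩)

/-- The barycentric coordinates of `4Δ₃`, times `4`. -/
def baryCoord (k : Fin 4) : ℝ³ →ᵃ[ℝ] ℝ where
  toFun x := ![x 0, x 1, x 2, 4 - x 0 - x 1 - x 2] k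
  linear :=
    { toFun := fun x => ![x 0, x 1, x 2, - x 0 - x 1 - x 2] k
      map_add' := fun x y => by (fin_cases k <;> simp); ring
      map_smul' := fun r x => by (fin_cases k <;> simp); ring }
  map_vadd' x v := by (fin_cases k <;> simp); ring

theorem baryCoord_apply (k : Fin 4) (x : ℝ³) :
    baryCoord k x = ![x 0, x 1, x 2, 4 - x 0 - x 1 - x 2] k := rfl

theorem baryCoord_castSucc (i : Fin 3) (x : ℝ³) : baryCoord i.castSucc x = x i := by
  fin_cases i <;> rfl

theorem sum_baryCoord (x : ℝ³) : ∑ k, baryCoord k x = 4 := by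
  simp [Fin.sum_univ_four, baryCoord_apply]

theorem ext_baryCoord {x y : ℝ³} (h : ∀ k, baryCoord k x = baryCoord k y) : x = y := by
  ext i
  rw [← baryCoord_castSucc i x, h, baryCoord_castSucc]

theorem mem_Delta4_iff_baryCoord {x : ℝ³} : x ∈ Delta4 ↔ ∀ k, 0 ≤ baryCoord k x := by
  simp only [mem_Delta4, Fin.forall_fin_succ, baryCoord_apply]
  simp [← sub_nonneg, sub_sub, add_assoc]

def barySymMap (σ : Equiv.Perm (Fin 4)) : ℝ³ →ᵃ[ℝ] ℝ³ :=
  AffineMap.pi fun i => baryCoord (σ i.castSucc)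

theorem baryCoord_barySymMap (σ : Equiv.Perm (Fin 4)) (x : ℝ³) (k : Fin 4) :
    baryCoord k (barySymMap σ x) = baryCoord (σ k) x := by
  have h : ∀ i : Fin 3, baryCoord i.castSucc (barySymMap σ x) = baryCoord (σ i.castSucc) x :=
    fun i => by rw [baryCoord_castSucc]; rfl
  have h1 := sum_baryCoord (barySymMap σ x)
  have h2 : ∑ k, baryCoord (σ k) x = 4 := by
    rw [Equiv.sum_comp σ fun k => baryCoord k x, sum_baryCoord]
  rw [Fin.sum_univ_castSucc] at h1 h2
  simp only [h] at h1
  induction k using Fin.lastCases with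
  | last => linarith
  | cast i => exact h i

theorem barySymMap_mul (σ τ : Equiv.Perm (Fin 4)) (x : ℝ³) :
    barySymMap σ (barySymMap τ x) = barySymMap (τ * σ) x :=
  ext_baryCoord fun k => by simp only [baryCoord_barySymMap, Equiv.Perm.mul_apply]

theorem barySymMap_one (x : ℝ³) : barySymMap 1 x = x :=
  ext_baryCoord fun k => by simp only [baryCoord_barySymMap, Equiv.Perm.one_apply]

theorem barySymMap_bijective (σ : Equiv.Perm (Fin 4)) : Function.Bijective (barySymMap σ) :=
  Function.bijective_iff_has_inverse.2 ⟨barySymMap σ⁻¹,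
    fun x => by rw [barySymMap_mul, mul_inv_cancel, barySymMap_one],
    fun x => by rw [barySymMap_mul, inv_mul_cancel, barySymMap_one]⟩

/-- The affine symmetry of `4Δ₃` given by a permutation of the barycentric coordinates. -/
def barySym (σ : Equiv.Perm (Fin 4)) : ℝ³ ≃ᵃ[ℝ] ℝ³ :=
  AffineEquiv.ofBijective (barySymMap_bijective σ)

theorem baryCoord_barySym (σ : Equiv.Perm (Fin 4)) (x : ℝ³) (k : Fin 4) :
    baryCoord k (barySym σ x) = baryCoord (σ k) x := baryCoord_barySymMap σ x k

theorem barySym_inv_apply (σ : Equiv.Perm (Fin 4)) (x : ℝ³) : barySym σ⁻¹ (barySym σ x) = x :=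
  ext_baryCoord fun k => by
    rw [baryCoord_barySym, baryCoord_barySym]
    exact congrArg (fun k => baryCoord k x) (σ.apply_symm_apply k)

theorem barySym_apply_inv (σ : Equiv.Perm (Fin 4)) (x : ℝ³) : barySym σ (barySym σ⁻¹ x) = x :=
  ext_baryCoord fun k => by
    rw [baryCoord_barySym, baryCoord_barySym]
    exact congrArg (fun k => baryCoord k x) (σ.symm_apply_apply k)

theorem mem_image_barySym {σ : Equiv.Perm (Fin 4)} {P : Set ℝ³} {x : ℝ³} :
    x ∈ barySym σ '' P ↔ barySym σ⁻¹ x ∈ P := by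
  constructor
  · rintro ⟨y, hy, rfl⟩
    rwa [barySym_inv_apply]
  · exact fun h => ⟨_, h, barySym_apply_inv σ x⟩

theorem barySym_mem_Delta4 (σ : Equiv.Perm (Fin 4)) {x : ℝ³} (hx : x ∈ Delta4) :
    barySym σ x ∈ Delta4 := by
  rw [mem_Delta4_iff_baryCoord] at *
  intro k
  rw [baryCoord_barySym]
  exact hx _

theorem image_barySym_Delta4 (σ : Equiv.Perm (Fin 4)) : barySym σ '' Delta4 = Delta4 := by
  ext x
  rw [mem_image_barySym]
  refine ⟨fun h => ?_, barySym_mem_Delta4 _⟩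
  rw [← barySym_apply_inv σ x]
  exact barySym_mem_Delta4 σ h

theorem mem_latticePts_iff_baryCoord {x : ℝ³} :
    x ∈ latticePts ↔ ∀ k, ∃ n : ℤ, baryCoord k x = n := by
  constructor
  · intro h k
    induction k using Fin.lastCases with
    | last =>
      obtain ⟨a, ha⟩ := h 0
      obtain ⟨b, hb⟩ := h 1
      obtain ⟨c, hc⟩ := h 2
      exact ⟨4 - a - b - c, by simp [baryCoord_apply, ha, hb, hc]⟩
    | cast i => rw [baryCoord_castSucc]; exact h i
  · intro h i
    rw [← baryCoord_castSucc i x]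
    exact h _

theorem barySym_mem_latticePts (σ : Equiv.Perm (Fin 4)) {x : ℝ³} (hx : x ∈ latticePts) :
    barySym σ x ∈ latticePts := by
  rw [mem_latticePts_iff_baryCoord] at *
  intro k
  rw [baryCoord_barySym]
  exact hx _

theorem image_barySym_latticePts (σ : Equiv.Perm (Fin 4)) :
    barySym σ '' latticePts = latticePts := by
  ext x
  rw [mem_image_barySym]
  refine ⟨fun h => ?_, barySym_mem_latticePts _⟩
  rw [← barySym_apply_inv σ x]
  exact barySym_mem_latticePts σ h

theorem barySym_pOne (σ : Equiv.Perm (Fin 4)) : barySym σ pOne = pOne := by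
  have h : ∀ k, baryCoord k pOne = 1 := by
    intro k
    fin_cases k <;> simp [baryCoord_apply, pOne]
    norm_num
  exact ext_baryCoord fun k => by rw [baryCoord_barySym, h, h]

theorem IsCanonicalSub.image_barySym {P : Set ℝ³} (hP : IsCanonicalSub P) (σ : Equiv.Perm (Fin 4)) :
    IsCanonicalSub (barySym σ '' P) := by
  obtain ⟨⟨h1, h2⟩, h3⟩ := hP
  refine ⟨⟨?_, ?_⟩, ?_⟩
  · rw [← image_barySym_Delta4 σ]
    exact image_mono h1
  · have h := congrArg (barySym σ '' ·) h2
    rw [h]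
    conv_rhs => rw [← h, ← image_barySym_latticePts σ, ← image_inter (barySym σ).injective]
    exact (barySym σ).toAffineMap.image_convexHull (P ∩ latticePts)
  · have h : (barySym σ).toContinuousAffineEquiv.toHomeomorph '' interior P = _ :=
      (barySym σ).toContinuousAffineEquiv.toHomeomorph.image_interior P
    have h' : barySym σ pOne ∈ interior (barySym σ '' P) := by
      change barySym σ pOne ∈ interior ((barySym σ).toContinuousAffineEquiv.toHomeomorph '' P)
      rw [← h]
      exact ⟨pOne, h3, rfl⟩
    rwa [barySym_pOne] at h'

/-- The vertices of `4Δ₃`. -/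
def baryVertex (k : Fin 4) : ℝ³ := fun i => if i.castSucc = k then 4 else 0

theorem baryCoord_baryVertex (k l : Fin 4) : baryCoord k (baryVertex l) =
    if k = l then 4 else 0 := by
  fin_cases k <;> fin_cases l <;> simp [baryCoord_apply, baryVertex]

theorem baryVertex_mem_Delta4 (k : Fin 4) : baryVertex k ∈ Delta4 := by
  rw [mem_Delta4_iff_baryCoord]
  intro l
  rw [baryCoord_baryVertex]
  positivity

theorem affineMap_eq_sum_baryCoord (f : ℝ³ →ᵃ[ℝ] ℝ) (x : ℝ³) :
    f x = ∑ k, baryCoord k x / 4 * f (baryVertex k) := by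
  have hf : ∀ y, f y = f.linear y + f 0 := fun y => by
    conv_lhs => rw [f.decomp]
    rfl
  have hx : x = (x 0 / 4) • baryVertex 0 + (x 1 / 4) • baryVertex 1 + (x 2 / 4) • baryVertex 2 +
      baryVertex 3 := by
    ext i
    fin_cases i <;> simp [baryVertex]
  have h3 : baryVertex 3 = 0 := by
    ext i
    fin_cases i <;> simp [baryVertex]
  have hl : f.linear x = x 0 / 4 * f.linear (baryVertex 0) + x 1 / 4 * f.linear (baryVertex 1) +
      x 2 / 4 * f.linear (baryVertex 2) := by
    conv_lhs => rw [hx, h3, add_zero, map_add, map_add, map_smul, map_smul, map_smul]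
    simp only [smul_eq_mul]
  rw [Fin.sum_univ_four, hf, hf (baryVertex 0), hf (baryVertex 1), hf (baryVertex 2), h3, hl]
  simp only [baryCoord_apply, Matrix.cons_val]
  ring

theorem eq_baryVertex_of_baryCoord_eq {x : ℝ³} (hx : x ∈ Delta4) {k : Fin 4}
    (h : baryCoord k x = 4) : x = baryVertex k := by
  rw [mem_Delta4_iff_baryCoord] at hx
  have hs := sum_baryCoord x
  refine ext_baryCoord fun l => ?_
  rw [baryCoord_baryVertex]
  split_ifs with hl
  · rw [hl, h]
  · rw [← Finset.add_sum_erase _ _ (Finset.mem_univ k), h] at hs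
    have h0 : ∑ j ∈ Finset.univ.erase k, baryCoord j x = 0 := by linarith
    exact (Finset.sum_eq_zero_iff_of_nonneg fun j _ => hx j).1 h0 l (by simp [hl])

/-- Every affine symmetry of `4Δ₃` permutes the barycentric coordinates. -/
theorem exists_eq_barySym (g : ℝ³ ≃ᵃ[ℝ] ℝ³) (hg : g '' Delta4 = Delta4) :
    ∃ σ, ∀ x, g x = barySym σ x := by
  have hg1 : ∀ x ∈ Delta4, g x ∈ Delta4 := fun x hx => hg ▸ mem_image_of_mem g hx
  have hg2 : ∀ x ∈ Delta4, g.symm x ∈ Delta4 := by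
    intro x hx
    rw [← hg] at hx
    obtain ⟨y, hy, rfl⟩ := hx
    rwa [g.symm_apply_apply]
  have hle : ∀ x ∈ Delta4, ∀ k, baryCoord k x ≤ 4 := by
    intro x hx k
    rw [← sum_baryCoord x]
    exact Finset.single_le_sum (f := fun k => baryCoord k x)
      (fun j _ => mem_Delta4_iff_baryCoord.1 hx j) (Finset.mem_univ k)
  have hv : ∀ k, ∃ j, g (baryVertex k) = baryVertex j := by
    intro k
    have hx := hg1 _ (baryVertex_mem_Delta4 k)
    obtain ⟨j, hj⟩ : ∃ j, 0 < baryCoord j (g (baryVertex k)) := by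
      by_contra! h
      have := Finset.sum_nonpos fun j (_ : j ∈ Finset.univ) => h j
      rw [sum_baryCoord] at this
      norm_num at this
    refine ⟨j, ?_⟩
    have hs := sum_baryCoord (g (baryVertex k))
    have hf := affineMap_eq_sum_baryCoord ((baryCoord k).comp g.symm.toAffineMap) (g (baryVertex k))
    simp only [AffineMap.comp_apply, AffineEquiv.coe_toAffineMap, g.symm_apply_apply,
      baryCoord_baryVertex, if_true] at hf
    have h4 : ∑ i, baryCoord i (g (baryVertex k)) / 4 *
        (4 - baryCoord k (g.symm (baryVertex i))) = 0 := by
      simp only [mul_sub, Finset.sum_sub_distrib, ← hf]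
      simp only [div_mul_cancel₀ _ (four_ne_zero : (4 : ℝ) ≠ 0)]
      linarith
    have h5 := (Finset.sum_eq_zero_iff_of_nonneg fun i _ => mul_nonneg
      (div_nonneg (mem_Delta4_iff_baryCoord.1 hx i) (by norm_num))
      (sub_nonneg.2 (hle _ (hg2 _ (baryVertex_mem_Delta4 i)) k))).1 h4 j (Finset.mem_univ j)
    have h6 : baryCoord k (g.symm (baryVertex j)) = 4 := by
      rcases mul_eq_zero.1 h5 with h | h <;> linarith
    rw [← eq_baryVertex_of_baryCoord_eq (hg2 _ (baryVertex_mem_Delta4 j)) h6, g.apply_symm_apply]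
  choose τ hτ using hv
  have hinj : Function.Injective τ := by
    intro a b hab
    have h : baryVertex a = baryVertex b := g.injective (by rw [hτ, hτ, hab])
    have := congrArg (baryCoord a) h
    rw [baryCoord_baryVertex, baryCoord_baryVertex] at this
    by_contra hne
    simp [hne] at this
  let T : Equiv.Perm (Fin 4) := Equiv.ofBijective τ (Finite.injective_iff_bijective.1 hinj)
  refine ⟨T⁻¹, fun x => ext_baryCoord fun k => ?_⟩
  rw [baryCoord_barySym, affineMap_eq_sum_baryCoord (baryCoord (T⁻¹ k)) x]
  have := affineMap_eq_sum_baryCoord ((baryCoord k).comp g.toAffineMap) x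
  simp only [AffineMap.comp_apply, AffineEquiv.coe_toAffineMap] at this
  rw [this]
  refine Finset.sum_congr rfl fun j _ => ?_
  rw [hτ, baryCoord_baryVertex, baryCoord_baryVertex]
  congr 2
  exact propext ⟨fun h => by rw [h]; exact T.symm_apply_apply j, fun h => by
    rw [← h]; exact (T.apply_symm_apply k).symm⟩

theorem exists_mem_permCodes : ∀ σ : Equiv.Perm (Fin 4),
    ((σ 0 : ℕ), (σ 1 : ℕ), (σ 2 : ℕ)) ∈ permCodes := by
  decide +kernel

theorem exists_perm_of_mem_permCodes : ∀ s ∈ permCodes, ∃ σ : Equiv.Perm (Fin 4),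
    s = ((σ 0 : ℕ), (σ 1 : ℕ), (σ 2 : ℕ)) := by
  decide +kernel

theorem baryCoord_pt {i : ℕ} (hi : i ∈ ptIdx) (k : Fin 4) : baryCoord k (pt i) = baryIdx i k := by
  have h := sum_le_of_mem_ptIdx i hi
  fin_cases k
  · rfl
  · rfl
  · rfl
  · simp only [baryCoord_apply, pt, baryIdx, Matrix.cons_val, Fin.reduceFinMk, Nat.cast_sub h]
    push_cast
    ring

theorem baryIdx_lt {i : ℕ} (hi : i ∈ ptIdx) (k : ℕ) : baryIdx i k < 5 := by
  have h := sum_le_of_mem_ptIdx i hi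
  unfold baryIdx
  split <;> omega

theorem barySym_pt (σ : Equiv.Perm (Fin 4)) {i : ℕ} (hi : i ∈ ptIdx) :
    barySym σ (pt i) = pt (permIdx ((σ 0 : ℕ), (σ 1 : ℕ), (σ 2 : ℕ)) i) := by
  rw [permIdx, pt_add _ _ _ (baryIdx_lt hi _) (baryIdx_lt hi _)]
  have h : ∀ k : Fin 3, barySym σ (pt i) k = baryIdx i (σ k.castSucc) := fun k => by
    rw [← baryCoord_castSucc k (barySym σ (pt i)), baryCoord_barySym, baryCoord_pt hi]
  ext k
  rw [h]
  fin_cases k <;> rfl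

/-- The polytope given by the inequalities `-1 ≤ a` for affine forms vanishing at `(1,1,1)`. -/
def polyOf (A : List Z3) : Set ℝ³ := {x | ∀ a ∈ A, -1 ≤ a.aff x}

theorem convex_forall_le (S : Set (ℝ³ →ᵃ[ℝ] ℝ)) (b : ℝ) : Convex ℝ {x | ∀ f ∈ S, b ≤ f x} := by
  have h : {x | ∀ f ∈ S, b ≤ f x} = ⋂ f ∈ S, {x | b ≤ f x} := by ext; simp
  rw [h]
  exact convex_iInter₂ fun f _ => convex_le_aff f b

open Topology in
theorem setOf_forall_le_mem_nhds {S : Set (ℝ³ →ᵃ[ℝ] ℝ)} (hS : S.Finite) {b : ℝ} {y : ℝ³}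
    (hy : ∀ f ∈ S, b < f y) : {x | ∀ f ∈ S, b ≤ f x} ∈ 𝓝 y := by
  have h : ∀ᶠ x in 𝓝 y, ∀ f ∈ S, b < f x := by
    rw [Filter.eventually_all_finite hS]
    exact fun f hf => f.continuous_of_finiteDimensional.continuousAt.eventually_const_lt (hy f hf)
  filter_upwards [h] with x hx f hf using (hx f hf).le

/-- An affine form with integer gradient, vanishing at `(1,1,1)`. -/
def IsIntForm (f : ℝ³ →ᵃ[ℝ] ℝ) : Prop :=
  ∃ a : Fin 3 → ℤ, ∀ x, f x = dotp (fun i => (a i : ℝ)) x - dotp (fun i => (a i : ℝ)) pOne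

theorem Z3.isIntForm_aff (a : Z3) : IsIntForm a.aff := by
  refine ⟨![a.x, a.y, a.z], fun x => ?_⟩
  simp [dotp_three, pOne, Z3.aff_apply]
  ring

theorem isIntForm_baryCoord (k : Fin 4) : ∃ b : Fin 3 → ℤ, ∀ x, baryCoord k x =
    dotp (fun i => (b i : ℝ)) x - dotp (fun i => (b i : ℝ)) pOne + 1 := by
  fin_cases k
  · exact ⟨![1, 0, 0], fun x => by simp [dotp_three, pOne, baryCoord_apply]⟩
  · exact ⟨![0, 1, 0], fun x => by simp [dotp_three, pOne, baryCoord_apply]⟩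
  · exact ⟨![0, 0, 1], fun x => by simp [dotp_three, pOne, baryCoord_apply]⟩
  · exact ⟨![-1, -1, -1], fun x => by simp [dotp_three, pOne, baryCoord_apply]; ring⟩

theorem IsIntForm.comp_barySym {f : ℝ³ →ᵃ[ℝ] ℝ} (hf : IsIntForm f) (σ : Equiv.Perm (Fin 4)) :
    IsIntForm (f.comp (barySym σ).toAffineMap) := by
  obtain ⟨a, ha⟩ := hf
  choose b hb using isIntForm_baryCoord
  refine ⟨fun j => ∑ i, a i * b (σ i.castSucc) j, fun x => ?_⟩
  have h : ∀ y, dotp (fun j => ((∑ i, a i * b (σ i.castSucc) j : ℤ) : ℝ)) y =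
      ∑ i, a i * dotp (fun j => (b (σ i.castSucc) j : ℝ)) y := by
    intro y
    simp only [dotp, Int.cast_sum, Int.cast_mul, Finset.sum_mul, Finset.mul_sum]
    rw [Finset.sum_comm]
    simp only [mul_assoc]
  have h' : ∀ y i, barySym σ y i = dotp (fun j => (b (σ i.castSucc) j : ℝ)) y -
      dotp (fun j => (b (σ i.castSucc) j : ℝ)) pOne + 1 := by
    intro y i
    rw [← baryCoord_castSucc i (barySym σ y), baryCoord_barySym, hb]
  rw [h, h]
  simp only [AffineMap.comp_apply, AffineEquiv.coe_toAffineMap, ha]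
  simp only [dotp_three, Fin.sum_univ_three, h' x]
  simp only [pOne, Matrix.cons_val]
  ring

theorem isReflexive_of_forms {P : Set ℝ³} (hp : pOne ∈ interior P) {S : Set (ℝ³ →ᵃ[ℝ] ℝ)}
    (hfin : S.Finite) (hZ : ∀ f ∈ S, IsIntForm f) (hP : P = {x | ∀ f ∈ S, -1 ≤ f x}) :
    IsReflexive P pOne := by
  have hPc : Convex ℝ P := hP ▸ convex_forall_le S (-1)
  have hPle : ∀ x ∈ P, ∀ f ∈ S, -1 ≤ f x := fun x hx => by rwa [hP] at hx
  rintro F ⟨c, b, hb, hF, hdim⟩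
  by_cases h : ∃ f ∈ S, ∀ x ∈ F, f x = -1
  · obtain ⟨f, hf, hfF⟩ := h
    obtain ⟨a, ha⟩ := hZ f hf
    have hpi : dotp (fun i => (a i : ℝ)) pOne = ((a 0 + a 1 + a 2 : ℤ) : ℝ) := by
      simp [dotp_three, pOne]
    refine ⟨a, a 0 + a 1 + a 2 - 1, fun x hx => ?_, fun x hx => ?_, ?_⟩
    · have := hfF x hx
      rw [ha, hpi] at this
      push_cast at this ⊢
      linarith
    · have := hPle x hx f hf
      rw [ha, hpi] at this
      push_cast at this ⊢
      linarith
    · rw [hpi]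
      push_cast
      ring
  · exfalso
    push Not at h
    have hne : F.Nonempty := by
      rw [nonempty_iff_ne_empty]
      rintro rfl
      rw [AffineSubspace.span_empty, AffineSubspace.direction_bot, finrank_bot] at hdim
      omega
    have hFP : F ⊆ P := hF ▸ inter_subset_left
    have hFc : Convex ℝ F := by
      rw [hF]
      refine hPc.inter ?_
      intro x hx y hy s t hs ht hst
      simp only [mem_ofPred_eq, dotp_three, Pi.add_apply, Pi.smul_apply, smul_eq_mul] at hx hy ⊢
      linear_combination s * hx + t * hy + b * hst
    have hex : ∀ S' ⊆ S, ∃ y ∈ F, ∀ f ∈ S', -1 < f y := by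
      intro S' hS'
      induction S', hfin.subset hS' using Set.Finite.induction_on with
      | empty => exact ⟨_, hne.some_mem, by simp⟩
      | @insert f S' _ _ ih =>
        obtain ⟨y, hy, hyS⟩ := ih ((subset_insert _ _).trans hS')
        obtain ⟨z, hz, hfz⟩ := h f (hS' (mem_insert _ _))
        have hfz : -1 < f z := lt_of_le_of_ne (hPle z (hFP hz) f (hS' (mem_insert _ _))) hfz.symm
        have hm : ∀ g : ℝ³ →ᵃ[ℝ] ℝ, g (midpoint ℝ y z) = (g y + g z) / 2 := fun g => by
          rw [g.map_midpoint, midpoint_eq_smul_add, smul_eq_mul, invOf_eq_inv]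
          ring
        refine ⟨midpoint ℝ y z, hFc.midpoint_mem hy hz, ?_⟩
        rintro g (rfl | hg)
        · rw [hm]
          linarith [hPle y (hFP hy) g (hS' (mem_insert _ _))]
        · rw [hm]
          linarith [hyS g hg, hPle z (hFP hz) g (hS' (mem_insert_of_mem _ hg))]
    obtain ⟨y, hy, hyS⟩ := hex S subset_rfl
    have hnhds : P ∈ nhds y := by
      rw [hP]
      exact setOf_forall_le_mem_nhds hfin hyS
    obtain ⟨ε, hε, hmem⟩ := exists_pos_add_smul_mem hnhds (-c)
    have h1 := hb _ hmem
    have h2 : dotp c y = b := by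
      rw [hF] at hy
      exact hy.2
    have h3 : c 0 * c 0 + c 1 * c 1 + c 2 * c 2 ≤ 0 := by
      have : dotp c (y + ε • -c) = dotp c y - ε * (c 0 * c 0 + c 1 * c 1 + c 2 * c 2) := by
        simp [dotp_three]
        ring
      rw [this, h2] at h1
      by_contra! h
      nlinarith [mul_pos hε h]
    have hc : c = 0 := by
      ext i
      fin_cases i <;> simp only [Fin.zero_eta, Fin.mk_one, Fin.reduceFinMk, Pi.zero_apply] <;>
        nlinarith [mul_self_nonneg (c 0), mul_self_nonneg (c 1), mul_self_nonneg (c 2)]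
    have hb0 : b = 0 := by rw [← h2, hc]; simp [dotp_three]
    have hFP' : F = P := by
      rw [hF, hc, hb0]
      ext x
      simp [dotp_three]
    have htop : affineSpan ℝ F = ⊤ := by
      rw [hFP']
      exact hPc.interior_nonempty_iff_affineSpan_eq_top.1 ⟨_, hp⟩
    rw [htop, AffineSubspace.direction_top, finrank_top] at hdim
    simp at hdim

theorem polyOf_eq (A : List Z3) : polyOf A = {x | ∀ f ∈ Z3.aff '' {a | a ∈ A}, -1 ≤ f x} := by
  ext x
  simp [polyOf]

theorem finite_forms (A : List Z3) : (Z3.aff '' {a | a ∈ A}).Finite :=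
  (List.finite_toSet A).image _

theorem convex_polyOf (A : List Z3) : Convex ℝ (polyOf A) := by
  rw [polyOf_eq]
  exact convex_forall_le _ _

theorem polyOf_mem_nhds {A : List Z3} {y : ℝ³} (hy : ∀ a ∈ A, -1 < a.aff y) :
    polyOf A ∈ nhds y := by
  rw [polyOf_eq]
  refine setOf_forall_le_mem_nhds (finite_forms A) ?_
  rintro _ ⟨a, ha, rfl⟩
  exact hy a ha

theorem pOne_mem_interior_polyOf (A : List Z3) : pOne ∈ interior (polyOf A) := by
  rw [mem_interior_iff_mem_nhds]
  refine polyOf_mem_nhds fun a _ => ?_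
  rw [Z3.aff_pOne]
  norm_num

theorem pOne_mem_polyOf (A : List Z3) : pOne ∈ polyOf A :=
  interior_subset (pOne_mem_interior_polyOf A)

theorem isReflexive_image_polyOf (A : List Z3) (σ : Equiv.Perm (Fin 4)) :
    IsReflexive (barySym σ '' polyOf A) pOne := by
  have hP : barySym σ '' polyOf A =
      {x | ∀ f ∈ (fun a : Z3 => a.aff.comp (barySym σ⁻¹).toAffineMap) ''
      {a | a ∈ A}, -1 ≤ f x} := by
    ext x
    rw [mem_image_barySym]
    simp [polyOf]
  have hfin := (List.finite_toSet A).image fun a : Z3 => a.aff.comp (barySym σ⁻¹).toAffineMap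
  refine isReflexive_of_forms ?_ hfin ?_ hP
  · rw [hP, mem_interior_iff_mem_nhds]
    refine setOf_forall_le_mem_nhds hfin ?_
    rintro _ ⟨a, -, rfl⟩
    simp [barySym_pOne, Z3.aff_pOne]
  · rintro _ ⟨a, -, rfl⟩
    exact a.isIntForm_aff.comp_barySym _

theorem isReflexive_polyOf (A : List Z3) : IsReflexive (polyOf A) pOne := by
  refine isReflexive_of_forms (pOne_mem_interior_polyOf A) (finite_forms A) ?_ (polyOf_eq A)
  rintro _ ⟨a, -, rfl⟩
  exact a.isIntForm_aff

theorem pt_mem_polyOf {A : List Z3} {i : ℕ} (hi : i ∈ ptIdx) :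
    pt i ∈ polyOf A ↔ i ∈ ptsOf A := by
  simp only [polyOf, ptsOf, mem_ofPred_eq, List.mem_filter, hi, true_and, List.all_eq_true,
    Bool.not_eq_true', ← Bool.not_eq_true, intNeg_iff, aff_pt]
  refine forall₂_congr fun a _ => ?_
  rw [not_lt, ← neg_le_iff_add_nonneg]
  exact_mod_cast Iff.rfl

theorem mem_ptIdx_of_mem_ptsOf {A : List Z3} {i : ℕ} (hi : i ∈ ptsOf A) : i ∈ ptIdx :=
  (List.mem_filter.1 hi).1

theorem volume_solidSimplex (n : ℕ) {r : ℝ} (hr : 0 ≤ r) :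
    volume {x : Fin n → ℝ | (∀ i, 0 ≤ x i) ∧ ∑ i, x i ≤ r} =
      ENNReal.ofReal (r ^ n / n.factorial) := by
  induction n generalizing r with
  | zero => 
    have : {x : Fin 0 → ℝ | (∀ i, 0 ≤ x i) ∧ ∑ i, x i ≤ r} = univ := by
      ext x
      simp [hr]
    rw [this, ← pi_univ, volume_pi_pi]
    simp
  | succ n ih =>
    have hms : ∀ (m : ℕ) (s : ℝ),
        MeasurableSet {x : Fin m → ℝ | (∀ i, 0 ≤ x i) ∧ ∑ i, x i ≤ s} := by
      intro m s
      refine IsClosed.measurableSet ?_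
      rw [ofPred_and]
      refine IsClosed.inter ?_ (isClosed_le (by fun_prop) continuous_const)
      rw [ofPred_forall]
      exact isClosed_iInter fun i => isClosed_le continuous_const (by fun_prop)
    have hpre := (volume_preserving_piFinSuccAbove (fun _ : Fin (n + 1) => ℝ) 0).symm
    rw [← hpre.measure_preimage (hms _ _).nullMeasurableSet, Measure.volume_eq_prod,
      Measure.prod_apply (hpre.measurable (hms _ _))]
    have hsl : ∀ y : ℝ, volume (Prod.mk y ⁻¹' ((MeasurableEquiv.piFinSuccAbove
        (fun _ : Fin (n + 1) => ℝ) 0).symm ⁻¹' {x | (∀ i, 0 ≤ x i) ∧ ∑ i, x i ≤ r})) =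
        (Icc 0 r).indicator (fun y => ENNReal.ofReal ((r - y) ^ n / n.factorial)) y := by
      intro y
      by_cases hy : y ∈ Icc 0 r
      · rw [indicator_of_mem hy, ← ih (sub_nonneg.2 hy.2)]
        congr 1
        ext x
        simp [Fin.forall_fin_succ, Fin.sum_univ_succ, hy.1, le_sub_iff_add_le',
          MeasurableEquiv.piFinSuccAbove]
      · rw [indicator_of_notMem hy]
        convert measure_empty (μ := (volume : Measure (Fin n → ℝ)))
        ext x
        simp only [MeasurableEquiv.piFinSuccAbove, mem_preimage, mem_ofPred_eq, mem_empty_iff_false,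
          iff_false]
        simp [Fin.forall_fin_succ, Fin.sum_univ_succ]
        intro h0 h1
        by_contra! h
        exact hy ⟨h0, by linarith [Finset.sum_nonneg fun i (_ : i ∈ Finset.univ) => h1 i]⟩
    simp_rw [hsl]
    rw [lintegral_indicator measurableSet_Icc, ← ofReal_integral_eq_lintegral_ofReal]
    · congr 1
      rw [integral_Icc_eq_integral_Ioc, ← intervalIntegral.integral_of_le hr,
        intervalIntegral.integral_comp_sub_left (fun y => y ^ n / n.factorial)]
      simp [integral_pow, Nat.factorial_succ]
      field_simp
    · exact (Continuous.integrableOn_Icc (by fun_prop))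
    · refine (ae_restrict_iff' measurableSet_Icc).2 (ae_of_all _ fun y hy => ?_)
      have := sub_nonneg.2 hy.2
      simp only [Pi.zero_apply]
      positivity

theorem mem_convexHull_four {a b c d x : ℝ³} : x ∈ convexHull ℝ {a, b, c, d} ↔
    ∃ r s t : ℝ, 0 ≤ r ∧ 0 ≤ s ∧ 0 ≤ t ∧ r + s + t ≤ 1 ∧
      x = a + r • (b - a) + s • (c - a) + t • (d - a) := by
  constructor
  · intro h
    have hc : Convex ℝ {x : ℝ³ | ∃ r s t : ℝ, 0 ≤ r ∧ 0 ≤ s ∧ 0 ≤ t ∧ r + s + t ≤ 1 ∧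
        x = a + r • (b - a) + s • (c - a) + t • (d - a)} := by
      rintro _ ⟨r, s, t, hr, hs, ht, h, rfl⟩ _ ⟨r', s', t', hr', hs', ht', h', rfl⟩ k l hk hl hkl
      refine ⟨k * r + l * r', k * s + l * s', k * t + l * t', by positivity, by positivity,
        by positivity, ?_, ?_⟩
      · nlinarith [mul_le_mul_of_nonneg_left h hk, mul_le_mul_of_nonneg_left h' hl]
      · obtain rfl : l = 1 - k := by linarith
        module
    refine convexHull_min ?_ hc h
    rintro y (rfl | rfl | rfl | rfl)
    · exact ⟨0, 0, 0, by simp⟩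
    · exact ⟨1, 0, 0, by simp⟩
    · exact ⟨0, 1, 0, by simp⟩
    · exact ⟨0, 0, 1, by simp⟩
  · rintro ⟨r, s, t, hr, hs, ht, h, rfl⟩
    have hmem : ∀ v ∈ ({a, b, c, d} : Set ℝ³), v ∈ convexHull ℝ {a, b, c, d} :=
      fun v hv => subset_convexHull ℝ _ hv
    have := (convex_convexHull ℝ ({a, b, c, d} : Set ℝ³)).sum_mem
      (t := Finset.univ) (w := ![1 - r - s - t, r, s, t]) (z := ![a, b, c, d])
      (by intro i _; fin_cases i <;> simp <;> linarith) (by simp [Fin.sum_univ_four]; ring)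
      (by intro i _; fin_cases i <;> exact hmem _ (by simp))
    convert this using 1
    simp only [Fin.sum_univ_four, Matrix.cons_val]
    module

/-- The signed volume of the parallelepiped spanned by three vectors. -/
def det3 (u v w : ℝ³) : ℝ := Matrix.det !![u 0, v 0, w 0; u 1, v 1, w 1; u 2, v 2, w 2]

theorem volume_convexHull_four (a b c d : ℝ³) : volume (convexHull ℝ {a, b, c, d}) =
    ENNReal.ofReal (|det3 (b - a) (c - a) (d - a)| / 6) := by
  set M := !![(b - a) 0, (c - a) 0, (d - a) 0; (b - a) 1, (c - a) 1, (d - a) 1;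
    (b - a) 2, (c - a) 2, (d - a) 2] with hM
  have hMx : ∀ x, Matrix.toLin' M x = x 0 • (b - a) + x 1 • (c - a) + x 2 • (d - a) := by
    intro x
    ext i
    fin_cases i <;> simp [hM, Matrix.mulVec, dotProduct, Fin.sum_univ_three] <;> ring
  have h : convexHull ℝ {a, b, c, d} = (fun x => a + x) '' (Matrix.toLin' M ''
      {x : ℝ³ | (∀ i, 0 ≤ x i) ∧ ∑ i, x i ≤ 1}) := by
    ext x
    rw [mem_convexHull_four]
    simp only [mem_image, exists_exists_and_eq_and, mem_ofPred_eq, hMx]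
    constructor
    · rintro ⟨r, s, t, hr, hs, ht, h, rfl⟩
      refine ⟨![r, s, t], ⟨?_, by simpa [Fin.sum_univ_three] using h⟩, by simp [add_assoc]⟩
      intro i
      fin_cases i <;> simpa
    · rintro ⟨y, ⟨h0, h1⟩, rfl⟩
      exact ⟨y 0, y 1, y 2, h0 0, h0 1, h0 2, by simpa [Fin.sum_univ_three] using h1,
        by simp [add_assoc]⟩
  rw [h, image_add_left, measure_preimage_add, Measure.addHaar_image_linearMap,
    volume_solidSimplex 3 zero_le_one, LinearMap.det_toLin', ← ENNReal.ofReal_mul (abs_nonneg _)]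
  simp [det3, hM, Nat.factorial, div_eq_mul_inv]

theorem affineIndependent_of_volume_ne_zero {S : Finset ℝ³} (hS : S.card = 4)
    (h : volume (convexHull ℝ (S : Set ℝ³)) ≠ 0) :
    AffineIndependent ℝ (fun v : (S : Set ℝ³) => (v : ℝ³)) := by
  have htop : affineSpan ℝ (S : Set ℝ³) = ⊤ := by
    by_contra hne
    exact h (measure_mono_null (convexHull_subset_affineSpan _)
      (Measure.addHaar_affineSubspace _ _ hne))
  rw [affineIndependent_iff_finrank_vectorSpan_eq ℝ _ (n := 3) (by simpa using hS)]
  rw [Subtype.range_coe_subtype, ofPred_mem_eq, ← direction_affineSpan, htop,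
    AffineSubspace.direction_top, finrank_top]
  simp

theorem volume_convexHull_eq_zero {S : Finset ℝ³} (hS : S.card < 4) :
    volume (convexHull ℝ (S : Set ℝ³)) = 0 := by
  refine measure_mono_null (convexHull_subset_affineSpan _) (Measure.addHaar_affineSubspace _ _ ?_)
  intro htop
  rcases S.eq_empty_or_nonempty with rfl | hne
  · simp at htop
  have h := finrank_vectorSpan_image_finset_le ℝ (fun x : ℝ³ => x) S (n := S.card - 1)
    (by have := hne.card_pos; omega)
  rw [Finset.image_id', ← direction_affineSpan, htop,
    AffineSubspace.direction_top, finrank_top] at h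
  simp at h
  omega

/-- A lattice point of a unimodular simplex is a vertex. -/
theorem mem_of_mem_convexHull_of_volume {S : Finset ℝ³} (hS : S.card = 4)
    (hl : (S : Set ℝ³) ⊆ latticePts)
    (hv : volume (convexHull ℝ (S : Set ℝ³)) = ENNReal.ofReal (1 / 6))
    {p : ℝ³} (hp : p ∈ latticePts) (hpS : p ∈ convexHull ℝ (S : Set ℝ³)) : p ∈ S := by
  obtain ⟨a, T, -, rfl, hT⟩ := Finset.card_eq_succ.1 hS
  obtain ⟨b, c, d, -, -, -, rfl⟩ := Finset.card_eq_three.1 hT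
  simp only [Finset.coe_insert, Finset.coe_singleton] at hl hv hpS
  rw [volume_convexHull_four, ENNReal.ofReal_eq_ofReal_iff (by positivity) (by norm_num),
    div_left_inj' (by norm_num)] at hv
  rw [mem_convexHull_four] at hpS
  obtain ⟨r, s, t, hr, hs, ht, hrst, hpe⟩ := hpS
  have hZ : ∀ x ∈ latticePts, ∀ y ∈ latticePts, ∃ n : Fin 3 → ℤ, ∀ i, x i - y i = n i := by
    intro x hx y hy
    choose n hn using hx
    choose m hm using hy
    exact ⟨n - m, fun i => by simp [hn, hm]⟩
  have hal := hl (by simp : a ∈ _)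
  obtain ⟨u, hu⟩ := hZ b (hl (by simp)) a hal
  obtain ⟨v, hv'⟩ := hZ c (hl (by simp)) a hal
  obtain ⟨w, hw⟩ := hZ d (hl (by simp)) a hal
  obtain ⟨q, hq⟩ := hZ p hp a hal
  set D := det3 (b - a) (c - a) (d - a) with hD
  have hq' : ∀ i, (q i : ℝ) = r * u i + s * v i + t * w i := fun i => by
    rw [← hq, ← hu, ← hv', ← hw, hpe]
    simp
    ring
  have hunit : ∀ (z : ℝ) (n : ℤ), 0 ≤ z → z ≤ 1 → z * D = n → z = 0 ∨ z = 1 := by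
    intro z n h0 h1 hz
    have : ∃ m : ℤ, z = m := by
      rcases abs_eq (zero_le_one' ℝ) |>.1 hv with h | h
      · exact ⟨n, by rw [← hz, h, mul_one]⟩
      · exact ⟨-n, by push_cast; rw [← hz, h]; ring⟩
    obtain ⟨m, rfl⟩ := this
    have h0 : 0 ≤ m := by exact_mod_cast h0
    have h1 : m ≤ 1 := by exact_mod_cast h1
    interval_cases m <;> simp
  have hD' : D = u 0 * (v 1 * w 2 - w 1 * v 2) - v 0 * (u 1 * w 2 - w 1 * u 2) +
      w 0 * (u 1 * v 2 - v 1 * u 2) := by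
    simp only [hD, det3, Matrix.det_fin_three, Pi.sub_apply, hu, hv', hw, Matrix.of_apply,
      Matrix.cons_val]
    ring
  have hr' := hunit r (q 0 * (v 1 * w 2 - w 1 * v 2) - v 0 * (q 1 * w 2 - w 1 * q 2) +
      w 0 * (q 1 * v 2 - v 1 * q 2)) hr (by linarith) (by
        push_cast; rw [hD']; simp only [hq']; ring)
  have hs' := hunit s (u 0 * (q 1 * w 2 - w 1 * q 2) - q 0 * (u 1 * w 2 - w 1 * u 2) +
      w 0 * (u 1 * q 2 - q 1 * u 2)) hs (by linarith) (by
        push_cast; rw [hD']; simp only [hq']; ring)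
  have ht' := hunit t (u 0 * (v 1 * q 2 - q 1 * v 2) - v 0 * (u 1 * q 2 - q 1 * u 2) +
      q 0 * (u 1 * v 2 - v 1 * u 2)) ht (by linarith) (by
        push_cast; rw [hD']; simp only [hq']; ring)
  simp only [Finset.mem_insert, Finset.mem_singleton]
  rcases hr' with rfl | rfl
  · rcases hs' with rfl | rfl
    · rcases ht' with rfl | rfl
      · exact Or.inl (by simp [hpe])
      · exact Or.inr (Or.inr (Or.inr (by simp [hpe])))
    · obtain rfl : t = 0 := by linarith
      exact Or.inr (Or.inr (Or.inl (by simp [hpe])))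
  · obtain rfl : s = 0 := by linarith
    obtain rfl : t = 0 := by linarith
    exact Or.inr (Or.inl (by simp [hpe]))

theorem AffineIndependent.weights_eq {S : Finset ℝ³}
    (hS : AffineIndependent ℝ (fun v : (S : Set ℝ³) => (v : ℝ³))) {w₁ w₂ : ℝ³ → ℝ}
    (h1 : ∑ y ∈ S, w₁ y = ∑ y ∈ S, w₂ y) (h2 : ∑ y ∈ S, w₁ y • y = ∑ y ∈ S, w₂ y • y) :
    ∀ y ∈ S, w₁ y = w₂ y := by
  intro y hy
  have := affineIndependent_iff.1 hS Finset.univ (fun v => w₁ v - w₂ v)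
    (by simp only [Finset.univ_eq_attach, Finset.sum_sub_distrib, Finset.coe_sort_coe]
        rw [Finset.sum_attach S w₁, Finset.sum_attach S w₂, h1, sub_self])
    (by simp only [Finset.univ_eq_attach, Finset.sum_sub_distrib, sub_smul, Finset.coe_sort_coe]
        rw [Finset.sum_attach S fun v => w₁ v • v, Finset.sum_attach S fun v => w₂ v • v, h2,
          sub_self]) ⟨y, hy⟩ (Finset.mem_univ _)
  exact sub_eq_zero.1 this

/-- A point in the relative interior of a face `G` of a simplex lies in another face only if this
face contains `G`. -/
theorem AffineIndependent.subset_of_mem_convexHull {S G F : Finset ℝ³}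
    (hS : AffineIndependent ℝ (fun v : (S : Set ℝ³) => (v : ℝ³))) (hG : G ⊆ S) (hF : F ⊆ S)
    {w : ℝ³ → ℝ} (hw : ∀ y ∈ G, 0 < w y) (hw1 : ∑ y ∈ G, w y = 1)
    (hx : ∑ y ∈ G, w y • y ∈ convexHull ℝ (F : Set ℝ³)) : G ⊆ F := by
  rw [Finset.mem_convexHull'] at hx
  obtain ⟨v, -, hv1, hvx⟩ := hx
  intro y hy
  by_contra hyF
  have := hS.weights_eq (w₁ := fun z => if z ∈ G then w z else 0)
    (w₂ := fun z => if z ∈ F then v z else 0)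
    (by rw [Finset.sum_ite_mem, Finset.sum_ite_mem, Finset.inter_eq_right.2 hG,
          Finset.inter_eq_right.2 hF, hv1, hw1])
    (by simp only [ite_smul, zero_smul]
        rw [Finset.sum_ite_mem, Finset.sum_ite_mem, Finset.inter_eq_right.2 hG,
          Finset.inter_eq_right.2 hF, hvx]) y (hG hy)
  simp only [hy, hyF, if_true, if_false] at this
  exact (hw y hy).ne' this

namespace IsTriangulationOf

variable {P : Set ℝ³} {T : Set (Finset ℝ³)}

theorem subset_of_mem (hT : IsTriangulationOf P T) {S S' G : Finset ℝ³} (hS : S ∈ T) (hS' : S' ∈ T)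
    (hG : G ⊆ S) {w : ℝ³ → ℝ} (hw : ∀ y ∈ G, 0 < w y) (hw1 : ∑ y ∈ G, w y = 1)
    (hx : ∑ y ∈ G, w y • y ∈ convexHull ℝ (S' : Set ℝ³)) : G ⊆ S' := by
  obtain ⟨F, -, hFS, hFS', h⟩ := hT.2.2.2.2 S hS S' hS'
  refine ((hT.2.1 S hS).2.subset_of_mem_convexHull hG hFS hw hw1 ?_).trans hFS'
  rw [← h]
  refine ⟨convexHull_mono (Finset.coe_subset.2 hG) ?_, hx⟩
  rw [Finset.mem_convexHull']
  exact ⟨w, fun y hy => (hw y hy).le, hw1, rfl⟩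

theorem card_le (hT : IsTriangulationOf P T) {S : Finset ℝ³} (hS : S ∈ T) : S.card ≤ 4 := by
  have := (hT.2.1 S hS).2.card_le_finrank_succ
  have h2 := Submodule.finrank_le (vectorSpan ℝ (range fun v : (S : Set ℝ³) => (v : ℝ³)))
  simp at this h2
  omega

theorem exists_card_eq_four (hT : IsTriangulationOf P T) (hP : Convex ℝ P)
    (hi : (interior P).Nonempty) {x : ℝ³} (hx : x ∈ P) :
    ∃ S ∈ T, S.card = 4 ∧ x ∈ convexHull ℝ (S : Set ℝ³) := by
  set U := ⋃ S ∈ {S ∈ T | S.card = 4}, convexHull ℝ (S : Set ℝ³) with hU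
  have hUc : IsClosed U := by
    refine (hT.1.subset (sep_subset _ _)).isClosed_biUnion fun S _ => ?_
    exact (S.finite_toSet.isCompact_convexHull (𝕜 := ℝ)).isClosed
  have hZ : interior P ⊆ U := by
    by_contra hne
    obtain ⟨y, hyP, hyU⟩ := not_subset.1 hne
    have hopen : IsOpen (interior P \ U) := isOpen_interior.sdiff hUc
    refine (hopen.measure_pos volume ⟨y, hyP, hyU⟩).ne' ?_
    have hsub : interior P \ U ⊆ ⋃ S ∈ {S ∈ T | S.card < 4}, convexHull ℝ (S : Set ℝ³) := by
      rintro z ⟨hzP, hzU⟩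
      have hz := interior_subset hzP
      rw [← hT.2.2.1] at hz
      simp only [mem_iUnion] at hz
      obtain ⟨S, hS, hzS⟩ := hz
      refine mem_biUnion (x := S) ⟨hS, (hT.card_le hS).lt_of_ne fun h => hzU ?_⟩ hzS
      exact mem_biUnion (x := S) ⟨hS, h⟩ hzS
    refine measure_mono_null hsub ?_
    rw [measure_biUnion_null_iff (hT.1.subset (sep_subset _ _)).countable]
    exact fun S hS => volume_convexHull_eq_zero hS.2
  have hx' : x ∈ U := by
    refine closure_minimal hZ hUc ?_
    rw [hP.closure_interior_eq_closure_of_nonempty_interior hi]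
    exact subset_closure hx
  simp only [hU, mem_iUnion] at hx'
  obtain ⟨S, hS, h⟩ := hx'
  exact ⟨S, hS.1, hS.2, h⟩

theorem exists_centroid {S : Finset ℝ³} (hS : S.Nonempty) :
    ∃ w : ℝ³ → ℝ, (∀ y ∈ S, 0 < w y) ∧ ∑ y ∈ S, w y = 1 := by
  have := hS.card_pos
  refine ⟨fun _ => (S.card : ℝ)⁻¹, fun y _ => by positivity, ?_⟩
  rw [Finset.sum_const, nsmul_eq_mul, mul_inv_cancel₀ (by positivity)]

theorem exists_subset_card_eq_four (hT : IsTriangulationOf P T) (hP : Convex ℝ P)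
    (hi : (interior P).Nonempty) {S : Finset ℝ³} (hS : S ∈ T) :
    ∃ S' ∈ T, S'.card = 4 ∧ S ⊆ S' := by
  rcases S.eq_empty_or_nonempty with rfl | hne
  · obtain ⟨S', h1, h2, -⟩ := hT.exists_card_eq_four hP hi (interior_subset hi.some_mem)
    exact ⟨S', h1, h2, Finset.empty_subset _⟩
  · obtain ⟨w, hw, hw1⟩ := exists_centroid hne
    have hmem : ∑ y ∈ S, w y • y ∈ convexHull ℝ (S : Set ℝ³) :=
      S.mem_convexHull'.2 ⟨w, fun y hy => (hw y hy).le, hw1, rfl⟩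
    have hxP : ∑ y ∈ S, w y • y ∈ P := by
      rw [← hT.2.2.1]
      exact mem_biUnion hS hmem
    obtain ⟨S', h1, h2, h3⟩ := hT.exists_card_eq_four hP hi hxP
    exact ⟨S', h1, h2, hT.subset_of_mem hS h1 subset_rfl hw hw1 h3⟩

/-- A triangulation is determined by any triangulation containing its full-dimensional
simplices. -/
theorem eq_of_forall_mem {T' : Set (Finset ℝ³)} (hT : IsTriangulationOf P T)
    (hT' : IsTriangulationOf P T') (hP : Convex ℝ P) (hi : (interior P).Nonempty)
    (h : ∀ S ∈ T', S.card = 4 → S ∈ T) : T' = T := by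
  refine Subset.antisymm (fun S hS => ?_) fun S hS => ?_
  · obtain ⟨S', h1, h2, h3⟩ := hT'.exists_subset_card_eq_four hP hi hS
    exact hT.2.2.2.1 S' (h S' h1 h2) S h3
  · obtain ⟨S', h1, h2, h3⟩ := hT.exists_subset_card_eq_four hP hi hS
    refine hT'.2.2.2.1 S' ?_ S h3
    obtain ⟨w, hw, hw1⟩ := exists_centroid (S := S') (Finset.card_pos.1 (by omega))
    have hxP : ∑ y ∈ S', w y • y ∈ P := by
      rw [← hT.2.2.1]
      exact mem_biUnion h1 (S'.mem_convexHull'.2 ⟨w, fun y hy => (hw y hy).le, hw1, rfl⟩)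
    obtain ⟨S'', k1, k2, k3⟩ := hT'.exists_card_eq_four hP hi hxP
    have := hT.subset_of_mem h1 (h S'' k1 k2) subset_rfl hw hw1 k3
    rwa [Finset.eq_of_subset_of_card_le this (by omega)]

end IsTriangulationOf

theorem pt_injective : Function.Injective pt := by
  intro i j h
  have h0 : ((i % 5 : ℕ) : ℝ) = (j % 5 : ℕ) := congrFun h 0
  have h1 : ((i / 5 % 5 : ℕ) : ℝ) = (j / 5 % 5 : ℕ) := congrFun h 1
  have h2 : ((i / 25 : ℕ) : ℝ) = (j / 25 : ℕ) := congrFun h 2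
  norm_cast at h0 h1 h2
  omega

theorem pt_ne_pOne {i : ℕ} (hi : i ∈ ptIdx) : pt i ≠ pOne := by
  rw [← pt_31]
  intro h
  rw [pt_injective h] at hi
  revert hi
  decide

theorem pairwise_ptsOf (A : List Z3) : (ptsOf A).Pairwise (· < ·) :=
  List.Pairwise.filter _ (by decide)

theorem mem_pairsOf {l : List ℕ} (hl : l.Pairwise (· < ·)) {i j : ℕ} :
    (i, j) ∈ pairsOf l ↔ i ∈ l ∧ j ∈ l ∧ i < j := by
  induction l with
  | nil => simp [pairsOf]
  | cons a l ih =>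
    rw [List.pairwise_cons] at hl
    have h := hl.1
    simp only [pairsOf, List.mem_append, List.mem_map, Prod.mk.injEq, ih hl.2, List.mem_cons]
    constructor
    · rintro (⟨b, hb, rfl, rfl⟩ | ⟨h1, h2, h3⟩)
      · exact ⟨Or.inl rfl, Or.inr hb, h _ hb⟩
      · exact ⟨Or.inr h1, Or.inr h2, h3⟩
    · rintro ⟨rfl | h1, rfl | h2, h3⟩
      · omega
      · exact Or.inl ⟨j, h2, rfl, rfl⟩
      · exact absurd (h _ h1) (by omega)
      · exact Or.inr ⟨h1, h2, h3⟩

theorem mem_triplesOf {l : List ℕ} (hl : l.Pairwise (· < ·)) {i j k : ℕ} :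
    (i, j, k) ∈ triplesOf l ↔ i ∈ l ∧ j ∈ l ∧ k ∈ l ∧ i < j ∧ j < k := by
  induction l with
  | nil => simp [triplesOf]
  | cons a l ih =>
    rw [List.pairwise_cons] at hl
    have h := hl.1
    simp only [triplesOf, List.mem_append, List.mem_map, Prod.mk.injEq, ih hl.2, List.mem_cons,
      Prod.exists, mem_pairsOf hl.2]
    constructor
    · rintro (⟨b, c, ⟨hb, hc, hbc⟩, rfl, rfl, rfl⟩ | ⟨h1, h2, h3, h4⟩)
      · exact ⟨Or.inl rfl, Or.inr hb, Or.inr hc, h _ hb, hbc⟩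
      · exact ⟨Or.inr h1, Or.inr h2, Or.inr h3, h4⟩
    · rintro ⟨rfl | h1, rfl | h2, rfl | h3, h4, h5⟩
      · omega
      · omega
      · omega
      · exact Or.inl ⟨j, k, ⟨h2, h3, h5⟩, rfl, rfl, rfl⟩
      · omega
      · exact absurd (h _ h1) (by omega)
      · exact absurd (h _ h2) (by omega)
      · exact Or.inr ⟨h1, h2, h3, h4, h5⟩

theorem mem_unimodularTriples {A : List Z3} {i j k : ℕ} : (i, j, k) ∈ unimodularTriples A ↔
    ∃ a ∈ A, ((i ∈ ptsOf A ∧ a.dot (disp i) = -1) ∧ (j ∈ ptsOf A ∧ a.dot (disp j) = -1) ∧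
      (k ∈ ptsOf A ∧ a.dot (disp k) = -1) ∧ i < j ∧ j < k) ∧
      Triple.det (i, j, k) * Triple.det (i, j, k) = 1 := by
  simp only [unimodularTriples, List.mem_flatMap, List.mem_filter (p := fun t : Triple => _),
    mem_triplesOf ((pairwise_ptsOf A).filter _), List.mem_filter, beq_iff_eq]

theorem Triple.has_iff {t : Triple} {i : ℕ} : t.has i = true ↔ i = t.1 ∨ i = t.2.1 ∨ i = t.2.2 := by
  simp only [Triple.has, Bool.or_eq_true, beq_iff_eq, @eq_comm ℕ i]

theorem isLower_iff {L : List ℕ} {c : ℕ} {t : Triple} : isLower L c t = true ↔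
    ∀ q ∈ L, (t.has q = true → (weightSlope c t).dot (disp q) = weight c (disp q)) ∧
      (t.has q ≠ true → (weightSlope c t).dot (disp q) < weight c (disp q)) := by
  simp only [isLower, List.all_eq_true]
  refine forall₂_congr fun q _ => ?_
  cases t.has q
  · simp [intNeg_iff]
  · simp

/-- The vertices of the tetrahedron spanned by a triple and `(1,1,1)`. -/
def Triple.tet (t : Triple) : Finset ℝ³ := {pOne, pt t.1, pt t.2.1, pt t.2.2}

theorem Triple.coe_tet (t : Triple) :
    (t.tet : Set ℝ³) = {pOne, pt t.1, pt t.2.1, pt t.2.2} := by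
  simp [Triple.tet]

theorem Triple.mem_tet {t : Triple} {x : ℝ³} :
    x ∈ t.tet ↔ x = pOne ∨ ∃ i, t.has i = true ∧ x = pt i := by
  simp [Triple.tet, Triple.has_iff]

theorem Triple.pt_mem_tet {t : Triple} {i : ℕ} (hi : i ∈ ptIdx) :
    pt i ∈ t.tet ↔ t.has i = true := by
  rw [Triple.mem_tet, or_iff_right (pt_ne_pOne hi)]
  exact ⟨fun ⟨j, hj, h⟩ => pt_injective h ▸ hj, fun h => ⟨i, h, rfl⟩⟩

theorem Z3.aff_comb (a : Z3) (i j k : ℕ) (r s t : ℝ) :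
    a.aff (pOne + r • (pt i - pOne) + s • (pt j - pOne) + t • (pt k - pOne)) =
      r * a.dot (disp i) + s * a.dot (disp j) + t * a.dot (disp k) := by
  simp only [pt_eq, add_sub_cancel_left]
  simp [Z3.aff_apply, pOne, Z3.vec, Z3.dot]
  ring

theorem Triple.exists_coords {t : Triple} (ht : t.det * t.det = 1) (x : ℝ³) : ∃ α β γ : ℝ,
    x = pOne + α • (pt t.1 - pOne) + β • (pt t.2.1 - pOne) + γ • (pt t.2.2 - pOne) := by
  obtain ⟨i, j, k⟩ := t
  simp only [pt_eq, add_sub_cancel_left]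
  simp only [Triple.det, Z3.det, Z3.dot, Z3.cross] at ht
  generalize disp i = u at *
  generalize disp j = v at *
  generalize disp k = w at *
  obtain ⟨u0, u1, u2⟩ := u
  obtain ⟨v0, v1, v2⟩ := v
  obtain ⟨w0, w1, w2⟩ := w
  simp only at ht
  have ht' := congrArg (Int.cast : ℤ → ℝ) ht
  push_cast at ht'
  set D : ℝ := (u0 * (v1 * w2 - v2 * w1) + u1 * (v2 * w0 - v0 * w2) + u2 * (v0 * w1 - v1 * w0))
    with hD
  refine ⟨D * ((v1 * w2 - v2 * w1) * (x 0 - 1) + (v2 * w0 - v0 * w2) * (x 1 - 1) +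
      (v0 * w1 - v1 * w0) * (x 2 - 1)),
    D * ((w1 * u2 - w2 * u1) * (x 0 - 1) + (w2 * u0 - w0 * u2) * (x 1 - 1) +
      (w0 * u1 - w1 * u0) * (x 2 - 1)),
    D * ((u1 * v2 - u2 * v1) * (x 0 - 1) + (u2 * v0 - u0 * v2) * (x 1 - 1) +
      (u0 * v1 - u1 * v0) * (x 2 - 1)), ?_⟩
  ext n
  fin_cases n <;> simp [Z3.vec, pOne]
  · linear_combination (-(x 0 - 1)) * ht' - D * (x 0 - 1) * hD
  · linear_combination (-(x 1 - 1)) * ht' - D * (x 1 - 1) * hD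
  · linear_combination (-(x 2 - 1)) * ht' - D * (x 2 - 1) * hD

section Induced

variable {A : List Z3} {c : ℕ}

theorem mem_inducedTriples {t : Triple} : t ∈ inducedTriples A c ↔
    t ∈ unimodularTriples A ∧ isLower (ptsOf A) c t = true := List.mem_filter

theorem det_mul_det_of_mem {t : Triple} (ht : t ∈ unimodularTriples A) : t.det * t.det = 1 := by
  obtain ⟨a, -, -, h⟩ := mem_unimodularTriples.1 ht
  exact h

theorem mem_ptsOf_of_has {t : Triple} (ht : t ∈ unimodularTriples A) {i : ℕ}
    (hi : t.has i = true) : i ∈ ptsOf A := by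
  obtain ⟨a, -, ⟨h1, h2, h3, -⟩, -⟩ := mem_unimodularTriples.1 ht
  rcases Triple.has_iff.1 hi with rfl | rfl | rfl
  exacts [h1.1, h2.1, h3.1]

theorem exists_aff_lt_of_neg {t : Triple} (ht : t ∈ inducedTriples A c) {i j k : ℕ}
    (hi : t.has i = true) (hj : t.has j = true) (hk : t.has k = true)
    (hn : hasNeighbour (inducedTriples A c) i j k = true) {x : ℝ³} {α β γ : ℝ}
    (hx : x = pOne + α • (pt i - pOne) + β • (pt j - pOne) + γ • (pt k - pOne)) (hα : α < 0) :
    ∃ s ∈ inducedTriples A c, (weightSlope c t).aff x < (weightSlope c s).aff x := by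
  simp only [hasNeighbour, List.any_eq_true, Bool.and_eq_true, Bool.not_eq_true'] at hn
  obtain ⟨s, hs, hsj, hsk, hsi⟩ := hn
  refine ⟨s, hs, ?_⟩
  rw [mem_inducedTriples] at ht hs
  have hL : ∀ {q}, t.has q = true → q ∈ ptsOf A := mem_ptsOf_of_has ht.1
  have lt := isLower_iff.1 ht.2
  have ls := isLower_iff.1 hs.2
  rw [hx, Z3.aff_comb, Z3.aff_comb, (lt i (hL hi)).1 hi, (lt j (hL hj)).1 hj, (lt k (hL hk)).1 hk,
    (ls j (hL hj)).1 hsj, (ls k (hL hk)).1 hsk]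
  have h : ((weightSlope c s).dot (disp i) : ℝ) < weight c (disp i) := by
    exact_mod_cast (ls i (hL hi)).2 (by simp [hsi])
  linarith [mul_lt_mul_of_neg_left h hα]

theorem exists_mem_convexHull_tet (hT : isClosedSurface (inducedTriples A c) = true) {x : ℝ³}
    (hx : x ∈ polyOf A) : ∃ t ∈ inducedTriples A c, x ∈ convexHull ℝ (t.tet : Set ℝ³) := by
  simp only [isClosedSurface, Bool.and_eq_true, List.all_eq_true, Bool.not_eq_true',
    List.isEmpty_eq_false_iff] at hT
  obtain ⟨hne, hT⟩ := hT
  obtain ⟨t, ht, hmax⟩ := (List.finite_toSet (inducedTriples A c)).exists_maximalFor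
    (fun t => (weightSlope c t).aff x) _ (List.exists_mem_of_ne_nil _ hne)
  refine ⟨t, ht, ?_⟩
  have hle : ∀ s ∈ inducedTriples A c, (weightSlope c s).aff x ≤ (weightSlope c t).aff x :=
    fun s hs => (le_total _ _).elim (fun h => hmax hs h) id
  obtain ⟨h1, h2, h3⟩ := hT t ht
  have htu := (mem_inducedTriples.1 ht).1
  obtain ⟨α, β, γ, hc⟩ := Triple.exists_coords (det_mul_det_of_mem htu) x
  have i1 : t.has t.1 = true := by simp [Triple.has_iff]
  have i2 : t.has t.2.1 = true := by simp [Triple.has_iff]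
  have i3 : t.has t.2.2 = true := by simp [Triple.has_iff]
  rw [Triple.coe_tet, mem_convexHull_four]
  refine ⟨α, β, γ, ?_, ?_, ?_, ?_, hc⟩
  · by_contra! h
    obtain ⟨s, hs, h⟩ := exists_aff_lt_of_neg ht i1 i2 i3 h1 hc h
    exact absurd (hle s hs) (not_le.2 h)
  · by_contra! h
    obtain ⟨s, hs, h⟩ := exists_aff_lt_of_neg ht i2 i3 i1 h2 (x := x) (α := β) (β := γ) (γ := α)
      (by rw [hc]; abel) h
    exact absurd (hle s hs) (not_le.2 h)
  · by_contra! h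
    obtain ⟨s, hs, h⟩ := exists_aff_lt_of_neg ht i3 i1 i2 h3 (x := x) (α := γ) (β := α) (γ := β)
      (by rw [hc]; abel) h
    exact absurd (hle s hs) (not_le.2 h)
  · obtain ⟨a, ha, ⟨⟨-, k1⟩, ⟨-, k2⟩, ⟨-, k3⟩, -⟩, -⟩ := mem_unimodularTriples.1 htu
    have := hx a ha
    rw [hc, Z3.aff_comb, k1, k2, k3] at this
    push_cast at this
    linarith

theorem tet_subset {t : Triple} (ht : t ∈ unimodularTriples A) :
    (t.tet : Set ℝ³) ⊆ polyOf A ∩ latticePts ∩ Delta4 := by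
  intro x hx
  rcases Triple.mem_tet.1 hx with rfl | ⟨i, hi, rfl⟩
  · exact ⟨⟨pOne_mem_polyOf A, pOne_mem_latticePts⟩, mem_Delta4.2 (by simp [pOne]; norm_num)⟩
  · have h := mem_ptsOf_of_has ht hi
    have h' := mem_ptIdx_of_mem_ptsOf h
    exact ⟨⟨(pt_mem_polyOf h').2 h, pt_mem_latticePts i⟩, pt_mem_Delta4 h'⟩

theorem polyOf_subset_Delta4 (hT : isClosedSurface (inducedTriples A c) = true) :
    polyOf A ⊆ Delta4 := by
  intro x hx
  obtain ⟨t, ht, h⟩ := exists_mem_convexHull_tet hT hx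
  exact convexHull_min ((tet_subset (mem_inducedTriples.1 ht).1).trans inter_subset_right)
    (convex_convexHull ℝ _) h

theorem isCanonicalSub_polyOf (hT : isClosedSurface (inducedTriples A c) = true) :
    IsCanonicalSub (polyOf A) := by
  refine ⟨⟨polyOf_subset_Delta4 hT, Subset.antisymm (fun x hx => ?_)
    (convexHull_min inter_subset_left (convex_polyOf A))⟩, pOne_mem_interior_polyOf A⟩
  obtain ⟨t, ht, h⟩ := exists_mem_convexHull_tet hT hx
  exact convexHull_mono ((tet_subset (mem_inducedTriples.1 ht).1).trans inter_subset_left) h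

theorem Triple.sum_tet {M : Type*} [AddCommMonoid M] {t : Triple}
    (ht : ∀ i, t.has i = true → i ∈ ptsOf A) (h1 : t.1 < t.2.1) (h2 : t.2.1 < t.2.2) (f : ℝ³ → M) :
    ∑ y ∈ t.tet, f y = f pOne + (f (pt t.1) + (f (pt t.2.1) + f (pt t.2.2))) := by
  have hp : ∀ {i}, t.has i = true → pOne ≠ pt i := fun hi =>
    (pt_ne_pOne (mem_ptIdx_of_mem_ptsOf (ht _ hi))).symm
  rw [Triple.tet, Finset.sum_insert, Finset.sum_insert, Finset.sum_pair]
  · exact pt_injective.ne h2.ne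
  · simpa using ⟨pt_injective.ne h1.ne, pt_injective.ne (h1.trans h2).ne⟩
  · simpa using ⟨hp (by simp [Triple.has_iff]), hp (by simp [Triple.has_iff]),
      hp (by simp [Triple.has_iff])⟩

theorem lt_of_mem_unimodularTriples {t : Triple} (ht : t ∈ unimodularTriples A) :
    t.1 < t.2.1 ∧ t.2.1 < t.2.2 := by
  obtain ⟨a, ha, ⟨-, -, -, h⟩, -⟩ := mem_unimodularTriples.1 ht
  exact h

theorem Triple.card_tet {t : Triple} (ht : t ∈ unimodularTriples A) : t.tet.card = 4 := by
  obtain ⟨h1, h2⟩ := lt_of_mem_unimodularTriples ht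
  rw [Finset.card_eq_sum_ones, Triple.sum_tet (fun i => mem_ptsOf_of_has ht) h1 h2]
  norm_num

theorem det3_pt (i j k : ℕ) : det3 (pt i - pOne) (pt j - pOne) (pt k - pOne) =
    Triple.det (i, j, k) := by
  simp only [pt_eq, add_sub_cancel_left, det3, Z3.vec, Matrix.det_fin_three, Triple.det, Z3.det,
    Z3.dot, Z3.cross, Matrix.of_apply, Matrix.cons_val]
  push_cast
  ring

theorem Triple.volume_tet {t : Triple} (ht : t.det * t.det = 1) :
    volume (convexHull ℝ (t.tet : Set ℝ³)) = ENNReal.ofReal (1 / 6) := by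
  rw [Triple.coe_tet, volume_convexHull_four, det3_pt]
  have : |(t.det : ℝ)| = 1 := by
    have h : |t.det| = 1 := by rcases mul_self_eq_one_iff.1 ht with h | h <;> simp [h]
    exact_mod_cast h
  rw [this]

theorem Triple.affineIndependent_tet {t : Triple} (ht : t ∈ unimodularTriples A) :
    AffineIndependent ℝ (fun v : (t.tet : Set ℝ³) => (v : ℝ³)) := by
  refine affineIndependent_of_volume_ne_zero (Triple.card_tet ht) ?_
  rw [Triple.volume_tet (det_mul_det_of_mem ht)]
  simp

end Induced

open Classical in
/-- The weight with the given code, as a function on the lattice points of `4Δ₃`, normalised to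
be `0` at `(1,1,1)`. -/
def ptWeight (c : ℕ) (x : ℝ³) : ℝ :=
  if h : ∃ i ∈ ptIdx, x = pt i then weight c (disp h.choose) else 0

theorem ptWeight_pt (c : ℕ) {i : ℕ} (hi : i ∈ ptIdx) : ptWeight c (pt i) = weight c (disp i) := by
  have h : ∃ j ∈ ptIdx, pt i = pt j := ⟨i, hi, rfl⟩
  rw [ptWeight, dif_pos h, ← pt_injective h.choose_spec.2]

theorem ptWeight_pOne (c : ℕ) : ptWeight c pOne = 0 :=
  dif_neg fun ⟨_, hi, h⟩ => pt_ne_pOne hi h.symm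

/-- The triangulation induced by a weight: all faces of the tetrahedra on its lower hull. -/
def inducedTriang (A : List Z3) (c : ℕ) : Set (Finset ℝ³) :=
  {S | ∃ t ∈ inducedTriples A c, S ⊆ t.tet}

section

variable {A : List Z3} {c : ℕ}

theorem eq_pOne_or_exists_mem_ptsOf (hA : polyOf A ⊆ Delta4) {x : ℝ³}
    (hx : x ∈ polyOf A ∩ latticePts) : x = pOne ∨ ∃ i ∈ ptsOf A, x = pt i := by
  rcases eq_pOne_or_pt (hA hx.1) hx.2 with h | ⟨i, hi, rfl⟩
  · exact Or.inl h
  · exact Or.inr ⟨i, (pt_mem_polyOf hi).1 hx.1, rfl⟩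

theorem aff_weightSlope_eq {t : Triple} (ht : t ∈ inducedTriples A c) {x : ℝ³} (hx : x ∈ t.tet) :
    (weightSlope c t).aff x = ptWeight c x := by
  rw [mem_inducedTriples] at ht
  rcases Triple.mem_tet.1 hx with rfl | ⟨i, hi, rfl⟩
  · rw [Z3.aff_pOne, ptWeight_pOne]
  · have h := mem_ptsOf_of_has ht.1 hi
    rw [aff_pt, ptWeight_pt c (mem_ptIdx_of_mem_ptsOf h), (isLower_iff.1 ht.2 i h).1 hi]

theorem aff_weightSlope_lt (hA : polyOf A ⊆ Delta4) {t : Triple} (ht : t ∈ inducedTriples A c)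
    {x : ℝ³} (hx : x ∈ polyOf A ∩ latticePts) (hxt : x ∉ t.tet) :
    (weightSlope c t).aff x < ptWeight c x := by
  rw [mem_inducedTriples] at ht
  rcases eq_pOne_or_exists_mem_ptsOf hA hx with rfl | ⟨i, hi, rfl⟩
  · exact absurd (Triple.mem_tet.2 (Or.inl rfl)) hxt
  · have h := mem_ptIdx_of_mem_ptsOf hi
    rw [aff_pt, ptWeight_pt c h]
    exact_mod_cast (isLower_iff.1 ht.2 i hi).2 fun h' => hxt ((Triple.pt_mem_tet h).2 h')

theorem aff_weightSlope_le (hA : polyOf A ⊆ Delta4) {t : Triple} (ht : t ∈ inducedTriples A c)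
    {x : ℝ³} (hx : x ∈ polyOf A ∩ latticePts) : (weightSlope c t).aff x ≤ ptWeight c x := by
  by_cases h : x ∈ t.tet
  · exact (aff_weightSlope_eq ht h).le
  · exact (aff_weightSlope_lt hA ht hx h).le

theorem map_sum_weights (f : ℝ³ →ᵃ[ℝ] ℝ) {S : Finset ℝ³} {w : ℝ³ → ℝ} (hw : ∑ y ∈ S, w y = 1) :
    f (∑ y ∈ S, w y • y) = ∑ y ∈ S, w y * f y := by
  have := S.map_affineCombination (fun y => y) w hw f
  rw [S.affineCombination_eq_linear_combination _ _ hw,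
    S.affineCombination_eq_linear_combination _ _ hw] at this
  simpa using this

theorem exists_face (hA : polyOf A ⊆ Delta4) {s t : Triple} (hs : s ∈ inducedTriples A c)
    (ht : t ∈ inducedTriples A c) {S S' : Finset ℝ³} (hS : S ⊆ s.tet) (hS' : S' ⊆ t.tet) :
    convexHull ℝ (S : Set ℝ³) ∩ convexHull ℝ (S' : Set ℝ³) = convexHull ℝ (↑(S ∩ S') : Set ℝ³) := by
  have hlat : ∀ {r}, r ∈ inducedTriples A c → ∀ y ∈ r.tet, y ∈ polyOf A ∩ latticePts :=
    fun hr y hy => (tet_subset (mem_inducedTriples.1 hr).1 hy).1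
  refine Subset.antisymm ?_ (subset_inter (convexHull_mono (by simp)) (convexHull_mono (by simp)))
  rintro x ⟨hx, hx'⟩
  obtain ⟨w, hw0, hw1, hwx⟩ := Finset.mem_convexHull'.1 hx
  obtain ⟨w', hw0', hw1', hwx'⟩ := Finset.mem_convexHull'.1 hx'
  have hsx : (weightSlope c s).aff x = ∑ y ∈ S, w y * ptWeight c y := by
    rw [← hwx, map_sum_weights _ hw1]
    exact Finset.sum_congr rfl fun y hy => by rw [aff_weightSlope_eq hs (hS hy)]
  have htx : (weightSlope c t).aff x = ∑ y ∈ S', w' y * ptWeight c y := by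
    rw [← hwx', map_sum_weights _ hw1']
    exact Finset.sum_congr rfl fun y hy => by rw [aff_weightSlope_eq ht (hS' hy)]
  have hts : (weightSlope c s).aff x ≤ (weightSlope c t).aff x := by
    rw [htx, ← hwx', map_sum_weights _ hw1']
    exact Finset.sum_le_sum fun y hy => mul_le_mul_of_nonneg_left
      (aff_weightSlope_le hA hs (hlat ht y (hS' hy))) (hw0' y hy)
  have hsub : ∀ y ∈ S, w y ≠ 0 → y ∈ t.tet := by
    intro y hy hwy
    by_contra hyt
    refine absurd hts (not_le.2 ?_)
    rw [hsx, ← hwx, map_sum_weights _ hw1]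
    refine Finset.sum_lt_sum (fun z hz => mul_le_mul_of_nonneg_left
      (aff_weightSlope_le hA ht (hlat hs z (hS hz))) (hw0 z hz)) ⟨y, hy, ?_⟩
    exact mul_lt_mul_of_pos_left (aff_weightSlope_lt hA ht (hlat hs y (hS hy)) hyt)
      ((hw0 y hy).lt_of_ne' hwy)
  have hu := (Triple.affineIndependent_tet (mem_inducedTriples.1 ht).1)
  have hsum : ∑ y ∈ S.filter (fun y => w y ≠ 0), w y = 1 := by rw [Finset.sum_filter_ne_zero, hw1]
  have hmem : ∑ y ∈ S.filter (fun y => w y ≠ 0), w y • y = x := by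
    rw [← hwx, Finset.sum_filter_of_ne]
    intro y _ h hy
    exact h (by rw [hy, zero_smul])
  have hsub' : S.filter (fun y => w y ≠ 0) ⊆ S' := by
    refine hu.subset_of_mem_convexHull (fun y hy => ?_) hS' (fun y hy => ?_) hsum ?_
    · rw [Finset.mem_filter] at hy
      exact hsub y hy.1 hy.2
    · rw [Finset.mem_filter] at hy
      exact (hw0 y hy.1).lt_of_ne' hy.2
    · rwa [hmem]
  rw [← hmem]
  refine (convex_convexHull ℝ _).sum_mem (fun y hy => hw0 y (Finset.mem_filter.1 hy).1) hsum ?_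
  intro y hy
  refine subset_convexHull ℝ _ ?_
  rw [Finset.mem_coe, Finset.mem_inter]
  exact ⟨(Finset.mem_filter.1 hy).1, hsub' hy⟩

theorem exists_eq_tet {S : Finset ℝ³} (hS : S ∈ inducedTriang A c) (h : S.card = 4) :
    ∃ t ∈ inducedTriples A c, S = t.tet := by
  obtain ⟨t, ht, hSt⟩ := hS
  refine ⟨t, ht, Finset.eq_of_subset_of_card_le hSt ?_⟩
  rw [h, Triple.card_tet (mem_inducedTriples.1 ht).1]

theorem isRUC_inducedTriang (hT : isClosedSurface (inducedTriples A c) = true) :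
    IsRUC (polyOf A) (inducedTriang A c) := by
  have hA := polyOf_subset_Delta4 hT
  refine ⟨⟨?_, ?_, ?_, ?_, ?_⟩, ?_, ?_, ptWeight c, ?_⟩
  · have : inducedTriang A c = ⋃ t ∈ {t | t ∈ inducedTriples A c}, (t.tet.powerset : Set _) := by
      ext S
      simp [inducedTriang]
    rw [this]
    exact (List.finite_toSet _).biUnion fun t _ => Finset.finite_toSet _
  · rintro S ⟨t, ht, hS⟩
    rw [mem_inducedTriples] at ht
    exact ⟨(Finset.coe_subset.2 hS).trans ((tet_subset ht.1).trans inter_subset_left),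
      (Triple.affineIndependent_tet ht.1).mono (Finset.coe_subset.2 hS)⟩
  · refine Subset.antisymm (iUnion₂_subset ?_) fun x hx => ?_
    · rintro S ⟨t, ht, hS⟩
      refine convexHull_min ?_ (convex_polyOf A)
      exact (Finset.coe_subset.2 hS).trans ((tet_subset (mem_inducedTriples.1 ht).1).trans
        (inter_subset_left.trans inter_subset_left))
    · obtain ⟨t, ht, h⟩ := exists_mem_convexHull_tet hT hx
      exact mem_biUnion (x := t.tet) ⟨t, ht, subset_rfl⟩ h
  · rintro S ⟨t, ht, hS⟩ S' hS'
    exact ⟨t, ht, hS'.trans hS⟩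
  · rintro S ⟨s, hs, hS⟩ S' ⟨t, ht, hS'⟩
    exact ⟨S ∩ S', ⟨s, hs, Finset.inter_subset_left.trans hS⟩, Finset.inter_subset_left,
      Finset.inter_subset_right, exists_face hA hs ht hS hS'⟩
  · intro S hS h
    obtain ⟨t, -, rfl⟩ := exists_eq_tet hS h
    exact subset_convexHull ℝ _ (Triple.mem_tet.2 (Or.inl rfl))
  · intro S hS h
    obtain ⟨t, ht, rfl⟩ := exists_eq_tet hS h
    exact Triple.volume_tet (det_mul_det_of_mem (mem_inducedTriples.1 ht).1)
  · intro S hS h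
    obtain ⟨t, ht, rfl⟩ := exists_eq_tet hS h
    exact ⟨(weightSlope c t).aff, fun v hv => aff_weightSlope_eq ht hv,
      fun v hv => aff_weightSlope_lt hA ht hv⟩

/-- The tetrahedra of a unimodular central triangulation are cones over unimodular triangles in
the facets. -/
theorem exists_eq_tet_of_isRUC (hA : polyOf A ⊆ Delta4) {T : Set (Finset ℝ³)}
    (hT : IsTriangulationOf (polyOf A) T) (hc : IsCentral pOne T) (hu : IsUnimodular T)
    {S : Finset ℝ³} (hS : S ∈ T) (h4 : S.card = 4) : ∃ t ∈ unimodularTriples A, S = t.tet := by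
  have hl := (hT.2.1 S hS).1
  have hpS : pOne ∈ S := mem_of_mem_convexHull_of_volume h4 (hl.trans inter_subset_right)
    (hu S hS h4) pOne_mem_latticePts (hc S hS h4)
  obtain ⟨t, ht, h12, h23, hSt⟩ : ∃ t : Triple, (∀ i, t.has i = true → i ∈ ptsOf A) ∧ t.1 < t.2.1 ∧
      t.2.1 < t.2.2 ∧ S = t.tet := by
    have hinj : (S.erase pOne).card = 3 := by rw [Finset.card_erase_of_mem hpS, h4]
    have hI : ∃ I : Finset ℕ, (∀ i ∈ I, i ∈ ptsOf A) ∧ S.erase pOne = I.image pt := by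
      refine ⟨(ptsOf A).toFinset.filter fun i => pt i ∈ S, fun i hi => ?_, ?_⟩
      · exact List.mem_toFinset.1 (Finset.mem_filter.1 hi).1
      · ext x
        simp only [Finset.mem_erase, Finset.mem_image, Finset.mem_filter, List.mem_toFinset]
        constructor
        · rintro ⟨hxp, hx⟩
          obtain ⟨i, hi, rfl⟩ := (eq_pOne_or_exists_mem_ptsOf hA (hl hx)).resolve_left hxp
          exact ⟨i, ⟨hi, hx⟩, rfl⟩
        · rintro ⟨i, ⟨hi, hx⟩, rfl⟩
          exact ⟨pt_ne_pOne (mem_ptIdx_of_mem_ptsOf hi), hx⟩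
    obtain ⟨I, hIL, hI⟩ := hI
    have hcard : I.card = 3 := by
      rw [← Finset.card_image_of_injective I pt_injective, ← hI, hinj]
    set e := I.orderEmbOfFin hcard
    have hIe : I = {e 0, e 1, e 2} := by
      have himage : ∀ f : Fin 3 → ℕ, Finset.univ.image f = {f 0, f 1, f 2} := fun f => by
        ext x
        simp [Fin.exists_fin_succ, eq_comm]
      exact (I.image_orderEmbOfFin_univ hcard).symm.trans (himage e)
    refine ⟨(e 0, e 1, e 2), ?_, e.strictMono (by decide), e.strictMono (by decide), ?_⟩
    · intro i hi
      refine hIL i ?_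
      rw [Triple.has_iff] at hi
      rw [hIe]
      simpa using hi
    · rw [← Finset.insert_erase hpS, hI, hIe]
      simp [Triple.tet]
  subst hSt
  have hv := hu _ hS h4
  rw [Triple.coe_tet, volume_convexHull_four, ENNReal.ofReal_eq_ofReal_iff (by positivity)
    (by norm_num), div_left_inj' (by norm_num), det3_pt] at hv
  have hdet : t.det * t.det = 1 := by
    rw [← abs_mul_abs_self, show |t.det| = 1 from by exact_mod_cast hv, mul_one]
  refine ⟨t, ?_, rfl⟩
  have i1 := ht t.1 (by simp [Triple.has_iff])
  have i2 := ht t.2.1 (by simp [Triple.has_iff])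
  have i3 := ht t.2.2 (by simp [Triple.has_iff])
  have hge : ∀ a ∈ A, ∀ {i}, i ∈ ptsOf A → -1 ≤ a.dot (disp i) := by
    intro a ha i hi
    have := (pt_mem_polyOf (mem_ptIdx_of_mem_ptsOf hi)).2 hi a ha
    rw [aff_pt] at this
    exact_mod_cast this
  suffices h : ∃ a ∈ A, a.dot (disp t.1) + a.dot (disp t.2.1) + a.dot (disp t.2.2) ≤ -3 by
    obtain ⟨a, ha, h⟩ := h
    have k1 := hge a ha i1
    have k2 := hge a ha i2
    have k3 := hge a ha i3
    have e1 : a.dot (disp t.1) = -1 := by omega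
    have e2 : a.dot (disp t.2.1) = -1 := by omega
    have e3 : a.dot (disp t.2.2) = -1 := by omega
    exact mem_unimodularTriples.2 ⟨a, ha, ⟨⟨i1, e1⟩, ⟨i2, e2⟩, ⟨i3, e3⟩, h12, h23⟩, hdet⟩
  by_contra! h
  set b : ℝ → ℝ³ := fun r => pOne + r • (pt t.1 - pOne) + r • (pt t.2.1 - pOne) +
    r • (pt t.2.2 - pOne) with hb
  have hm : polyOf A ∈ nhds (b (1 / 3)) := by
    refine polyOf_mem_nhds fun a ha => ?_
    rw [hb, Z3.aff_comb]
    have : (-3 : ℝ) < a.dot (disp t.1) + a.dot (disp t.2.1) + a.dot (disp t.2.2) := by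
      exact_mod_cast h a ha
    linarith
  obtain ⟨ε, hε, hy⟩ := exists_pos_add_smul_mem hm (b (1 / 3) - pOne)
  have hbε : b (1 / 3) + ε • (b (1 / 3) - pOne) = b ((1 + ε) / 3) := by
    simp only [hb]
    module
  rw [hbε] at hy
  obtain ⟨S', hS', h4', hyS'⟩ := hT.exists_card_eq_four (convex_polyOf A)
    ⟨_, pOne_mem_interior_polyOf A⟩ hy
  have hmem : b (1 / 4) ∈ convexHull ℝ (S' : Set ℝ³) := by
    have hs : 3 / (4 * (1 + ε)) ≤ 1 := by
      rw [div_le_one (by positivity)]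
      linarith
    have := (convex_convexHull ℝ (S' : Set ℝ³)) (hc S' hS' h4') hyS' (a := 1 - 3 / (4 * (1 + ε)))
      (b := 3 / (4 * (1 + ε))) (by linarith) (by positivity) (by ring)
    convert this using 1
    have e : (1 / 4 : ℝ) = 3 / (4 * (1 + ε)) * ((1 + ε) / 3) := by field_simp
    rw [e]
    simp only [hb]
    module
  have hsub := hT.subset_of_mem hS hS' subset_rfl (w := fun _ => 1 / 4) (by simp)
    (by rw [Triple.sum_tet ht h12 h23]; norm_num)
    (by
      rw [Triple.sum_tet ht h12 h23]
      convert hmem using 1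
      simp only [hb]
      module)
  rw [← Finset.eq_of_subset_of_card_le hsub (by omega), Triple.coe_tet, mem_convexHull_four] at hyS'
  obtain ⟨r, s, q, -, -, -, hle, he⟩ := hyS'
  have h' := congrArg ((disp t.1).interp (disp t.2.1) (disp t.2.2) 1 1 1).aff he
  obtain ⟨e1, e2, e3⟩ := Z3.interp_dot (disp t.1) (disp t.2.1) (disp t.2.2) 1 1 1
  rw [hb, Z3.aff_comb, Z3.aff_comb, e1, e2, e3, one_mul, ← add_mul, ← add_mul, ← add_mul,
    ← add_mul] at h'
  have hne : (((disp t.1).det (disp t.2.1) (disp t.2.2) : ℤ) : ℝ) ≠ 0 := by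
    rw [Int.cast_ne_zero]
    intro h0
    simp [Triple.det, h0] at hdet
  have := mul_right_cancel₀ hne h'
  linarith

/-- Two edges with the same midpoint do not occur in the same triangulation. -/
theorem conflict_eq_false {P : Set ℝ³} {T : Set (Finset ℝ³)} (hT : IsTriangulationOf P T)
    {s t : Triple} (hs : s.tet ∈ T) (ht : t.tet ∈ T) (hsi : ∀ i, s.has i = true → i ∈ ptIdx)
    (hti : ∀ i, t.has i = true → i ∈ ptIdx) (h12 : t.1 < t.2.1) (h23 : t.2.1 < t.2.2) :
    conflict s t = false := by
  rw [← Bool.not_eq_true]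
  intro h
  simp only [conflict, List.any_eq_true, Bool.and_eq_true, Bool.not_eq_true', sameMidpoint,
    beq_iff_eq] at h
  obtain ⟨e, he, f, hf, ⟨h0, h1, h2⟩, hsf⟩ := h
  have hedge : ∀ {r : Triple} {e}, e ∈ r.edges → r.has e.1 = true ∧ r.has e.2 = true := by
    intro r e he
    simp only [Triple.edges, List.mem_cons, List.not_mem_nil, or_false] at he
    rcases he with rfl | rfl | rfl <;> simp [Triple.has_iff]
  have hne : f.1 ≠ f.2 := by
    simp only [Triple.edges, List.mem_cons, List.not_mem_nil, or_false] at hf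
    rcases hf with rfl | rfl | rfl <;> simp only [ne_eq] <;> omega
  obtain ⟨he1, he2⟩ := hedge he
  obtain ⟨hf1, hf2⟩ := hedge hf
  have hmid : midpoint ℝ (pt e.1) (pt e.2) = midpoint ℝ (pt f.1) (pt f.2) := by
    have h0' : ((e.1 % 5 : ℕ) : ℝ) + (e.2 % 5 : ℕ) = (f.1 % 5 : ℕ) + (f.2 % 5 : ℕ) := by
      exact_mod_cast h0
    have h1' : ((e.1 / 5 % 5 : ℕ) : ℝ) + (e.2 / 5 % 5 : ℕ) =
        (f.1 / 5 % 5 : ℕ) + (f.2 / 5 % 5 : ℕ) := by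
      exact_mod_cast h1
    have h2' : ((e.1 / 25 : ℕ) : ℝ) + (e.2 / 25 : ℕ) = (f.1 / 25 : ℕ) + (f.2 / 25 : ℕ) := by
      exact_mod_cast h2
    rw [midpoint_eq_smul_add, midpoint_eq_smul_add]
    congr 1
    ext n
    fin_cases n
    exacts [h0', h1', h2']
  have hinS : ∀ {i}, s.has i = true → pt i ∈ convexHull ℝ (s.tet : Set ℝ³) := fun hi =>
    subset_convexHull ℝ _ ((Triple.pt_mem_tet (hsi _ hi)).2 hi)
  have hpt : pt f.1 ≠ pt f.2 := pt_injective.ne hne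
  have hsub := hT.subset_of_mem ht hs (G := {pt f.1, pt f.2}) (w := fun _ => 1 / 2)
    (by
      rw [Finset.insert_subset_iff, Finset.singleton_subset_iff, Triple.pt_mem_tet (hti _ hf1),
        Triple.pt_mem_tet (hti _ hf2)]
      exact ⟨hf1, hf2⟩) (by simp) (by rw [Finset.sum_pair hpt]; norm_num)
    (by
      rw [Finset.sum_pair hpt]
      convert (convex_convexHull ℝ _).midpoint_mem (hinS he1) (hinS he2) using 1
      rw [hmid, midpoint_eq_smul_add, smul_add]
      simp)
  rw [Finset.insert_subset_iff, Finset.singleton_subset_iff, Triple.pt_mem_tet (hti _ hf1),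
    Triple.pt_mem_tet (hti _ hf2)] at hsub
  simp [hsub] at hsf

theorem Triple.tet_injOn {s t : Triple} (hs : s ∈ unimodularTriples A)
    (ht : t ∈ unimodularTriples A)
    (h : s.tet = t.tet) : s = t := by
  have hhas : ∀ i ∈ ptIdx, s.has i = true ↔ t.has i = true := by
    intro i hi
    rw [← Triple.pt_mem_tet hi, h, Triple.pt_mem_tet hi]
  have hst : ∀ i, s.has i = true → t.has i = true := fun i hi =>
    (hhas i (mem_ptIdx_of_mem_ptsOf (mem_ptsOf_of_has hs hi))).1 hi
  obtain ⟨h1, h2⟩ := lt_of_mem_unimodularTriples hs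
  obtain ⟨h3, h4⟩ := lt_of_mem_unimodularTriples ht
  obtain ⟨i, j, k⟩ := s
  obtain ⟨i', j', k'⟩ := t
  simp only [Triple.has_iff, forall_eq_or_imp, forall_eq] at hst
  simp only [Prod.mk.injEq]
  simp only at h1 h2 h3 h4
  omega

theorem ncard_isRUC {r : List ℕ × List ℕ} (hr : checkPolytope r = true) :
    isClosedSurface (inducedTriples (facetsOf r) baseWeight) = true ∧
      {T | IsRUC (polyOf (facetsOf r)) T}.ncard = r.2.length + 1 := by
  obtain ⟨n, l⟩ := r
  simp only [checkPolytope, Bool.and_eq_true] at hr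
  obtain ⟨hbase, hr⟩ := hr
  refine ⟨hbase, ?_⟩
  generalize facetsOf (n, l) = A at *
  have hA := polyOf_subset_Delta4 hbase
  have hP := convex_polyOf A
  have hi : (interior (polyOf A)).Nonempty := ⟨_, pOne_mem_interior_polyOf A⟩
  have hB := isRUC_inducedTriang hbase
  have hsimp : ∀ {T}, IsRUC (polyOf A) T → ∀ S ∈ T, S.card = 4 →
      ∃ t ∈ unimodularTriples A, S = t.tet := fun hT S hS h4 =>
    exists_eq_tet_of_isRUC hA hT.1 hT.2.1 hT.2.2.1 hS h4
  match l with
  | [] =>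
    simp only [List.all_eq_true] at hr
    have : {T | IsRUC (polyOf A) T} = {inducedTriang A baseWeight} := by
      refine Subset.antisymm (fun T hT => ?_) (by rintro _ rfl; exact hB)
      refine hB.1.eq_of_forall_mem hT.1 hP hi fun S hS h4 => ?_
      obtain ⟨t, ht, rfl⟩ := hsimp hT S hS h4
      exact ⟨t, mem_inducedTriples.2 ⟨ht, hr t ht⟩, subset_rfl⟩
    rw [this, ncard_singleton]
    rfl
  | [c] =>
    simp only [Bool.and_eq_true, List.any_eq_true, List.all_eq_true, Bool.or_eq_true,
      Bool.not_eq_true'] at hr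
    obtain ⟨hc, ⟨t₀, ht₀, hlt₀⟩, hor, hconf⟩ := hr
    have hC := isRUC_inducedTriang hc
    have hne : inducedTriang A baseWeight ≠ inducedTriang A c := by
      intro h
      have hmem : t₀.tet ∈ inducedTriang A c := h ▸ ⟨t₀, ht₀, subset_rfl⟩
      have hu₀ := (mem_inducedTriples.1 ht₀).1
      obtain ⟨t, ht, he⟩ := exists_eq_tet hmem (Triple.card_tet hu₀)
      rw [mem_inducedTriples] at ht
      rw [Triple.tet_injOn hu₀ ht.1 he, ht.2] at hlt₀
      exact Bool.noConfusion hlt₀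
    have : {T | IsRUC (polyOf A) T} = {inducedTriang A baseWeight, inducedTriang A c} := by
      refine Subset.antisymm (fun T hT => ?_) ?_
      · by_contra hcon
        simp only [mem_insert_iff, mem_singleton_iff, not_or] at hcon
        have h1 : ∃ t ∈ unimodularTriples A, t.tet ∈ T ∧ isLower (ptsOf A) baseWeight t ≠ true := by
          by_contra! h
          refine hcon.1 (hB.1.eq_of_forall_mem hT.1 hP hi fun S hS h4 => ?_)
          obtain ⟨t, ht, rfl⟩ := hsimp hT S hS h4
          exact ⟨t, mem_inducedTriples.2 ⟨ht, h t ht hS⟩, subset_rfl⟩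
        have h2 : ∃ t ∈ unimodularTriples A, t.tet ∈ T ∧ isLower (ptsOf A) c t ≠ true := by
          by_contra! h
          refine hcon.2 (hC.1.eq_of_forall_mem hT.1 hP hi fun S hS h4 => ?_)
          obtain ⟨t, ht, rfl⟩ := hsimp hT S hS h4
          exact ⟨t, mem_inducedTriples.2 ⟨ht, h t ht hS⟩, subset_rfl⟩
        obtain ⟨t, ht, htT, htl⟩ := h1
        obtain ⟨s, hs, hsT, hsl⟩ := h2
        have hs' := mem_inducedTriples.2 ⟨hs, (hor s hs).resolve_right hsl⟩
        have ht' := mem_inducedTriples.2 ⟨ht, (hor t ht).resolve_left htl⟩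
        have := ((hconf s hs').resolve_left hsl t ht').resolve_left htl
        obtain ⟨h12, h23⟩ := lt_of_mem_unimodularTriples ht
        rw [conflict_eq_false hT.1 hsT htT
          (fun i hi => mem_ptIdx_of_mem_ptsOf (mem_ptsOf_of_has hs hi))
          (fun i hi => mem_ptIdx_of_mem_ptsOf (mem_ptsOf_of_has ht hi)) h12 h23] at this
        exact Bool.noConfusion this
      · rintro T (rfl | rfl)
        exacts [hB, hC]
    rw [this, ncard_pair hne]
    rfl
  | _ :: _ :: _ => simp at hr

end

theorem forceList_eq {α : Type} (l : List ℕ) (k : List ℕ → α) : forceList l k = k l := by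
  induction l generalizing k with
  | nil => rfl
  | cons a l ih => rw [forceList, force_eq, ih]

theorem nodup_of_distinctNums {l : List ℕ} (h : distinctNums l = true) : l.Nodup := by
  induction l with
  | nil => exact List.nodup_nil
  | cons a l ih =>
    rw [distinctNums, Bool.and_eq_true, List.all_eq_true] at h
    refine List.nodup_cons.2 ⟨fun ha => ?_, ih h.2⟩
    have := h.1 a ha
    simp at this

theorem nodup_map_pointMask : (polytopeData.map pointMask).Nodup := by
  have h := orbitsMinimal_eq
  rw [orbitsMinimal, forceList_eq, Bool.and_eq_true] at h
  exact nodup_of_distinctNums h.2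

theorem maskOf_land {l m : List ℕ} (h : ∀ i ∈ l, i ∈ m) :
    Nat.land (maskOf l) (maskOf m) = maskOf l := by
  change maskOf l &&& maskOf m = _
  refine Nat.eq_of_testBit_eq fun i => ?_
  rw [Nat.testBit_and, Bool.and_eq_left_iff_imp, testBit_maskOf, testBit_maskOf]
  exact h i

theorem orbit_rigid {q r : List ℕ × List ℕ} (hq : q ∈ polytopeData) (hr : r ∈ polytopeData)
    {s : ℕ × ℕ × ℕ} (hs : s ∈ permCodes)
    (h : ∀ i ∈ ptsOf (facetsOf q), permIdx s i ∈ ptsOf (facetsOf r)) :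
    q = r ∧ ∀ i ∈ ptsOf (facetsOf r), ∃ j ∈ ptsOf (facetsOf q), permIdx s j = i := by
  have hmin := orbitsMinimal_eq
  simp only [orbitsMinimal, forceList_eq, Bool.and_eq_true, List.all_eq_true, orbitMinimal,
    force_eq] at hmin
  have h1 := hmin.1 q hq _ (List.mem_map_of_mem hr) _ (List.mem_map_of_mem hs)
  have hland : Nat.land (maskOf ((ptsOf (facetsOf q)).map (permIdx s))) (pointMask r) =
      maskOf ((ptsOf (facetsOf q)).map (permIdx s)) :=
    maskOf_land fun i hi => by
      obtain ⟨j, hj, rfl⟩ := List.mem_map.1 hi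
      exact h j hj
  rw [hland, Nat.beq_refl, cond_true, Bool.and_eq_true, Nat.beq_eq, Nat.beq_eq] at h1
  refine ⟨List.inj_on_of_nodup_map nodup_map_pointMask hq hr h1.2, fun i hi => ?_⟩
  rw [pointMask] at h1
  rw [← List.mem_map, ← testBit_maskOf, h1.1, testBit_maskOf]
  exact hi

theorem checkPolytope_of_mem {r : List ℕ × List ℕ} (hr : r ∈ polytopeData) :
    checkPolytope r = true :=
  List.all_eq_true.1 checkPolytope_all r hr

theorem isCanonicalSub_of_mem {r : List ℕ × List ℕ} (hr : r ∈ polytopeData) :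
    IsCanonicalSub (polyOf (facetsOf r)) :=
  isCanonicalSub_polyOf (ncard_isRUC (checkPolytope_of_mem hr)).1

/-- The representatives lie in different orbits, and no image of one of them lies properly in
another one. -/
theorem image_polyOf_rigid {q r : List ℕ × List ℕ} (hq : q ∈ polytopeData) (hr : r ∈ polytopeData)
    {g : ℝ³ ≃ᵃ[ℝ] ℝ³} (hg : g '' Delta4 = Delta4)
    (h : g '' polyOf (facetsOf q) ⊆ polyOf (facetsOf r)) :
    q = r ∧ g '' polyOf (facetsOf q) = polyOf (facetsOf r) := by
  obtain ⟨σ, hσ⟩ := exists_eq_barySym g hg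
  have hpt : ∀ i ∈ ptIdx, g (pt i) = pt (permIdx (σ 0, σ 1, σ 2) i) := fun i hi => by
    rw [hσ, barySym_pt σ hi]
  have hidx : ∀ s ∈ permCodes, ∀ i ∈ ptIdx, permIdx s i ∈ ptIdx := by decide +kernel
  obtain ⟨hqr, hsurj⟩ := orbit_rigid hq hr (exists_mem_permCodes σ) fun i hi => by
    have hi' := mem_ptIdx_of_mem_ptsOf hi
    rw [← pt_mem_polyOf (hidx _ (exists_mem_permCodes σ) i hi'), ← hpt i hi']
    exact h (mem_image_of_mem g ((pt_mem_polyOf hi').2 hi))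
  refine ⟨hqr, h.antisymm ((isCanonicalSub_of_mem hr).1.subset_of
    ((convex_polyOf _).affine_image g.toAffineMap)
    ⟨pOne, pOne_mem_polyOf _, (hσ pOne).trans (barySym_pOne σ)⟩ fun i hi hir => ?_)⟩
  obtain ⟨j, hj, hji⟩ := hsurj i ((pt_mem_polyOf hi).1 hir)
  have hj' := mem_ptIdx_of_mem_ptsOf hj
  exact ⟨pt j, (pt_mem_polyOf hj').2 hj, by rw [← hji]; exact hpt j hj'⟩

theorem exists_image_polyOf_subset {P : Set ℝ³} (hP : IsCanonicalSub P) (hR : IsReflexive P pOne) :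
    ∃ r ∈ polytopeData, ∃ σ, barySym σ '' polyOf (facetsOf r) ⊆ P := by
  obtain ⟨r, hr, s, hs, h⟩ := hR.exists_orbit_subset hP
  obtain ⟨σ, rfl⟩ := exists_perm_of_mem_permCodes s hs
  refine ⟨r, hr, σ, ?_⟩
  rw [image_subset_iff]
  have hconv : Convex ℝ P := by
    rw [hP.1.2]
    exact convex_convexHull ℝ _
  refine (isCanonicalSub_of_mem hr).1.subset_of
    (hconv.affine_preimage (barySym σ).toAffineMap) ?_ fun i hi hir => ?_
  · rw [mem_preimage, barySym_pOne]
    exact interior_subset hP.2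
  · change barySym σ (pt i) ∈ P
    rw [barySym_pt σ hi]
    exact h i ((pt_mem_polyOf hi).1 hir)

theorem isMinimalRefl_of_mem {r : List ℕ × List ℕ} (hr : r ∈ polytopeData) :
    IsMinimalRefl (polyOf (facetsOf r)) := by
  refine ⟨isCanonicalSub_of_mem hr, isReflexive_polyOf _, fun Q hQ hQR hss => ?_⟩
  obtain ⟨q, hq, σ, hσ⟩ := exists_image_polyOf_subset hQ hQR
  have := (image_polyOf_rigid hq hr (image_barySym_Delta4 σ) (hσ.trans hss.1)).2
  exact hss.2 (this ▸ hσ)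

theorem IsMinimalRefl.exists_eq_image {P : Set ℝ³} (hP : IsMinimalRefl P) :
    ∃ r ∈ polytopeData, ∃ σ, barySym σ '' polyOf (facetsOf r) = P := by
  obtain ⟨r, hr, σ, hσ⟩ := exists_image_polyOf_subset hP.1 hP.2.1
  refine ⟨r, hr, σ, by_contra fun hne => ?_⟩
  exact hP.2.2 _ ((isCanonicalSub_of_mem hr).image_barySym σ) (isReflexive_image_polyOf _ σ)
    (hσ.ssubset_of_ne hne)

/-- The set of representatives. -/
def minimalPolytopes : Set (Set ℝ³) := (fun r => polyOf (facetsOf r)) '' {r | r ∈ polytopeData}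

theorem injOn_polyOf_facetsOf :
    InjOn (fun r => polyOf (facetsOf r)) {r | r ∈ polytopeData} := by
  intro q hq r hr h
  refine (image_polyOf_rigid hq hr (g := AffineEquiv.refl ℝ ℝ³) ?_ ?_).1
  · simp
  · simpa using h.le

theorem ncard_setOf_mem_minimalPolytopes (p : Set ℝ³ → Prop) (b : List ℕ × List ℕ → Bool)
    (h : ∀ r ∈ polytopeData, p (polyOf (facetsOf r)) ↔ b r = true) :
    {P ∈ minimalPolytopes | p P}.ncard = (polytopeData.filter b).length := by
  have hset : {P ∈ minimalPolytopes | p P} =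
      (fun r => polyOf (facetsOf r)) '' {r | r ∈ polytopeData.filter b} := by
    ext P
    simp only [minimalPolytopes, mem_ofPred_eq, mem_image, List.mem_filter]
    constructor
    · rintro ⟨⟨r, hr, rfl⟩, hp⟩
      exact ⟨r, ⟨hr, (h r hr).1 hp⟩, rfl⟩
    · rintro ⟨r, ⟨hr, hb⟩, rfl⟩
      exact ⟨⟨r, hr, rfl⟩, (h r hr).2 hb⟩
  have hnodup : (polytopeData.filter b).Nodup := (nodup_map_pointMask.of_map _).filter _
  have hinj : InjOn (fun r => polyOf (facetsOf r)) {r | r ∈ polytopeData.filter b} :=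
    injOn_polyOf_facetsOf.mono fun r hr => (List.mem_filter.1 hr).1
  rw [hset, hinj.ncard_image, ← List.toFinset_card_of_nodup hnodup, ← ncard_coe_finset,
    List.coe_toFinset]

theorem IsMinimalRefl.existsUnique_symEquiv {P : Set ℝ³} (hP : IsMinimalRefl P) :
    ∃! Q, Q ∈ minimalPolytopes ∧ SymEquiv P Q := by
  obtain ⟨r, hr, σ, rfl⟩ := hP.exists_eq_image
  refine ⟨polyOf (facetsOf r), ⟨⟨r, hr, rfl⟩, barySym σ⁻¹, image_barySym_Delta4 _, ?_⟩, ?_⟩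
  · simp [image_image, barySym_inv_apply]
  · rintro _ ⟨⟨q, hq, rfl⟩, g, hg, hgP⟩
    have hmap : ∀ X, (barySym σ).trans g '' X = g '' (barySym σ '' X) := fun X => by
      rw [image_image]
      rfl
    have := (image_polyOf_rigid hr hq (g := (barySym σ).trans g)
      (by rw [hmap, image_barySym_Delta4, hg]) (by rw [hmap]; exact hgP.le)).1
    rw [this]

theorem ncard_isRUC_eq_iff {r : List ℕ × List ℕ} (hr : r ∈ polytopeData) (n : ℕ) :
    {T | IsRUC (polyOf (facetsOf r)) T}.ncard = n + 1 ↔ (r.2.length == n) = true := by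
  rw [(ncard_isRUC (checkPolytope_of_mem hr)).2, beq_iff_eq, Nat.add_right_cancel_iff]

theorem stmt12 :
    ∃ R : Set (Set (Fin 3 → ℝ)), R.Finite ∧ R.ncard = 115 ∧
      (∀ P ∈ R, IsMinimalRefl P) ∧
      (∀ P, IsMinimalRefl P → ∃! Q, Q ∈ R ∧ SymEquiv P Q) ∧
      {P ∈ R | {T | IsRUC P T}.ncard = 2}.ncard = 29 ∧
      {P ∈ R | {T | IsRUC P T}.ncard = 1}.ncard = 86 := by
  obtain ⟨h115, h29, h86⟩ := polytopeData_counts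
  refine ⟨minimalPolytopes, (List.finite_toSet _).image _, ?_, ?_,
    fun P hP => hP.existsUnique_symEquiv, ?_, ?_⟩
  · have := ncard_setOf_mem_minimalPolytopes (fun _ => True) (fun _ => true) (by simp)
    simpa [h115] using this
  · rintro _ ⟨r, hr, rfl⟩
    exact isMinimalRefl_of_mem hr
  · rw [← h29]
    exact ncard_setOf_mem_minimalPolytopes _ _ fun r hr => ncard_isRUC_eq_iff hr 1
  · rw [← h86]
    exact ncard_setOf_mem_minimalPolytopes _ _ fun r hr => ncard_isRUC_eq_iff hr 0
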